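/- Let m ∈ ℝ, t ∈ [0,1] and a ∈ BS^m_{f,t}(ℝ^{3n}). For j ∈ ℕ define c_j ∈ C^∞(ℝ^{2n}) by c_j(q, p) := (1/j!) [ (i ∂_p·∂_{q'})^j A ](q, p, q')|_{q'=0}, where A(q, p, q') := a(q + (1-t)q', p, q - t q') and ∂_p·∂_{q'} := Σ_{l=1}^n ∂_{p_l} ∂_{q'_l}. Then each c_j belongs to S^{m-j}_f(ℝ^{2n}), and for every ℏ ∈ (0,1] there exists b^t ∈ S^m_f(ℝ^{2n}) with Op_ℏ(a)u = Op^t_ℏ(b^t)u for all u ∈ C_c^∞(ℝⁿ), such that for all N, N₀ ∈ ℕ there exist C > 0 and N' ∈ ℕ, independent of a and of ℏ ∈ (0,1], with | b^t − Σ_{j=0}^N ℏ^j c_j |_{S^{m-N-1}_f, N₀} ≤ C ℏ^{N+1} |a|_{BS^m_{f,t}, N'}. -/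

import Mathlib

open MeasureTheory Finset

noncomputable section

/-- Points of `ℝⁿ` (with `n = d + 1`) split as `q = (r, θ) ∈ ℝ × ℝ^d`. -/
abbrev Q (d : ℕ) : Type := ℝ × (Fin d → ℝ)

/-- The coordinate direction `∂_r`. -/
def eR (d : ℕ) : Q d := ((1 : ℝ), 0)

/-- The coordinate direction `∂_{θ_i}`. -/
def eTh (d : ℕ) (i : Fin d) : Q d := ((0 : ℝ), Pi.single i 1)

/-- Directional derivative of a complex-valued function. -/
def dirD {E : Type*} [NormedAddCommGroup E] [NormedSpace ℝ E]
    (v : E) (g : E → ℂ) : E → ℂ :=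
  fun x => fderiv ℝ g x v

/-- Multiindices `α = (α₀, α')` split as in the paper. -/
abbrev MIdx (d : ℕ) : Type := ℕ × (Fin d → ℕ)

/-- `|α| = α₀ + |α'|`. -/
def deg {d : ℕ} (α : MIdx d) : ℕ := α.1 + ∑ i, α.2 i

/-- `|α'|`, the angular part of a multiindex. -/
def degA {d : ℕ} (α : MIdx d) : ℕ := ∑ i, α.2 i

/-- `∂_q^α` acting on functions on `ℝⁿ = ℝ × ℝ^d`. -/
def mderiv1 {d : ℕ} (α : MIdx d) (g : Q d → ℂ) : Q d → ℂ :=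
  (dirD (eR d))^[α.1] <|
    (List.finRange d).foldr (fun i h => (dirD (eTh d i))^[α.2 i] h) g

/-- `∂_q^α ∂_p^β` acting on functions on phase space. -/
def mderiv2 {d : ℕ} (α β : MIdx d) (g : Q d × Q d → ℂ) : Q d × Q d → ℂ :=
  (dirD ((eR d, 0) : Q d × Q d))^[α.1] <|
  (List.finRange d).foldr (fun i h => (dirD ((eTh d i, 0) : Q d × Q d))^[α.2 i] h) <|
  (dirD (((0 : Q d), eR d) : Q d × Q d))^[β.1] <|
  (List.finRange d).foldr (fun i h => (dirD (((0 : Q d), eTh d i) : Q d × Q d))^[β.2 i] h) g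

/-- `∂_q^α ∂_p^β ∂_{q'}^γ` acting on amplitudes `a(q, p, q')`. -/
def mderiv3 {d : ℕ} (α β γ : MIdx d) (g : Q d × Q d × Q d → ℂ) : Q d × Q d × Q d → ℂ :=
  (dirD ((eR d, 0, 0) : Q d × Q d × Q d))^[α.1] <|
  (List.finRange d).foldr (fun i h => (dirD ((eTh d i, 0, 0) : Q d × Q d × Q d))^[α.2 i] h) <|
  (dirD (((0 : Q d), eR d, 0) : Q d × Q d × Q d))^[β.1] <|
  (List.finRange d).foldr (fun i h => (dirD (((0 : Q d), eTh d i, 0) : Q d × Q d × Q d))^[β.2 i] h) <|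
  (dirD (((0 : Q d), (0 : Q d), eR d) : Q d × Q d × Q d))^[γ.1] <|
  (List.finRange d).foldr (fun i h => (dirD (((0 : Q d), (0 : Q d), eTh d i) : Q d × Q d × Q d))^[γ.2 i] h) g

/-- `⟨p⟩ = (1 + ρ² + |η|²)^{1/2}`. -/
def brP {d : ℕ} (p : Q d) : ℝ := Real.sqrt (1 + p.1 ^ 2 + ∑ i, (p.2 i) ^ 2)

/-- `⟨ρ ⊕ f(r)⁻¹ η⟩` evaluated at a phase-space point. -/
def brF {d : ℕ} (f : ℝ → ℝ) (x : Q d × Q d) : ℝ :=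
  Real.sqrt (1 + x.2.1 ^ 2 + ∑ i, (x.2.2 i / f x.1.1) ^ 2)

/-- The standing assumption on `f : ℝ → [1, ∞)`: smooth, `f ≥ 1`, and all derivatives
of `log f` of order `≥ 1` are bounded. -/
def GoodF (f : ℝ → ℝ) : Prop :=
  ContDiff ℝ (⊤ : ℕ∞) f ∧ (∀ r, 1 ≤ f r) ∧
    ∀ j : ℕ, 1 ≤ j → ∃ C : ℝ, ∀ r, |iteratedDeriv j (fun s => Real.log (f s)) r| ≤ C

/-- Membership in the symbol class `S^m_f(ℝ^{2n})`. -/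
def IsSymbol {d : ℕ} (f : ℝ → ℝ) (m : ℝ) (a : Q d × Q d → ℂ) : Prop :=
  ContDiff ℝ (⊤ : ℕ∞) a ∧
    ∀ α β : MIdx d, ∃ C : ℝ, ∀ x : Q d × Q d,
      ‖mderiv2 α β a x‖ ≤ C * f x.1.1 ^ ((degA α : ℝ) - (degA β : ℝ)) * brF f x ^ (m - (deg β : ℝ))

/-- The finite set of multiindices of length `≤ N`. -/
def idxSet (d N : ℕ) : Finset (MIdx d) :=
  ((Finset.range (N + 1)) ×ˢ Fintype.piFinset fun _ : Fin d => Finset.range (N + 1)).filter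
    fun α => deg α ≤ N

/-- The seminorm `|a|_{S^m_f, N}`. -/
def symNorm {d : ℕ} (f : ℝ → ℝ) (m : ℝ) (N : ℕ) (a : Q d × Q d → ℂ) : ℝ :=
  ∑ α ∈ idxSet d N, ∑ β ∈ idxSet d N,
    if deg α + deg β ≤ N then
      ⨆ x : Q d × Q d,
        f x.1.1 ^ (-(degA α : ℝ) + (degA β : ℝ)) * brF f x ^ (-m + (deg β : ℝ)) *
          ‖mderiv2 α β a x‖
    else 0

/-- `p · q`. -/
def qdot {d : ℕ} (p q : Q d) : ℝ := p.1 * q.1 + ∑ i, p.2 i * q.2 i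

/-- The oscillating factor `e^{i p · v / ℏ}`. -/
def ephase {d : ℕ} (ℏ : ℝ) (p v : Q d) : ℂ :=
  Complex.exp (Complex.I * Complex.ofReal (qdot p v) / Complex.ofReal ℏ)

/-- The quantization `Op^t_ℏ(a)` of a symbol, acting on functions (trivialized half-densities). -/
def Op {d : ℕ} (ℏ t : ℝ) (a : Q d × Q d → ℂ) (u : Q d → ℂ) : Q d → ℂ :=
  fun q => ((2 * Real.pi * ℏ) ^ (d + 1) : ℝ)⁻¹ •
    ∫ p : Q d, ∫ q' : Q d,
      a (t • q + (1 - t) • q', p) * ephase ℏ p (q - q') * u q'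

/-- Membership in `C_c^∞(ℝⁿ)`. -/
def IsCc {d : ℕ} (u : Q d → ℂ) : Prop := ContDiff ℝ (⊤ : ℕ∞) u ∧ HasCompactSupport u

/-- The `L²` inner product `⟨w, v⟩ = ∫ w \bar v`. -/
def l2inner {d : ℕ} (w v : Q d → ℂ) : ℂ := ∫ q : Q d, w q * (starRingEnd ℂ) (v q)

/-- The `L²` norm. -/
def l2norm {d : ℕ} (u : Q d → ℂ) : ℝ := (∫ q : Q d, ‖u q‖ ^ 2) ^ (1 / 2 : ℝ)

/-- `Σ_{|β| ≤ N} sup |∂^β u|`. -/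
def ckNorm {d : ℕ} (N : ℕ) (u : Q d → ℂ) : ℝ :=
  ∑ β ∈ idxSet d N, ⨆ q : Q d, ‖mderiv1 β u q‖

/-- `⟨ρ ⊕ f(tr + (1-t)r')⁻¹ η⟩` evaluated at a point `(q, p, q')`. -/
def brFA {d : ℕ} (f : ℝ → ℝ) (t : ℝ) (x : Q d × Q d × Q d) : ℝ :=
  Real.sqrt (1 + x.2.1.1 ^ 2 + ∑ i, (x.2.1.2 i / f (t * x.1.1 + (1 - t) * x.2.2.1)) ^ 2)

/-- Membership in the amplitude class `BS^m_{f,t}(ℝ^{3n})`. -/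
def IsAmp {d : ℕ} (f : ℝ → ℝ) (m t : ℝ) (a : Q d × Q d × Q d → ℂ) : Prop :=
  ContDiff ℝ (⊤ : ℕ∞) a ∧
    ∀ α β γ : MIdx d, ∃ C : ℝ, ∀ x : Q d × Q d × Q d,
      ‖mderiv3 α β γ a x‖ ≤
        C * f (t * x.1.1 + (1 - t) * x.2.2.1) ^ ((degA α : ℝ) - (degA β : ℝ) + (degA γ : ℝ)) *
          brFA f t x ^ (m - (deg β : ℝ))

/-- The seminorm `|a|_{BS^m_{f,t}, N}`. -/
def ampNorm {d : ℕ} (f : ℝ → ℝ) (m t : ℝ) (N : ℕ) (a : Q d × Q d × Q d → ℂ) : ℝ :=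
  ∑ α ∈ idxSet d N, ∑ β ∈ idxSet d N, ∑ γ ∈ idxSet d N,
    if deg α + deg β + deg γ ≤ N then
      ⨆ x : Q d × Q d × Q d,
        f (t * x.1.1 + (1 - t) * x.2.2.1) ^ (-(degA α : ℝ) + (degA β : ℝ) - (degA γ : ℝ)) *
          brFA f t x ^ (-m + (deg β : ℝ)) * ‖mderiv3 α β γ a x‖
    else 0

/-- The quantization of an amplitude `a(q, p, q')`. -/
def OpAmp {d : ℕ} (ℏ : ℝ) (a : Q d × Q d × Q d → ℂ) (u : Q d → ℂ) : Q d → ℂ :=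
  fun q => ((2 * Real.pi * ℏ) ^ (d + 1) : ℝ)⁻¹ •
    ∫ p : Q d, ∫ q' : Q d, a (q, p, q') * ephase ℏ p (q - q') * u q'


/-- The operator `∂_p · ∂_{q'} = ∂_ρ ∂_{r'} + Σ_i ∂_{η_i} ∂_{θ'_i}` on amplitudes. -/
def dpdq' {d : ℕ} (g : Q d × Q d × Q d → ℂ) : Q d × Q d × Q d → ℂ :=
  fun x => dirD (((0 : Q d), eR d, 0) : Q d × Q d × Q d)
      (dirD (((0 : Q d), (0 : Q d), eR d) : Q d × Q d × Q d) g) x +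
    ∑ i : Fin d, dirD (((0 : Q d), eTh d i, 0) : Q d × Q d × Q d)
      (dirD (((0 : Q d), (0 : Q d), eTh d i) : Q d × Q d × Q d) g) x

/-- The `j`-th term of the asymptotic expansion of the symbol of an amplitude. -/
def cJ (d : ℕ) (t : ℝ) (a : Q d × Q d × Q d → ℂ) (j : ℕ) : Q d × Q d → ℂ :=
  fun x => (Complex.I ^ j / (j.factorial : ℂ)) *
    ((dpdq' (d := d))^[j] (fun y : Q d × Q d × Q d =>
      a (y.1 + (1 - t) • y.2.2, y.2.1, y.1 - t • y.2.2))) (x.1, x.2, 0)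



section HBasic

variable {E : Type*} [NormedAddCommGroup E] [NormedSpace ℝ E]
variable {G : Type*} [NormedAddCommGroup G] [NormedSpace ℝ G]

abbrev Sm {E : Type*} [NormedAddCommGroup E] [NormedSpace ℝ E]
    {F : Type*} [NormedAddCommGroup F] [NormedSpace ℝ F] (g : E → F) : Prop :=
  ContDiff ℝ (⊤ : ℕ∞) g

lemma Sm.diff {F : Type*} [NormedAddCommGroup F] [NormedSpace ℝ F] {g : E → F}
    (h : Sm g) : Differentiable ℝ g :=
  ContDiff.differentiable h (by simp)

lemma Sm.nat {F : Type*} [NormedAddCommGroup F] [NormedSpace ℝ F] {g : E → F}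
    (h : Sm g) (k : ℕ) : ContDiff ℝ k g :=
  ContDiff.of_le h (by exact_mod_cast le_top)

lemma Sm.fderiv' {F : Type*} [NormedAddCommGroup F] [NormedSpace ℝ F] {g : E → F}
    (h : Sm g) : Sm (fun x => fderiv ℝ g x) :=
  ContDiff.fderiv_right h (by simp)

lemma Sm.dirD {g : E → ℂ} (h : Sm g) (v : E) : Sm (dirD v g) := by
  unfold _root_.dirD
  exact h.fderiv'.clm_apply contDiff_const

lemma dirD_add {g h : E → ℂ} (hg : Sm g) (hh : Sm h) (v : E) :
    dirD v (fun x => g x + h x) = fun x => dirD v g x + dirD v h x := by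
  funext x
  simp only [dirD]
  rw [fderiv_fun_add (hg.diff x) (hh.diff x)]; rfl

lemma dirD_sub {g h : E → ℂ} (hg : Sm g) (hh : Sm h) (v : E) :
    dirD v (fun x => g x - h x) = fun x => dirD v g x - dirD v h x := by
  funext x
  simp only [dirD]
  rw [fderiv_fun_sub (hg.diff x) (hh.diff x)]; rfl

lemma dirD_mul {g h : E → ℂ} (hg : Sm g) (hh : Sm h) (v : E) :
    dirD v (fun x => g x * h x) = fun x => dirD v g x * h x + g x * dirD v h x := by
  funext x
  simp only [dirD]
  rw [fderiv_fun_mul (hg.diff x) (hh.diff x)]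
  simp; ring

lemma dirD_const_mul {g : E → ℂ} (hg : Sm g) (c : ℂ) (v : E) :
    dirD v (fun x => c * g x) = fun x => c * dirD v g x := by
  funext x
  simp only [dirD]
  rw [fderiv_const_mul (hg.diff x)]; rfl

lemma dirD_sum {ι : Type*} (s : Finset ι) {g : ι → E → ℂ} (hg : ∀ i, Sm (g i)) (v : E) :
    dirD v (fun x => ∑ i ∈ s, g i x) = fun x => ∑ i ∈ s, dirD v (g i) x := by
  funext x
  simp only [dirD]
  rw [fderiv_fun_sum (fun i _ => (hg i).diff x)]; simp

lemma dirD_comm {g : E → ℂ} (hg : Sm g) (v w : E) :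
    dirD v (dirD w g) = dirD w (dirD v g) := by
  funext x
  have h2 : ∀ a : E, ∀ b : E, dirD a (dirD b g) x = fderiv ℝ (fderiv ℝ g) x a b := by
    intro a b
    have : dirD b g = fun y => (fderiv ℝ g y) b := rfl
    rw [this]; simp only [dirD]
    rw [fderiv_clm_apply (hg.fderiv'.diff x) (differentiableAt_const _)]
    simp
  rw [h2, h2]
  have := (ContDiff.contDiffAt hg (x := x)).isSymmSndFDerivAt
    (by simp only [minSmoothness_of_isRCLikeNormedField]
        exact WithTop.coe_le_coe.2 (le_top : (2 : ℕ∞) ≤ ⊤))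
  exact this v w

lemma dirD_comp {g : G → ℂ} (hg : Sm g) (L : E →L[ℝ] G) (c : G) (v : E) :
    dirD v (fun x => g (L x + c)) = fun x => dirD (L v) g (L x + c) := by
  funext x
  simp only [dirD]
  have h1 : HasFDerivAt (fun x => L x + c) L x := (L.hasFDerivAt).add_const c
  have h2 := (hg.diff (L x + c)).hasFDerivAt.comp x h1
  have h3 : fderiv ℝ (fun x => g (L x + c)) x = _ := h2.fderiv
  rw [h3]; rfl

lemma dirD_vadd (g : E → ℂ) (v w : E) :
    dirD (v + w) g = fun x => dirD v g x + dirD w g x := by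
  funext x; simp [dirD]

lemma dirD_vsmul (g : E → ℂ) (c : ℝ) (v : E) :
    dirD (c • v) g = fun x => c * dirD v g x := by
  funext x; simp [dirD]

/-- bounds for all derivatives of order at most `k` -/
def Bd {F : Type*} [NormedAddCommGroup F] [NormedSpace ℝ F]
    (k : ℕ) (ω : E → ℝ) (C : ℝ) (Ψ : E → F) : Prop :=
  ∀ j ≤ k, ∀ x, ‖iteratedFDeriv ℝ j Ψ x‖ ≤ C * ω x

lemma Bd.mono {k l : ℕ} {ω : E → ℝ} {C : ℝ} {Ψ : E → ℂ} (h : Bd k ω C Ψ) (hl : l ≤ k) :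
    Bd l ω C Ψ := fun j hj x => h j (hj.trans hl) x

lemma Bd.mono' {k : ℕ} {ω ω' : E → ℝ} {C C' : ℝ} {Ψ : E → ℂ} (h : Bd k ω C Ψ)
    (hl : ∀ x, C * ω x ≤ C' * ω' x) :
    Bd k ω' C' Ψ := fun j hj x => (h j hj x).trans (hl x)

lemma Bd.val {k : ℕ} {ω : E → ℝ} {C : ℝ} {Ψ : E → ℂ} (h : Bd k ω C Ψ) (x : E) :
    ‖Ψ x‖ ≤ C * ω x := by simpa using h 0 (Nat.zero_le _) x

lemma Bd.add {k : ℕ} {ω : E → ℝ} {C C' : ℝ} {g h : E → ℂ} (sg : Sm g) (sh : Sm h)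
    (hg : Bd k ω C g) (hh : Bd k ω C' h) : Bd k ω (C + C') (fun x => g x + h x) := by
  intro j hj x
  have : iteratedFDeriv ℝ j (fun x => g x + h x) x
      = iteratedFDeriv ℝ j g x + iteratedFDeriv ℝ j h x :=
    iteratedFDeriv_add_apply (sg.nat j).contDiffAt (sh.nat j).contDiffAt
  rw [this]
  calc _ ≤ _ := norm_add_le _ _
    _ ≤ C * ω x + C' * ω x := add_le_add (hg j hj x) (hh j hj x)
    _ = _ := by ring

lemma Bd.neg {k : ℕ} {ω : E → ℝ} {C : ℝ} {g : E → ℂ}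
    (hg : Bd k ω C g) : Bd k ω C (fun x => - g x) := by
  intro j hj x
  have : iteratedFDeriv ℝ j (fun x => - g x) x = - iteratedFDeriv ℝ j g x :=
    iteratedFDeriv_neg_apply
  rw [this, norm_neg]; exact hg j hj x

lemma Bd.sub {k : ℕ} {ω : E → ℝ} {C C' : ℝ} {g h : E → ℂ} (sg : Sm g) (sh : Sm h)
    (hg : Bd k ω C g) (hh : Bd k ω C' h) : Bd k ω (C + C') (fun x => g x - h x) := by
  simpa [sub_eq_add_neg] using Bd.add sg (ContDiff.neg sh) hg hh.neg

lemma Bd.dirD {k : ℕ} {ω : E → ℝ} {C : ℝ} {g : E → ℂ} (sg : Sm g)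
    (hg : Bd (k + 1) ω C g) (v : E) : Bd k ω (‖v‖ * C) (dirD v g) := by
  intro j hj x
  have := norm_iteratedFDeriv_clm_apply_const (𝕜 := ℝ) (f := fderiv ℝ g) (c := v) (x := x) (n := j)
    (N := (⊤ : ℕ∞)) (ContDiff.contDiffAt sg.fderiv') (by exact_mod_cast le_top)
  refine le_trans this ?_
  rw [norm_iteratedFDeriv_fderiv, mul_assoc]
  exact mul_le_mul_of_nonneg_left (hg (j + 1) (by omega) x) (norm_nonneg _)

lemma Bd.mul {k : ℕ} {ω ω' : E → ℝ} {C C' : ℝ} {g h : E → ℂ} (sg : Sm g) (sh : Sm h)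
    (hg : Bd k ω C g) (hh : Bd k ω' C' h) :
    Bd k (fun x => ω x * ω' x) (2 ^ k * (C * C')) (fun x => g x * h x) := by
  intro j hj x
  have := norm_iteratedFDeriv_mul_le (𝕜 := ℝ) sg sh x (n := j) (by exact_mod_cast le_top)
  refine le_trans this ?_
  have h0 : 0 ≤ C * ω x := (norm_nonneg _).trans (hg.val x)
  have h0' : 0 ≤ C' * ω' x := (norm_nonneg _).trans (hh.val x)
  calc _ ≤ ∑ i ∈ range (j + 1), (j.choose i : ℝ) * ((C * ω x) * (C' * ω' x)) := by
        apply Finset.sum_le_sum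
        intro i hi
        rw [mul_assoc]
        apply mul_le_mul_of_nonneg_left _ (by positivity)
        have : i ≤ j := by simpa [Nat.lt_succ_iff] using hi
        exact mul_le_mul (hg i (by omega) x) (hh (j - i) (by omega) x) (norm_nonneg _) h0
    _ = 2 ^ j * ((C * ω x) * (C' * ω' x)) := by
        rw [← Finset.sum_mul]
        congr 1
        exact_mod_cast Nat.sum_range_choose j
    _ ≤ 2 ^ k * ((C * ω x) * (C' * ω' x)) := by
        apply mul_le_mul_of_nonneg_right _ (mul_nonneg h0 h0')
        exact pow_le_pow_right₀ (by norm_num) hj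
    _ = _ := by ring

lemma Bd.comp {F : Type*} [NormedAddCommGroup F] [NormedSpace ℝ F]
    {k : ℕ} {ω : G → ℝ} {C : ℝ} {g : G → F} (sg : Sm g)
    (hg : Bd k ω C g) (L : E →L[ℝ] G) (c : G) {A : ℝ} (hA : ‖L‖ ≤ A) (hA1 : 1 ≤ A) :
    Bd k (fun x => ω (L x + c)) (A ^ k * C) (fun x => g (L x + c)) := by
  intro j hj x
  have h1 : iteratedFDeriv ℝ j (fun x => g (L x + c)) x
      = (iteratedFDeriv ℝ j g (L x + c)).compContinuousLinearMap fun _ => L := by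
    have sg' : Sm (fun y => g (y + c)) := ContDiff.comp sg (contDiff_id.add contDiff_const)
    have := L.iteratedFDeriv_comp_right (f := fun y => g (y + c)) sg' x (i := j)
      (by exact_mod_cast le_top)
    rw [iteratedFDeriv_comp_add_right] at this
    exact this
  rw [h1]
  refine (ContinuousMultilinearMap.norm_compContinuousLinearMap_le _ _).trans ?_
  have h0 : 0 ≤ C * ω (L x + c) := (norm_nonneg _).trans (hg j hj _)
  have h2 : ∏ _i : Fin j, ‖L‖ ≤ A ^ k := by
    simp only [prod_const, card_univ, Fintype.card_fin]
    exact (pow_le_pow_left₀ (norm_nonneg _) hA j).trans (pow_le_pow_right₀ hA1 hj)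
  calc _ ≤ (C * ω (L x + c)) * A ^ k :=
        mul_le_mul (hg j hj _) h2 (by positivity) h0
    _ = _ := by ring

lemma onepi_ne (t : ℝ) : (1 + Complex.I * (t : ℂ)) ≠ 0 := by
  intro h
  have := congrArg Complex.re h
  simp at this

lemma onepi_norm (t : ℝ) : 1 + |t| ≤ 2 * ‖(1 + Complex.I * (t : ℂ))‖ := by
  have h1 := Complex.abs_re_le_norm (1 + Complex.I * (t : ℂ))
  have h2 := Complex.abs_im_le_norm (1 + Complex.I * (t : ℂ))
  simp at h1 h2
  linarith

lemma inv1_iter (j : ℕ) : iteratedDeriv j (fun t : ℝ => (1 + Complex.I * (t : ℂ))⁻¹)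
    = fun t : ℝ => ((-Complex.I) ^ j * (j.factorial : ℂ)) * ((1 + Complex.I * (t : ℂ))⁻¹) ^ (j + 1) := by
  induction j with
  | zero => simp
  | succ j ih =>
    rw [iteratedDeriv_succ, ih]
    funext t
    have h0 : HasDerivAt (fun t : ℝ => (1 + Complex.I * (t : ℂ))) Complex.I t := by
      have := ((Complex.ofRealCLM.hasDerivAt (x := t)).const_mul Complex.I).const_add 1
      simpa using this
    have h1 := ((h0.inv (onepi_ne t)).pow (j + 1)).const_mul
      ((-Complex.I) ^ j * (j.factorial : ℂ))
    have h2 := h1.deriv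
    refine Eq.trans ?_ (h2.trans ?_)
    · rfl
    · have := onepi_ne t
      simp [Nat.factorial_succ]
      field_simp
      ring

lemma sm_inv (lam : E →L[ℝ] ℝ) : Sm (fun x => (1 + Complex.I * ((lam x : ℝ) : ℂ))⁻¹) := by
  apply ContDiff.inv
  · exact contDiff_const.add (contDiff_const.mul (Complex.ofRealCLM.contDiff.comp lam.contDiff))
  · intro x; exact onepi_ne _

lemma bd_inv (k : ℕ) (lam : E →L[ℝ] ℝ) : ∃ C, 0 ≤ C ∧
    Bd k (fun x => (1 + |lam x|)⁻¹) C (fun x => (1 + Complex.I * ((lam x : ℝ) : ℂ))⁻¹) := by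
  have key : Bd k (fun t : ℝ => (1 + |t|)⁻¹) (2 * (k.factorial : ℝ))
      (fun t : ℝ => (1 + Complex.I * (t : ℂ))⁻¹) := by
    intro j hj t
    rw [norm_iteratedFDeriv_eq_norm_iteratedDeriv, inv1_iter]
    have h1 : (0 : ℝ) < ‖(1 + Complex.I * (t : ℂ))‖ := norm_pos_iff.2 (onepi_ne t)
    have h2 := onepi_norm t
    have h3 : (1 : ℝ) ≤ ‖(1 + Complex.I * (t : ℂ))‖ := by
      have h1 := Complex.abs_re_le_norm (1 + Complex.I * (t : ℂ))
      simpa using h1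
    simp only [norm_mul, norm_pow, norm_neg, Complex.norm_I, one_pow, one_mul, norm_inv,
      Complex.norm_natCast]
    have h4 : ‖(1 + Complex.I * (t : ℂ))‖⁻¹ ^ (j + 1) ≤ 2 * (1 + |t|)⁻¹ := by
      calc _ ≤ ‖(1 + Complex.I * (t : ℂ))‖⁻¹ ^ 1 := by
            apply pow_le_pow_of_le_one (by positivity) (inv_le_one_of_one_le₀ h3) (by omega)
        _ ≤ _ := by
            rw [pow_one, ← div_eq_mul_inv, inv_le_comm₀ h1 (by positivity), inv_div]
            linarith
    calc _ ≤ (k.factorial : ℝ) * (2 * (1 + |t|)⁻¹) := by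
          apply mul_le_mul _ h4 (by positivity) (by positivity)
          exact_mod_cast Nat.factorial_le hj
      _ = _ := by ring
  have s1 : Sm (fun t : ℝ => (1 + Complex.I * (t : ℂ))⁻¹) := by
    have := sm_inv (ContinuousLinearMap.id ℝ ℝ)
    simpa using this
  have := key.comp s1 lam 0 (A := max 1 ‖lam‖) (le_max_right _ _) (le_max_left _ _)
  refine ⟨_, ?_, by simpa using this⟩
  positivity

/-- one integration by parts step -/
def stp (a : E × (E →L[ℝ] ℝ)) (Ψ : E → ℂ) : E → ℂ :=
  fun x => (1 + Complex.I * ((a.2 x : ℝ) : ℂ))⁻¹ * (Ψ x - dirD a.1 Ψ x)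

def stps (L : List (E × (E →L[ℝ] ℝ))) (Ψ : E → ℂ) : E → ℂ :=
  L.foldr (fun a h => stp a h) Ψ

def wt (L : List (E × (E →L[ℝ] ℝ))) (x : E) : ℝ :=
  (L.map fun a => (1 + |a.2 x|)⁻¹).prod

lemma Sm.stp {g : E → ℂ} (h : Sm g) (a : E × (E →L[ℝ] ℝ)) : Sm (stp a g) :=
  (sm_inv a.2).mul (ContDiff.sub h (h.dirD a.1))

lemma Sm.stps {g : E → ℂ} (h : Sm g) (L : List (E × (E →L[ℝ] ℝ))) : Sm (stps L g) := by
  induction L with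
  | nil => exact h
  | cons a L ih => exact Sm.stp ih a

lemma wt_nonneg (L : List (E × (E →L[ℝ] ℝ))) (x : E) : 0 ≤ wt L x := by
  unfold wt
  apply List.prod_nonneg
  simp only [List.mem_map]
  rintro _ ⟨a, _, rfl⟩
  positivity

lemma wt_cont (L : List (E × (E →L[ℝ] ℝ))) : Continuous (wt L) := by
  induction L with
  | nil =>
    have : wt ([] : List (E × (E →L[ℝ] ℝ))) = fun _ => (1 : ℝ) := by funext x; simp [wt]
    rw [this]; exact continuous_const
  | cons a L ih =>
    have : wt (a :: L) = fun x => (1 + |a.2 x|)⁻¹ * wt L x := by funext x; simp [wt]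
    rw [this]
    refine Continuous.mul (Continuous.inv₀ (by fun_prop) ?_) ih
    intro x; positivity

lemma bd_stp (k : ℕ) (a : E × (E →L[ℝ] ℝ)) : ∃ K, 0 ≤ K ∧ ∀ (ω : E → ℝ) (C : ℝ) (Ψ : E → ℂ),
    Sm Ψ → Bd (k + 1) ω C Ψ → Bd k (fun x => (1 + |a.2 x|)⁻¹ * ω x) (K * C) (stp a Ψ) := by
  obtain ⟨C0, h0, hC0⟩ := bd_inv k a.2
  refine ⟨2 ^ k * (C0 * (1 + ‖a.1‖)), by positivity, ?_⟩
  intro ω C Ψ sΨ hΨ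
  have h1 := Bd.sub sΨ (sΨ.dirD a.1) (hΨ.mono (Nat.le_succ k)) (hΨ.dirD sΨ a.1)
  have h2 := Bd.mul (sm_inv a.2) (ContDiff.sub sΨ (sΨ.dirD a.1)) hC0 h1
  refine h2.mono' ?_
  intro x
  apply le_of_eq; ring

lemma bd_stps (L : List (E × (E →L[ℝ] ℝ))) : ∀ k : ℕ, ∃ K, 0 ≤ K ∧
    ∀ (ω : E → ℝ) (C : ℝ) (Ψ : E → ℂ),
    Sm Ψ → Bd (k + L.length) ω C Ψ → Bd k (fun x => wt L x * ω x) (K * C) (stps L Ψ) := by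
  induction L with
  | nil => intro k; exact ⟨1, by norm_num, fun ω C Ψ _ h => by simpa [wt, stps] using h⟩
  | cons a L ih =>
    intro k
    obtain ⟨K1, h1, hK1⟩ := ih (k + 1)
    obtain ⟨K2, h2, hK2⟩ := bd_stp k a
    refine ⟨K2 * K1, by positivity, ?_⟩
    intro ω C Ψ sΨ hΨ
    have e1 := hK1 ω C Ψ sΨ (hΨ.mono (by simp; omega))
    have e2 := hK2 _ _ _ (sΨ.stps L) e1
    have e3 : stps (a :: L) Ψ = stp a (stps L Ψ) := rfl
    rw [e3]
    refine e2.mono' ?_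
    intro x
    apply le_of_eq
    simp [wt]; ring

end HBasic


section HOsc

set_option linter.unusedSectionVars false

open Topology Filter

variable {E : Type*} [NormedAddCommGroup E] [NormedSpace ℝ E] [FiniteDimensional ℝ E]
  [MeasureSpace E] [BorelSpace E] [(volume : Measure E).IsAddHaarMeasure]

/-- oscillating factor -/
def ex {E : Type*} (Θ : E → ℝ) (x : E) : ℂ := Complex.exp (Complex.I * (Θ x : ℂ))

lemma ex_norm {E : Type*} (Θ : E → ℝ) (x : E) : ‖ex Θ x‖ = 1 := by
  unfold ex; rw [mul_comm]; exact Complex.norm_exp_ofReal_mul_I _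

lemma ex_sm {E : Type*} [NormedAddCommGroup E] [NormedSpace ℝ E]
    {Θ : E → ℝ} (h : Sm Θ) : Sm (ex Θ) := by
  unfold ex
  exact (contDiff_const.mul (Complex.ofRealCLM.contDiff.comp h)).cexp

lemma dirD_ex {E : Type*} [NormedAddCommGroup E] [NormedSpace ℝ E]
    {Θ : E → ℝ} (h : Sm Θ) (v : E) (x : E) :
    fderiv ℝ (ex Θ) x v = Complex.I * (fderiv ℝ Θ x v : ℝ) * ex Θ x := by
  have h1 := (h.diff x).hasFDerivAt
  have h2 : HasFDerivAt (fun x => (Θ x : ℂ)) (Complex.ofRealCLM.comp (fderiv ℝ Θ x)) x :=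
    Complex.ofRealCLM.hasFDerivAt.comp x h1
  have h3 := (h2.const_mul Complex.I).cexp
  have h4 : fderiv ℝ (ex Θ) x = _ := h3.fderiv
  rw [h4]; simp [ex]; ring

lemma int_cs {g : E → ℂ} (h : Continuous g) (hc : HasCompactSupport g) : Integrable g :=
  h.integrable_of_hasCompactSupport hc

lemma cs_dirD {E : Type*} [NormedAddCommGroup E] [NormedSpace ℝ E]
    {g : E → ℂ} (h : HasCompactSupport g) (v : E) : HasCompactSupport (dirD v g) :=
  HasCompactSupport.fderiv_apply (𝕜 := ℝ) h v

lemma ibp {Θ : E → ℝ} (hΘ : Sm Θ) (v : E) {φ : E → ℂ} (hφ : Sm φ) (hc : HasCompactSupport φ) :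
    ∫ x, ex Θ x * dirD v φ x = - ∫ x, Complex.I * (fderiv ℝ Θ x v : ℝ) * ex Θ x * φ x := by
  have := integral_mul_fderiv_eq_neg_fderiv_mul_of_integrable (μ := (volume : Measure E))
    (f := ex Θ) (g := φ) (v := v) ?_ ?_ ?_ (fun x _ => (ex_sm hΘ).diff x) (fun x _ => hφ.diff x)
  · simp only [dirD_ex hΘ] at this
    exact this
  · exact int_cs (((ex_sm hΘ).dirD v).continuous.mul hφ.continuous) hc.mul_left
  · exact int_cs ((ex_sm hΘ).continuous.mul (hφ.dirD v).continuous) (cs_dirD hc v).mul_left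
  · exact int_cs ((ex_sm hΘ).continuous.mul hφ.continuous) hc.mul_left

/-- admissible steps for the phase -/
def Vld {E : Type*} [NormedAddCommGroup E] [NormedSpace ℝ E]
    (Θ : E → ℝ) (a : E × (E →L[ℝ] ℝ)) : Prop :=
  (∀ x, fderiv ℝ Θ x a.1 = a.2 x) ∧ a.2 a.1 = 0

lemma dirD_inv {E : Type*} [NormedAddCommGroup E] [NormedSpace ℝ E]
    (lam : E →L[ℝ] ℝ) (v : E) (hv : lam v = 0) :
    dirD v (fun x => (1 + Complex.I * ((lam x : ℝ) : ℂ))⁻¹) = fun _ => 0 := by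
  funext x
  simp only [dirD]
  have s1 := sm_inv (ContinuousLinearMap.id ℝ ℝ)
  have h4 := ((s1.diff (lam x)).hasFDerivAt.comp x lam.hasFDerivAt).fderiv
  have h5 : fderiv ℝ (fun x => (1 + Complex.I * ((lam x : ℝ) : ℂ))⁻¹) x = _ := h4
  rw [h5]; simp [hv]

lemma ibp_stp {Θ : E → ℝ} (hΘ : Sm Θ) (a : E × (E →L[ℝ] ℝ)) (ha : Vld Θ a)
    {Ψ : E → ℂ} (hs : Sm Ψ) (hc : HasCompactSupport Ψ) :
    ∫ x, ex Θ x * stp a Ψ x = ∫ x, ex Θ x * Ψ x := by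
  set φ : E → ℂ := fun x => (1 + Complex.I * ((a.2 x : ℝ) : ℂ))⁻¹ * Ψ x with hφ
  have sφ : Sm φ := (sm_inv a.2).mul hs
  have cφ : HasCompactSupport φ := hc.mul_left
  have h1 : stp a Ψ = fun x => φ x - dirD a.1 φ x := by
    rw [hφ, dirD_mul (sm_inv a.2) hs, dirD_inv _ _ ha.2]
    funext x; simp [stp]; ring
  have h2 := ibp hΘ a.1 sφ cφ
  simp only [ha.1] at h2
  rw [h1]
  simp only [mul_sub]
  rw [integral_sub, h2, sub_neg_eq_add, ← integral_add]
  · congr 1; funext x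
    simp only [hφ]
    have := onepi_ne (a.2 x)
    field_simp
  · exact int_cs ((ex_sm hΘ).continuous.mul sφ.continuous) cφ.mul_left
  · have : Continuous fun x => Complex.I * ((a.2 x : ℝ) : ℂ) * ex Θ x :=
      (continuous_const.mul (Complex.continuous_ofReal.comp a.2.continuous)).mul
        (ex_sm hΘ).continuous
    exact int_cs (this.mul sφ.continuous) cφ.mul_left
  · exact int_cs ((ex_sm hΘ).continuous.mul sφ.continuous) cφ.mul_left
  · exact int_cs ((ex_sm hΘ).continuous.mul (sφ.dirD _).continuous) (cs_dirD cφ _).mul_left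

lemma cs_stp {E : Type*} [NormedAddCommGroup E] [NormedSpace ℝ E] {Ψ : E → ℂ}
    (hc : HasCompactSupport Ψ) (a : E × (E →L[ℝ] ℝ)) : HasCompactSupport (stp a Ψ) :=
  (HasCompactSupport.sub hc (cs_dirD hc a.1)).mul_left

lemma cs_stps {E : Type*} [NormedAddCommGroup E] [NormedSpace ℝ E] {Ψ : E → ℂ}
    (hc : HasCompactSupport Ψ) (L : List (E × (E →L[ℝ] ℝ))) : HasCompactSupport (stps L Ψ) := by
  induction L with
  | nil => exact hc
  | cons a L ih => exact cs_stp ih a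

lemma ibp_stps {Θ : E → ℝ} (hΘ : Sm Θ) (L : List (E × (E →L[ℝ] ℝ))) (hL : ∀ a ∈ L, Vld Θ a)
    {Ψ : E → ℂ} (hs : Sm Ψ) (hc : HasCompactSupport Ψ) :
    ∫ x, ex Θ x * stps L Ψ x = ∫ x, ex Θ x * Ψ x := by
  induction L with
  | nil => rfl
  | cons a L ih =>
    rw [← ih (fun b hb => hL b (by simp [hb]))]
    exact ibp_stp hΘ a (hL a (by simp)) (hs.stps L) (cs_stps hc L)

lemma stps_congr {E : Type*} [NormedAddCommGroup E] [NormedSpace ℝ E]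
    (L : List (E × (E →L[ℝ] ℝ))) {Ψ Ψ' : E → ℂ} {x : E} (h : Ψ =ᶠ[𝓝 x] Ψ') :
    stps L Ψ =ᶠ[𝓝 x] stps L Ψ' := by
  induction L with
  | nil => exact h
  | cons a L ih =>
    have h1 := ih.fderiv (𝕜 := ℝ)
    filter_upwards [ih, h1] with y hy1 hy2
    have e : ∀ Ψ, stps (a :: L) Ψ = stp a (stps L Ψ) := fun _ => rfl
    rw [e, e]; simp only [stp, dirD, hy1, hy2]

/-- cutoffs -/
def Cut {E : Type*} [NormedAddCommGroup E] [NormedSpace ℝ E] (χ : E → ℂ) : Prop :=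
  Sm χ ∧ HasCompactSupport χ ∧ ∀ᶠ x in 𝓝 0, χ x = 1

lemma cut_ex {E : Type*} [NormedAddCommGroup E] [NormedSpace ℝ E] [FiniteDimensional ℝ E]
    (x0 : E) (R : ℝ) : ∃ χ : E → ℂ, Sm χ ∧ HasCompactSupport χ ∧
    (∀ x ∈ Metric.ball x0 R, χ x = 1) := by
  let b : ContDiffBump x0 := ⟨|R| + 1, |R| + 2, by positivity, by linarith⟩
  refine ⟨fun x => ((b x : ℝ) : ℂ), Complex.ofRealCLM.contDiff.comp b.contDiff, ?_, ?_⟩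
  · exact b.hasCompactSupport.comp_left (g := fun t : ℝ => (t : ℂ)) (by simp)
  · intro x hx
    have : b x = 1 := b.one_of_mem_closedBall (by
      simp only [Metric.mem_closedBall]
      have := Metric.mem_ball.1 hx
      have h2 := le_abs_self R
      show dist x x0 ≤ |R| + 1
      linarith)
    simp [this]

lemma Cut.exists {E : Type*} [NormedAddCommGroup E] [NormedSpace ℝ E] [FiniteDimensional ℝ E] :
    ∃ χ : E → ℂ, Cut χ := by
  obtain ⟨χ, h1, h2, h3⟩ := cut_ex (0 : E) 1
  exact ⟨χ, h1, h2, by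
    filter_upwards [Metric.ball_mem_nhds (0 : E) one_pos] with x hx using h3 x hx⟩

/-- scaled function -/
def sc {E : Type*} [NormedAddCommGroup E] [NormedSpace ℝ E] (χ : E → ℂ) (n : ℕ) (x : E) : ℂ :=
  χ (((n : ℝ) + 1)⁻¹ • x)

def HasOsc (Θ : E → ℝ) (Ψ : E → ℂ) (c : ℂ) : Prop :=
  ∀ χ : E → ℂ, Cut χ → Tendsto (fun n : ℕ => ∫ x, ex Θ x * (sc χ n x * Ψ x)) atTop (𝓝 c)

lemma HasOsc.uniq {Θ : E → ℝ} {Ψ : E → ℂ} {c c' : ℂ} (h : HasOsc Θ Ψ c) (h' : HasOsc Θ Ψ c') :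
    c = c' := by
  obtain ⟨χ, hχ⟩ := Cut.exists (E := E)
  exact tendsto_nhds_unique (h χ hχ) (h' χ hχ)

lemma sc_sm {E : Type*} [NormedAddCommGroup E] [NormedSpace ℝ E] {χ : E → ℂ} (h : Sm χ) (n : ℕ) :
    Sm (sc χ n) := ContDiff.comp h (contDiff_const_smul _)

lemma sc_cs {E : Type*} [NormedAddCommGroup E] [NormedSpace ℝ E]
    {χ : E → ℂ} (h : HasCompactSupport χ) (n : ℕ) :
    HasCompactSupport (sc χ n) := by
  have hn : ((n : ℝ) + 1)⁻¹ ≠ 0 := by positivity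
  exact h.comp_homeomorph (Homeomorph.smulOfNeZero _ hn)

lemma sc_one {E : Type*} [NormedAddCommGroup E] [NormedSpace ℝ E] {χ : E → ℂ}
    (h : ∀ᶠ x in 𝓝 0, χ x = 1) (x : E) :
    ∀ᶠ n : ℕ in atTop, ∀ᶠ y in 𝓝 x, sc χ n y = 1 := by
  have h1 : Tendsto (fun n : ℕ => ((n : ℝ) + 1)⁻¹ • x) atTop (𝓝 0) := by
    have := (tendsto_one_div_add_atTop_nhds_zero_nat (𝕜 := ℝ)).smul_const x
    simpa using this
  have h2 := h1.eventually (eventually_eventually_nhds.2 h)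
  filter_upwards [h2] with n hn
  have : ContinuousAt (fun y : E => ((n : ℝ) + 1)⁻¹ • y) x := by fun_prop
  exact this.eventually hn

lemma sc_bd {E : Type*} [NormedAddCommGroup E] [NormedSpace ℝ E] {χ : E → ℂ}
    (h : Sm χ) (hc : HasCompactSupport χ) (k : ℕ) :
    ∃ C, 0 ≤ C ∧ ∀ n, Bd k (fun _ => 1) C (sc χ n) := by
  have h1 : ∀ j : ℕ, ∃ C, ∀ x, ‖iteratedFDeriv ℝ j χ x‖ ≤ C := fun j =>
    (hc.iteratedFDeriv (𝕜 := ℝ) j).exists_bound_of_continuous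
      (h.nat j).continuous_iteratedFDeriv'
  choose C hC using h1
  have hC0 : ∀ j, 0 ≤ C j := fun j => (norm_nonneg _).trans (hC j 0)
  refine ⟨∑ j ∈ range (k + 1), C j, Finset.sum_nonneg fun j _ => hC0 j, ?_⟩
  have hb : Bd k (fun _ : E => (1 : ℝ)) (∑ j ∈ range (k + 1), C j) χ := by
    intro j hj x
    rw [mul_one]
    exact (hC j x).trans (Finset.single_le_sum (f := C) (fun i _ => hC0 i) (by simp; omega))
  intro n
  have := hb.comp h (((n : ℝ) + 1)⁻¹ • ContinuousLinearMap.id ℝ E) 0 (A := 1) ?_ le_rfl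
  · have e : sc χ n = fun x => χ (((n : ℝ) + 1)⁻¹ • x) := rfl
    rw [e]; simpa using this
  · rw [norm_smul]
    have h3 : ‖((n : ℝ) + 1)⁻¹‖ ≤ 1 := by
      rw [norm_inv, Real.norm_of_nonneg (by positivity)]
      apply inv_le_one_of_one_le₀; linarith [(Nat.cast_nonneg n : (0 : ℝ) ≤ n)]
    calc _ ≤ 1 * 1 := mul_le_mul h3 ContinuousLinearMap.norm_id_le (norm_nonneg _) zero_le_one
      _ = 1 := one_mul 1

/-- dominated convergence for the regularised integrals -/
lemma tendsto_stps {ι : Type*} {l : Filter ι} [l.IsCountablyGenerated]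
    (Θ : E → ℝ) (hΘ : Sm Θ) (L : List (E × (E →L[ℝ] ℝ)))
    {Ψn : ι → E → ℂ} {Ψ : E → ℂ} (hs : ∀ n, Sm (Ψn n)) {ω : E → ℝ} {C : ℝ}
    (hb : ∀ᶠ n in l, Bd L.length ω C (Ψn n)) (hi : Integrable (fun x => wt L x * ω x))
    (hp : ∀ x, Tendsto (fun n => stps L (Ψn n) x) l (𝓝 (stps L Ψ x))) :
    Tendsto (fun n => ∫ x, ex Θ x * stps L (Ψn n) x) l (𝓝 (∫ x, ex Θ x * stps L Ψ x)) := by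
  obtain ⟨K, hK0, hK⟩ := bd_stps L 0
  apply tendsto_integral_filter_of_dominated_convergence (fun x => (K * C) * (wt L x * ω x))
  · exact Eventually.of_forall fun n =>
      ((ex_sm hΘ).continuous.mul ((hs n).stps L).continuous).aestronglyMeasurable
  · filter_upwards [hb] with n hn
    refine Eventually.of_forall fun x => ?_
    rw [norm_mul, ex_norm, one_mul]
    exact (hK ω C _ (hs n) (by simpa using hn)).val x
  · exact hi.const_mul _
  · exact Eventually.of_forall fun x => (hp x).const_mul _

lemma hasOsc_stps {Θ : E → ℝ} (hΘ : Sm Θ) (L : List (E × (E →L[ℝ] ℝ))) (hL : ∀ a ∈ L, Vld Θ a)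
    {Ψ : E → ℂ} (hs : Sm Ψ) {ω : E → ℝ} {C : ℝ}
    (hb : Bd L.length ω C Ψ) (hi : Integrable (fun x => wt L x * ω x)) :
    HasOsc Θ Ψ (∫ x, ex Θ x * stps L Ψ x) := by
  rintro χ ⟨c1, c2, c3⟩
  obtain ⟨C', hC', hbd⟩ := sc_bd c1 c2 L.length
  have h := tendsto_stps (l := atTop) Θ hΘ L (Ψn := fun n x => sc χ n x * Ψ x) (Ψ := Ψ)
    (fun n => (sc_sm c1 n).mul hs) (ω := ω) (C := 2 ^ L.length * (C' * C))
    (Eventually.of_forall fun n => by simpa using Bd.mul (sc_sm c1 n) hs (hbd n) hb) hi ?_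
  · refine h.congr fun n => ?_
    exact ibp_stps hΘ L hL ((sc_sm c1 n).mul hs) ((sc_cs c2 n).mul_right)
  · intro x
    refine tendsto_const_nhds.congr' ?_
    filter_upwards [sc_one c3 x] with n hn
    refine (stps_congr L ?_).symm.eq_of_nhds
    filter_upwards [hn] with y hy
    simp [hy]

lemma hasOsc_int {Θ : E → ℝ} (hΘ : Sm Θ) {Ψ : E → ℂ} (hs : Sm Ψ) (hi : Integrable Ψ) :
    HasOsc Θ Ψ (∫ x, ex Θ x * Ψ x) := by
  have := hasOsc_stps hΘ [] (by simp) hs (ω := fun x => ‖Ψ x‖) (C := 1) ?_ ?_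
  · exact this
  · intro j hj x
    have : j = 0 := by simpa using hj
    subst this; simp
  · simpa [wt] using hi.norm

lemma HasOsc.const_mul {Θ : E → ℝ} {Ψ : E → ℂ} {c : ℂ} (h : HasOsc Θ Ψ c) (k : ℂ) :
    HasOsc Θ (fun x => k * Ψ x) (k * c) := by
  intro χ hχ
  refine ((h χ hχ).const_mul k).congr fun n => ?_
  rw [← integral_const_mul]
  congr 1; funext x; ring

lemma osc_int {Θ : E → ℝ} (hΘ : Sm Θ) {Ψ χ : E → ℂ} (hs : Sm Ψ) (h1 : Sm χ)
    (h2 : HasCompactSupport χ) (n : ℕ) : Integrable (fun x => ex Θ x * (sc χ n x * Ψ x)) :=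
  int_cs ((ex_sm hΘ).continuous.mul ((sc_sm h1 n).continuous.mul hs.continuous))
    ((sc_cs h2 n).mul_right.mul_left)

lemma HasOsc.sum {Θ : E → ℝ} (hΘ : Sm Θ) {ι : Type*} (s : Finset ι) {Ψ : ι → E → ℂ}
    (hs : ∀ i, Sm (Ψ i)) {c : ι → ℂ} (h : ∀ i ∈ s, HasOsc Θ (Ψ i) (c i)) :
    HasOsc Θ (fun x => ∑ i ∈ s, Ψ i x) (∑ i ∈ s, c i) := by
  intro χ hχ
  refine (tendsto_finsetSum s fun i hi => h i hi χ hχ).congr fun n => ?_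
  rw [← integral_finsetSum]
  · congr 1; funext x; simp [Finset.mul_sum]
  · intro i _; exact osc_int hΘ (hs i) hχ.1 hχ.2.1 n

lemma HasOsc.sub {Θ : E → ℝ} (hΘ : Sm Θ) {Ψ Ψ' : E → ℂ}
    (hs : Sm Ψ) (hs' : Sm Ψ') {c c' : ℂ} (h : HasOsc Θ Ψ c) (h' : HasOsc Θ Ψ' c') :
    HasOsc Θ (fun x => Ψ x - Ψ' x) (c - c') := by
  intro χ hχ
  refine ((h χ hχ).sub (h' χ hχ)).congr fun n => ?_
  rw [← integral_sub (osc_int hΘ hs hχ.1 hχ.2.1 n) (osc_int hΘ hs' hχ.1 hχ.2.1 n)]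
  congr 1; funext x; ring

lemma HasOsc.comp {Θ : E → ℝ} {Ψ : E → ℂ} {c : ℂ} (h : HasOsc Θ Ψ c)
    (g : E ≃L[ℝ] E) (hg : MeasurePreserving g) (hΘ : ∀ x, Θ (g x) = Θ x) :
    HasOsc Θ (fun x => Ψ (g x)) c := by
  rintro χ ⟨c1, c2, c3⟩
  have hχ : Cut (fun x => χ (g.symm x)) := by
    refine ⟨ContDiff.comp c1 g.symm.contDiff, c2.comp_homeomorph g.symm.toHomeomorph, ?_⟩
    have : Tendsto g.symm (𝓝 0) (𝓝 0) := by
      have := g.symm.continuous.tendsto 0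
      simpa using this
    exact this.eventually c3
  refine (h _ hχ).congr fun n => ?_
  rw [← hg.integral_comp g.toHomeomorph.measurableEmbedding]
  congr 1; funext x
  simp [ex, hΘ, sc]

lemma HasOsc.mul_lin {Θ : E → ℝ} (hΘ : Sm Θ) {Ψ : E → ℂ} (hs : Sm Ψ) {c c₂ : ℂ} {v : E}
    (h : HasOsc Θ (dirD v Ψ) c) (h2 : HasOsc Θ Ψ c₂) :
    HasOsc Θ (fun x => ((fderiv ℝ Θ x v : ℝ) : ℂ) * Ψ x) (Complex.I * c) := by
  rintro χ hχ
  have hχ' : Cut (fun x => χ x + dirD v χ x) := by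
    refine ⟨ContDiff.add hχ.1 (hχ.1.dirD v), HasCompactSupport.add hχ.2.1 (cs_dirD hχ.2.1 v), ?_⟩
    have h3 : χ =ᶠ[𝓝 0] fun _ => (1 : ℂ) := hχ.2.2
    filter_upwards [h3, h3.fderiv (𝕜 := ℝ)] with x hx hx2
    simp [hx, dirD, hx2]
  have e1 := (h2 _ hχ').sub (h2 _ hχ)
  have e2 : Tendsto (fun n : ℕ => ∫ x, ex Θ x * (sc (dirD v χ) n x * Ψ x)) atTop (𝓝 0) := by
    rw [sub_self] at e1
    refine e1.congr fun n => ?_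
    rw [← integral_sub (osc_int hΘ hs hχ'.1 hχ'.2.1 n) (osc_int hΘ hs hχ.1 hχ.2.1 n)]
    congr 1; funext x; simp only [sc]; ring
  have e3 : Tendsto (fun n : ℕ => ((((n : ℝ) + 1)⁻¹ : ℝ) : ℂ)) atTop (𝓝 0) := by
    have := tendsto_one_div_add_atTop_nhds_zero_nat (𝕜 := ℝ)
    have h4 := (Complex.continuous_ofReal.tendsto 0).comp this
    simpa [Function.comp_def] using h4
  have e4 := ((h χ hχ).add (e3.mul e2)).const_mul Complex.I
  rw [mul_zero, add_zero] at e4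
  refine e4.congr fun n => ?_
  have hd : dirD v (fun x => sc χ n x * Ψ x) = fun x =>
      sc χ n x * dirD v Ψ x + ((((n : ℝ) + 1)⁻¹ : ℝ) : ℂ) * (sc (dirD v χ) n x * Ψ x) := by
    rw [dirD_mul (sc_sm hχ.1 n) hs]
    have := dirD_comp hχ.1 (((n : ℝ) + 1)⁻¹ • ContinuousLinearMap.id ℝ E) 0 v
    simp only [add_zero] at this
    have h5 : dirD v (sc χ n) = fun x => ((((n : ℝ) + 1)⁻¹ : ℝ) : ℂ) * sc (dirD v χ) n x := by
      refine Eq.trans this ?_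
      funext x
      simp [sc, dirD]
    rw [h5]; funext x; ring
  have e5 := ibp hΘ v ((sc_sm hχ.1 n).mul hs) ((sc_cs hχ.2.1 n).mul_right (f' := Ψ))
  rw [hd] at e5
  simp only [mul_add] at e5
  rw [integral_add (osc_int hΘ (hs.dirD v) hχ.1 hχ.2.1 n)] at e5
  · have e6 : ∫ x, ex Θ x * (((((n : ℝ) + 1)⁻¹ : ℝ) : ℂ) * (sc (dirD v χ) n x * Ψ x))
        = ((((n : ℝ) + 1)⁻¹ : ℝ) : ℂ) * ∫ x, ex Θ x * (sc (dirD v χ) n x * Ψ x) := by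
      rw [← integral_const_mul]; congr 1; funext x; ring
    rw [e6] at e5
    rw [e5, mul_neg, ← integral_const_mul, ← integral_neg]
    congr 1; funext x
    linear_combination (-(fderiv ℝ Θ x v : ℂ) * ex Θ x * sc χ n x * Ψ x) * Complex.I_mul_I
  · have := (osc_int hΘ hs (hχ.1.dirD v) (cs_dirD hχ.2.1 v) n).const_mul
      ((((n : ℝ) + 1)⁻¹ : ℝ) : ℂ)
    refine this.congr (Eventually.of_forall fun x => ?_)
    simp only; ring

end HOsc


section HTame

set_option linter.unusedSectionVars false

open Topology Filter

section gen

variable {E : Type*} [NormedAddCommGroup E] [NormedSpace ℝ E]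
variable {G : Type*} [NormedAddCommGroup G] [NormedSpace ℝ G]

/-- polynomial weight -/
def pw {E : Type*} [NormedAddCommGroup E] (M : ℕ) (x : E) : ℝ := (1 + ‖x‖) ^ M

lemma pw_pos (M : ℕ) (x : E) : 0 < pw M x := by unfold pw; positivity

lemma pw_one (M : ℕ) (x : E) : 1 ≤ pw M x :=
  one_le_pow₀ (by linarith [norm_nonneg x])

lemma pw_mono {M M' : ℕ} (h : M ≤ M') (x : E) : pw M x ≤ pw M' x :=
  pow_le_pow_right₀ (by linarith [norm_nonneg x]) h

lemma pw_prod (M : ℕ) (x : E × G) : pw M x ≤ pw M x.1 * pw M x.2 := by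
  unfold pw
  rw [← mul_pow]
  apply pow_le_pow_left₀ (by positivity)
  rw [Prod.norm_def]
  rcases max_choice ‖x.1‖ ‖x.2‖ with h | h <;> rw [h] <;>
    nlinarith [norm_nonneg x.1, norm_nonneg x.2, mul_nonneg (norm_nonneg x.1) (norm_nonneg x.2)]

lemma pw_fst (M : ℕ) (x : E × G) : pw M x.1 ≤ pw M x := by
  unfold pw; gcongr; exact norm_fst_le x

lemma pw_snd (M : ℕ) (x : E × G) : pw M x.2 ≤ pw M x := by
  unfold pw; gcongr; exact norm_snd_le x

def Tame {E : Type*} [NormedAddCommGroup E] [NormedSpace ℝ E] (M : ℕ) (Ψ : E → ℂ) : Prop :=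
  Sm Ψ ∧ ∀ k, ∃ C, 0 ≤ C ∧ Bd k (pw M) C Ψ

lemma tame_of {M : ℕ} {Ψ : E → ℂ} (hs : Sm Ψ)
    (h : ∀ k, ∃ C, ∀ x, ‖iteratedFDeriv ℝ k Ψ x‖ ≤ C * pw M x) : Tame M Ψ := by
  refine ⟨hs, fun k => ?_⟩
  choose C hC using h
  have hC0 : ∀ j, 0 ≤ C j := fun j => by
    have := (norm_nonneg _).trans (hC j 0)
    exact nonneg_of_mul_nonneg_left this (pw_pos M 0)
  refine ⟨∑ j ∈ range (k + 1), C j, Finset.sum_nonneg fun j _ => hC0 j, fun j hj x => ?_⟩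
  refine (hC j x).trans (mul_le_mul_of_nonneg_right ?_ (pw_pos M x).le)
  exact (Finset.single_le_sum (f := C) (fun i _ => hC0 i) (by simp; omega))

lemma Tame.mono {M M' : ℕ} {Ψ : E → ℂ} (h : Tame M Ψ) (hM : M ≤ M') : Tame M' Ψ := by
  refine ⟨h.1, fun k => ?_⟩
  obtain ⟨C, h0, hC⟩ := h.2 k
  exact ⟨C, h0, hC.mono' fun x => mul_le_mul_of_nonneg_left (pw_mono hM x) h0⟩

lemma Tame.dirD {M : ℕ} {Ψ : E → ℂ} (h : Tame M Ψ) (v : E) : Tame M (dirD v Ψ) := by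
  refine ⟨h.1.dirD v, fun k => ?_⟩
  obtain ⟨C, h0, hC⟩ := h.2 (k + 1)
  exact ⟨‖v‖ * C, by positivity, hC.dirD h.1 v⟩

lemma Tame.mul {M M' : ℕ} {Ψ Ψ' : E → ℂ} (h : Tame M Ψ) (h' : Tame M' Ψ') :
    Tame (M + M') (fun x => Ψ x * Ψ' x) := by
  refine ⟨h.1.mul h'.1, fun k => ?_⟩
  obtain ⟨C, h0, hC⟩ := h.2 k
  obtain ⟨C', h0', hC'⟩ := h'.2 k
  refine ⟨2 ^ k * (C * C'), by positivity, (Bd.mul h.1 h'.1 hC hC').mono' fun x => ?_⟩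
  simp only [pw, pow_add]; rfl

lemma Tame.add {M : ℕ} {Ψ Ψ' : E → ℂ} (h : Tame M Ψ) (h' : Tame M Ψ') :
    Tame M (fun x => Ψ x + Ψ' x) := by
  refine ⟨ContDiff.add h.1 h'.1, fun k => ?_⟩
  obtain ⟨C, h0, hC⟩ := h.2 k
  obtain ⟨C', h0', hC'⟩ := h'.2 k
  exact ⟨C + C', by positivity, Bd.add h.1 h'.1 hC hC'⟩

lemma tame_const (c : ℂ) : Tame 0 (fun _ : E => c) := by
  refine tame_of contDiff_const fun k => ⟨‖c‖, fun x => ?_⟩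
  cases k with
  | zero => simp [pw]
  | succ k => rw [iteratedFDeriv_succ_const]; simp [pw]

lemma Tame.sum {M : ℕ} {ι : Type*} (s : Finset ι) {Ψ : ι → E → ℂ} (h : ∀ i, Tame M (Ψ i)) :
    Tame M (fun x => ∑ i ∈ s, Ψ i x) := by
  classical
  induction s using Finset.induction_on with
  | empty => simpa using (tame_const (E := E) 0).mono (Nat.zero_le M)
  | insert a s ha ih => simp only [Finset.sum_insert ha]; exact (h a).add ih

lemma pw_comp (L : E →L[ℝ] G) (c : G) (M : ℕ) (x : E) :
    pw M (L x + c) ≤ (1 + ‖L‖ + ‖c‖) ^ M * pw M x := by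
  unfold pw
  rw [← mul_pow]
  apply pow_le_pow_left₀ (by positivity)
  have h1 := norm_add_le (L x) c
  have h2 := L.le_opNorm x
  nlinarith [norm_nonneg x, norm_nonneg c, norm_nonneg L, mul_nonneg (norm_nonneg c) (norm_nonneg x)]

lemma Tame.comp {M : ℕ} {Ψ : G → ℂ} (h : Tame M Ψ) (L : E →L[ℝ] G) (c : G) :
    Tame M (fun x => Ψ (L x + c)) := by
  refine ⟨ContDiff.comp h.1 (L.contDiff.add contDiff_const), fun k => ?_⟩
  obtain ⟨C, h0, hC⟩ := h.2 k
  have := hC.comp h.1 L c (A := 1 + ‖L‖) (by linarith) (by linarith [norm_nonneg L])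
  refine ⟨(1 + ‖L‖) ^ k * C * (1 + ‖L‖ + ‖c‖) ^ M, by positivity, this.mono' fun x => ?_⟩
  rw [mul_assoc _ _ (pw M x)]
  exact mul_le_mul_of_nonneg_left (pw_comp L c M x) (by positivity)

lemma Tame.compL {M : ℕ} {Ψ : G → ℂ} (h : Tame M Ψ) (L : E →L[ℝ] G) :
    Tame M (fun x => Ψ (L x)) := by simpa using h.comp L 0

lemma tame_lin (L : E →L[ℝ] ℝ) : Tame 1 (fun x => ((L x : ℝ) : ℂ)) := by
  set L' : E →L[ℝ] ℂ := Complex.ofRealCLM.comp L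
  have e : (fun x => ((L x : ℝ) : ℂ)) = L' := rfl
  rw [e]
  refine tame_of L'.contDiff fun k => ⟨‖L'‖, fun x => ?_⟩
  have h1 : (1 : ℝ) ≤ pw 1 x := pw_one 1 x
  have h2 : ‖x‖ ≤ pw 1 x := by simp [pw]
  match k with
  | 0 =>
    rw [norm_iteratedFDeriv_zero]
    exact (L'.le_opNorm x).trans (mul_le_mul_of_nonneg_left h2 (norm_nonneg _))
  | 1 =>
    rw [norm_iteratedFDeriv_one, L'.fderiv]
    exact le_mul_of_one_le_right (norm_nonneg _) h1
  | k + 2 =>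
    have : ‖iteratedFDeriv ℝ (k + 2) (L' : E → ℂ) x‖ = 0 := by
      rw [← norm_iteratedFDeriv_fderiv]
      have : fderiv ℝ (L' : E → ℂ) = fun _ => L' := by funext y; exact L'.fderiv
      rw [this, iteratedFDeriv_succ_const]; simp
    rw [this]; have := pw_pos 1 x; positivity

lemma tame_cs {Ψ : E → ℂ} (hs : Sm Ψ) (hc : HasCompactSupport Ψ) : Tame 0 Ψ := by
  refine tame_of hs fun k => ?_
  obtain ⟨C, hC⟩ := (hc.iteratedFDeriv (𝕜 := ℝ) k).exists_bound_of_continuous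
      (hs.nat k).continuous_iteratedFDeriv'
  exact ⟨C, fun x => by simpa [pw] using hC x⟩

end gen

instance qHaar (d : ℕ) : (volume : Measure (Q d)).IsAddHaarMeasure :=
  Measure.prod.instIsAddHaarMeasure _ _
instance qqHaar (d : ℕ) : (volume : Measure (Q d × Q d)).IsAddHaarMeasure :=
  Measure.prod.instIsAddHaarMeasure _ _
instance qqqqHaar (d : ℕ) :
    (volume : Measure ((Q d × Q d) × (Q d × Q d))).IsAddHaarMeasure :=
  Measure.prod.instIsAddHaarMeasure _ _

section mp
variable {E : Type*} [NormedAddCommGroup E] [NormedSpace ℝ E] [FiniteDimensional ℝ E]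
  [MeasureSpace E] [BorelSpace E] [(volume : Measure E).IsAddHaarMeasure]

lemma mp_of_conj (g s : E ≃L[ℝ] E) (h1 : ∀ x, s (s x) = x) (h2 : ∀ x, s (g (s (g x))) = x) :
    MeasurePreserving g := by
  set dg := LinearMap.det (g : E →ₗ[ℝ] E)
  set ds := LinearMap.det (s : E →ₗ[ℝ] E)
  have e1 : ds * ds = 1 := by
    rw [← map_mul]
    have : (s : E →ₗ[ℝ] E) * (s : E →ₗ[ℝ] E) = 1 := by ext x; simpa using h1 x
    rw [this, map_one]
  have e2 : ds * dg * (ds * dg) = 1 := by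
    rw [← map_mul, ← map_mul]
    have : ((s : E →ₗ[ℝ] E) * (g : E →ₗ[ℝ] E)) * ((s : E →ₗ[ℝ] E) * (g : E →ₗ[ℝ] E)) = 1 := by
      ext x; simpa using h2 x
    rw [this, map_one]
  have e3 : dg ^ 2 = 1 := by linear_combination e2 - dg ^ 2 * e1
  have e4 : |dg| = 1 := by
    have := sq_abs dg
    rw [e3] at this
    nlinarith [abs_nonneg dg]
  refine ⟨g.continuous.measurable, ?_⟩
  have := Measure.map_linearMap_addHaar_eq_smul_addHaar (volume : Measure E)
    (f := (g : E →ₗ[ℝ] E)) (by intro h; have : dg = 0 := h; rw [this] at e4; simp at e4)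
  have h5 : |(LinearMap.det (g : E →ₗ[ℝ] E))⁻¹| = 1 := by
    rw [abs_inv]; change |dg|⁻¹ = 1; rw [e4, inv_one]
  rw [h5] at this
  simpa using this

end mp

section coords
variable (d : ℕ)

def ee : Option (Fin d) → Q d
  | none => eR d
  | some i => eTh d i

def co : Option (Fin d) → Q d →L[ℝ] ℝ
  | none => ContinuousLinearMap.fst ℝ ℝ (Fin d → ℝ)
  | some i => (ContinuousLinearMap.proj i).comp (ContinuousLinearMap.snd ℝ ℝ (Fin d → ℝ))

variable {d}

lemma qdot_co (y z : Q d) : qdot y z = ∑ i, co d i y * co d i z := by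
  rw [Fintype.sum_option]; rfl

lemma co_ee (i j : Option (Fin d)) : co d i (ee d j) = if i = j then 1 else 0 := by
  cases i <;> cases j <;> simp [co, ee, eR, eTh, Pi.single_apply]

lemma decomp (y : Q d) : y = ∑ i, co d i y • ee d i := by
  rw [Fintype.sum_option]
  ext j
  · simp [co, ee, eR, eTh, Prod.fst_sum]
  · simp [co, ee, eR, eTh, Prod.snd_sum, Finset.sum_apply, Pi.single_apply]

lemma qdot_ee (y : Q d) (i : Option (Fin d)) : qdot y (ee d i) = co d i y := by
  simp [qdot_co, co_ee]

lemma ee_qdot (y : Q d) (i : Option (Fin d)) : qdot (ee d i) y = co d i y := by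
  simp [qdot_co, co_ee]

lemma co_le (y : Q d) (i : Option (Fin d)) : |co d i y| ≤ ‖y‖ := by
  cases i with
  | none => exact norm_fst_le y
  | some i => exact (norm_le_pi_norm y.2 i).trans (norm_snd_le y)

lemma norm_co (y : Q d) {r : ℝ} (hr : 0 ≤ r) (h : ∀ i, |co d i y| ≤ r) : ‖y‖ ≤ r := by
  rw [Prod.norm_def]
  refine max_le (h none) ((pi_norm_le_iff_of_nonneg hr).2 fun i => h (some i))

lemma ee_norm (i : Option (Fin d)) : ‖ee d i‖ ≤ 1 := by
  refine norm_co _ zero_le_one fun j => ?_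
  rw [co_ee]; split_ifs <;> simp

lemma norm_le_prod (y : Q d) : 1 + ‖y‖ ≤ ∏ i, (1 + |co d i y|) := by
  have h1 : ∀ i, 1 + |co d i y| ≤ ∏ i, (1 + |co d i y|) := fun i => by
    have := Finset.prod_le_prod (s := Finset.univ)
      (f := fun j => if j = i then 1 + |co d i y| else 1)
      (g := fun j => 1 + |co d j y|) (fun j _ => by split_ifs <;> positivity)
      (fun j _ => by
        have h3 := abs_nonneg (co d j y)
        split_ifs with h
        · rw [h]
        · linarith)
    simpa using this
  have h2 : 1 ≤ ∏ i, (1 + |co d i y|) := (by linarith [abs_nonneg (co d none y)] : (1:ℝ) ≤ 1 + |co d none y|).trans (h1 none)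
  have := norm_co y (r := ∏ i, (1 + |co d i y|) - 1) (by linarith) (fun i => by linarith [h1 i])
  linarith

/-- the phase -/
def th (d : ℕ) (x : Q d × Q d) : ℝ := qdot x.1 x.2

lemma th_hasFDerivAt (x : Q d × Q d) : HasFDerivAt (th d)
    (∑ i, ((co d i x.1) • (co d i).comp (ContinuousLinearMap.snd ℝ (Q d) (Q d))
      + (co d i x.2) • (co d i).comp (ContinuousLinearMap.fst ℝ (Q d) (Q d)))) x := by
  have e : th d = fun x : Q d × Q d => ∑ i, co d i x.1 * co d i x.2 := by
    funext x; exact qdot_co _ _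
  rw [e]
  refine HasFDerivAt.fun_sum fun i _ => ?_
  exact (((co d i).comp (ContinuousLinearMap.fst ℝ (Q d) (Q d))).hasFDerivAt).mul
    (((co d i).comp (ContinuousLinearMap.snd ℝ (Q d) (Q d))).hasFDerivAt)

lemma th_sm : Sm (th d) := by
  have e : th d = fun x : Q d × Q d => ∑ i, co d i x.1 * co d i x.2 := by
    funext x; exact qdot_co _ _
  rw [e]
  refine ContDiff.sum fun i _ => ContDiff.mul ?_ ?_
  · exact (co d i).contDiff.comp contDiff_fst
  · exact (co d i).contDiff.comp contDiff_snd

lemma th_fderiv (x v : Q d × Q d) : fderiv ℝ (th d) x v = qdot x.1 v.2 + qdot v.1 x.2 := by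
  rw [(th_hasFDerivAt x).fderiv, qdot_co, qdot_co, ← Finset.sum_add_distrib]
  simp [mul_comm]

def sy (d : ℕ) (i : Option (Fin d)) : (Q d × Q d) × ((Q d × Q d) →L[ℝ] ℝ) :=
  ((ee d i, 0), (co d i).comp (ContinuousLinearMap.snd ℝ (Q d) (Q d)))

def sz (d : ℕ) (i : Option (Fin d)) : (Q d × Q d) × ((Q d × Q d) →L[ℝ] ℝ) :=
  ((0, ee d i), (co d i).comp (ContinuousLinearMap.fst ℝ (Q d) (Q d)))

lemma vld_sy (i : Option (Fin d)) : Vld (th d) (sy d i) := by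
  refine ⟨fun x => ?_, by simp [sy]⟩
  rw [th_fderiv]; simp [sy, ee_qdot]; simp [qdot]

lemma vld_sz (i : Option (Fin d)) : Vld (th d) (sz d i) := by
  refine ⟨fun x => ?_, by simp [sz]⟩
  rw [th_fderiv]; simp [sz, qdot_ee]; simp [qdot]

def bz (d : ℕ) : List ((Q d × Q d) × ((Q d × Q d) →L[ℝ] ℝ)) := Finset.univ.toList.map (sz d)
def bl (d : ℕ) : List ((Q d × Q d) × ((Q d × Q d) →L[ℝ] ℝ)) :=
  Finset.univ.toList.map (sy d) ++ bz d

def rep {α : Type*} (R : ℕ) (L : List α) : List α := (List.replicate R L).flatten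

lemma mem_rep {α : Type*} {R : ℕ} {L : List α} {a : α} (h : a ∈ rep R L) : a ∈ L := by
  simp only [rep, List.mem_flatten, List.mem_replicate] at h
  obtain ⟨l, ⟨_, rfl⟩, h⟩ := h
  exact h

section
variable {E : Type*} [NormedAddCommGroup E] [NormedSpace ℝ E]
lemma wt_append (L L' : List (E × (E →L[ℝ] ℝ))) (x : E) : wt (L ++ L') x = wt L x * wt L' x := by
  simp [wt]

lemma wt_rep (R : ℕ) (L : List (E × (E →L[ℝ] ℝ))) (x : E) : wt (rep R L) x = wt L x ^ R := by
  induction R with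
  | zero => simp [rep, wt]
  | succ R ih =>
    have : rep (R + 1) L = L ++ rep R L := by simp [rep, List.replicate_succ]
    rw [this, wt_append, ih, pow_succ']
end

lemma vld_bz : ∀ a ∈ bz d, Vld (th d) a := by
  intro a ha; simp only [bz, List.mem_map] at ha
  obtain ⟨i, _, rfl⟩ := ha; exact vld_sz i

lemma vld_bl : ∀ a ∈ bl d, Vld (th d) a := by
  intro a ha; simp only [bl, List.mem_append, List.mem_map] at ha
  rcases ha with ⟨i, _, rfl⟩ | h
  · exact vld_sy i
  · exact vld_bz a h

lemma wt_bz (x : Q d × Q d) : wt (bz d) x ≤ (1 + ‖x.1‖)⁻¹ := by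
  have : wt (bz d) x = (∏ i, (1 + |co d i x.1|))⁻¹ := by
    simp only [wt, bz, List.map_map]
    rw [← Finset.prod_inv_distrib]
    exact Finset.prod_map_toList _ _
  rw [this]
  exact inv_anti₀ (by positivity) (norm_le_prod x.1)

lemma wt_bl (x : Q d × Q d) : wt (bl d) x ≤ (1 + ‖x‖)⁻¹ := by
  have : wt (Finset.univ.toList.map (sy d)) x = (∏ i, (1 + |co d i x.2|))⁻¹ := by
    simp only [wt, List.map_map]
    rw [← Finset.prod_inv_distrib]
    exact Finset.prod_map_toList _ _
  rw [bl, wt_append, this]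
  have h1 := wt_bz x
  have h2 : (∏ i, (1 + |co d i x.2|))⁻¹ ≤ (1 + ‖x.2‖)⁻¹ :=
    inv_anti₀ (by positivity) (norm_le_prod x.2)
  calc _ ≤ (1 + ‖x.2‖)⁻¹ * (1 + ‖x.1‖)⁻¹ :=
        mul_le_mul h2 h1 (wt_nonneg _ _) (by positivity)
    _ ≤ _ := by
        rw [← mul_inv]
        apply inv_anti₀ (by positivity)
        have := pw_prod 1 x
        simp only [pw, pow_one] at this
        linarith

def LM (d M : ℕ) : List ((Q d × Q d) × ((Q d × Q d) →L[ℝ] ℝ)) := rep (M + (2 * (d + 1) + 1)) (bl d)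

/-- integrable weight -/
def iw {E : Type*} [NormedAddCommGroup E] (n : ℕ) (x : E) : ℝ := ((1 + ‖x‖)⁻¹) ^ n

lemma iw_int {E : Type*} [NormedAddCommGroup E] [NormedSpace ℝ E] [FiniteDimensional ℝ E]
    [MeasureSpace E] [BorelSpace E] [(volume : Measure E).IsAddHaarMeasure]
    (n : ℕ) (h : Module.finrank ℝ E < n) : Integrable (iw n : E → ℝ) := by
  have := integrable_one_add_norm (E := E) (μ := volume) (r := n) (by exact_mod_cast h)
  refine this.congr (Eventually.of_forall fun x => ?_)
  simp only [iw]
  rw [Real.rpow_neg (by positivity), Real.rpow_natCast, inv_pow]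

lemma iw_cont {E : Type*} [NormedAddCommGroup E] (n : ℕ) : Continuous (iw n : E → ℝ) := by
  refine Continuous.pow (Continuous.inv₀ (by fun_prop) fun x => ?_) n
  positivity

lemma iw_nonneg {E : Type*} [NormedAddCommGroup E] (n : ℕ) (x : E) : 0 ≤ iw n x := by
  unfold iw; positivity

lemma pw_cont {E : Type*} [NormedAddCommGroup E] (n : ℕ) : Continuous (pw n : E → ℝ) := by
  unfold pw; fun_prop

lemma wt_LM (M : ℕ) (x : Q d × Q d) :
    wt (LM d M) x * pw M x ≤ iw (2 * (d + 1) + 1) x := by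
  unfold LM
  rw [wt_rep, pow_add]
  have h0 := wt_nonneg (bl d) x
  have h1 := wt_bl x
  have h2 : wt (bl d) x ^ M * pw M x ≤ 1 := by
    unfold pw
    rw [← mul_pow]
    apply pow_le_one₀ (by positivity)
    calc _ ≤ (1 + ‖x‖)⁻¹ * (1 + ‖x‖) := by gcongr
      _ = 1 := inv_mul_cancel₀ (by positivity)
  have h3 : wt (bl d) x ^ (2 * (d + 1) + 1) ≤ iw (2 * (d + 1) + 1) x := pow_le_pow_left₀ h0 h1 _
  calc _ = (wt (bl d) x ^ M * pw M x) * wt (bl d) x ^ (2 * (d + 1) + 1) := by ring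
    _ ≤ 1 * iw (2 * (d + 1) + 1) x := by gcongr
    _ = _ := one_mul _

lemma iw_intP : Integrable (iw (2 * (d + 1) + 1) : Q d × Q d → ℝ) := by
  apply iw_int
  simp; omega

lemma LM_int (M : ℕ) : Integrable (fun x : Q d × Q d => wt (LM d M) x * pw M x) := by
  refine iw_intP.mono' ((wt_cont _).mul (pw_cont M)).aestronglyMeasurable
    (Eventually.of_forall fun x => ?_)
  rw [Real.norm_of_nonneg (mul_nonneg (wt_nonneg _ _) (pw_pos M x).le)]
  exact wt_LM M x

lemma vld_LM (M : ℕ) : ∀ a ∈ LM d M, Vld (th d) a := fun a ha => vld_bl a (mem_rep ha)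

def osc (d M : ℕ) (Ψ : Q d × Q d → ℂ) : ℂ := ∫ x, ex (th d) x * stps (LM d M) Ψ x

def k0 (d M : ℕ) : ℕ := (LM d M).length

lemma osc_has {M : ℕ} {Ψ : Q d × Q d → ℂ} {C : ℝ} (hs : Sm Ψ) (hb : Bd (k0 d M) (pw M) C Ψ) :
    HasOsc (th d) Ψ (osc d M Ψ) :=
  hasOsc_stps th_sm (LM d M) (vld_LM M) hs hb (LM_int M)

lemma Tame.osc {M : ℕ} {Ψ : Q d × Q d → ℂ} (h : Tame M Ψ) : HasOsc (th d) Ψ (osc d M Ψ) := by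
  obtain ⟨C, _, hC⟩ := h.2 (k0 d M)
  exact osc_has h.1 hC

lemma osc_bound (d M : ℕ) : ∃ K, 0 ≤ K ∧ ∀ (Ψ : Q d × Q d → ℂ) (C : ℝ), Sm Ψ →
    Bd (k0 d M) (pw M) C Ψ → ‖osc d M Ψ‖ ≤ K * C := by
  obtain ⟨K, hK0, hK⟩ := bd_stps (LM d M) 0
  refine ⟨K * ∫ x, wt (LM d M) x * pw M x, mul_nonneg hK0 (integral_nonneg fun x =>
    mul_nonneg (wt_nonneg _ _) (pw_pos M x).le), ?_⟩
  intro Ψ C hs hb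
  have h1 := (hK _ C Ψ hs (by simpa [k0] using hb)).val
  calc _ ≤ ∫ x, (K * C) * (wt (LM d M) x * pw M x) := by
        apply norm_integral_le_of_norm_le ((LM_int M).const_mul _)
        refine Eventually.of_forall fun x => ?_
        rw [norm_mul, ex_norm, one_mul]; exact h1 x
    _ = _ := by rw [integral_const_mul]; ring

end coords

end HTame


section HScale

set_option linter.unusedSectionVars false

open Topology Filter

section lift
variable {E : Type*} [NormedAddCommGroup E] [NormedSpace ℝ E]
variable {X : Type*} [NormedAddCommGroup X] [NormedSpace ℝ X]

def lft (X : Type*) [NormedAddCommGroup X] [NormedSpace ℝ X]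
    (a : E × (E →L[ℝ] ℝ)) : (X × E) × ((X × E) →L[ℝ] ℝ) :=
  ((0, a.1), a.2.comp (ContinuousLinearMap.snd ℝ X E))

lemma dirD_slice {Φ : X × E → ℂ} (h : Sm Φ) (v : E) (ξ : X) (x : E) :
    dirD ((0 : X), v) Φ (ξ, x) = dirD v (fun y => Φ (ξ, y)) x := by
  have := dirD_comp h (ContinuousLinearMap.inr ℝ X E) (ξ, 0) v
  have h2 := congrFun this x
  simpa using h2.symm

lemma Sm.slice {F : Type*} [NormedAddCommGroup F] [NormedSpace ℝ F] {Φ : X × E → F} (h : Sm Φ)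
    (ξ : X) : Sm (fun y => Φ (ξ, y)) :=
  ContDiff.comp h (contDiff_const.prodMk contDiff_id)

lemma stps_lift (L : List (E × (E →L[ℝ] ℝ))) {Φ : X × E → ℂ} (h : Sm Φ) (ξ : X) (x : E) :
    stps (L.map (lft X)) Φ (ξ, x) = stps L (fun y => Φ (ξ, y)) x := by
  induction L generalizing x with
  | nil => rfl
  | cons a L ih =>
    have e1 : stps ((a :: L).map (lft X)) Φ = stp (lft X a) (stps (L.map (lft X)) Φ) := rfl
    have e2 : ∀ Ψ, stps (a :: L) Ψ = stp a (stps L Ψ) := fun _ => rfl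
    rw [e1, e2]
    simp only [stp]
    have h3 : dirD (lft X a).1 (stps (L.map (lft X)) Φ) (ξ, x)
        = dirD a.1 (stps L fun y => Φ (ξ, y)) x := by
      have := dirD_slice (h.stps (L.map (lft X))) a.1 ξ x
      rw [show (lft X a).1 = ((0 : X), a.1) from rfl, this]
      congr 1; funext y; exact ih y
    rw [ih, h3]; rfl

lemma stps_param_cont (L : List (E × (E →L[ℝ] ℝ))) {Φ : X × E → ℂ} (h : Sm Φ) (x : E) :
    Continuous (fun ξ => stps L (fun y => Φ (ξ, y)) x) := by
  have : (fun ξ => stps L (fun y => Φ (ξ, y)) x) = fun ξ => stps (L.map (lft X)) Φ (ξ, x) := by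
    funext ξ; exact (stps_lift L h ξ x).symm
  rw [this]
  exact (h.stps _).continuous.comp (by fun_prop)

end lift

variable {d : ℕ}

def dgE (d : ℕ) (a b : ℝ) (ha : a ≠ 0) (hb : b ≠ 0) : Q d ≃L[ℝ] Q d :=
  (ContinuousLinearEquiv.smulLeft (Units.mk0 a ha) : ℝ ≃L[ℝ] ℝ).prodCongr
    (ContinuousLinearEquiv.smulLeft (Units.mk0 b hb) : (Fin d → ℝ) ≃L[ℝ] (Fin d → ℝ))

/-- diagonal scaling -/
def dg (a b : ℝ) (y : Q d) : Q d := (a * y.1, b • y.2)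

lemma dgE_apply (a b : ℝ) (ha : a ≠ 0) (hb : b ≠ 0) (y : Q d) : dgE d a b ha hb y = dg a b y := rfl

lemma HasOsc.scale {Ψ : Q d × Q d → ℂ} {c : ℂ} (h : HasOsc (th d) Ψ c) (a b : ℝ) (ha : a ≠ 0)
    (hb : b ≠ 0) : HasOsc (th d) (fun x => Ψ (dg a b x.1, dg a⁻¹ b⁻¹ x.2)) c := by
  set g : (Q d × Q d) ≃L[ℝ] (Q d × Q d) :=
    (dgE d a b ha hb).prodCongr (dgE d a⁻¹ b⁻¹ (inv_ne_zero ha) (inv_ne_zero hb)) with hg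
  have hgx : ∀ x, g x = (dg a b x.1, dg a⁻¹ b⁻¹ x.2) := fun x => rfl
  have e : ∀ y : Q d, dg a⁻¹ b⁻¹ (dg a b y) = y := by
    intro y
    ext
    · simp [dg, ha]
    · simp [dg, hb]
  have e' : ∀ y : Q d, dg a b (dg a⁻¹ b⁻¹ y) = y := by
    intro y
    ext
    · simp [dg, ha]
    · simp [dg, hb]
  refine h.comp g (mp_of_conj g (ContinuousLinearEquiv.prodComm ℝ (Q d) (Q d)) ?_ ?_) ?_
  · intro x; rfl
  · intro x
    simp [hgx, e, e']
  · intro x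
    rw [hgx]
    simp only [th, qdot, dg, Pi.smul_apply, smul_eq_mul]
    congr 1
    · field_simp
    · refine Finset.sum_congr rfl fun i _ => ?_
      field_simp

def kap (d : ℕ) : ℂ := osc d 0 (fun _ => 1)

lemma kap_has : HasOsc (th d) (fun _ => 1) (kap d) := (tame_const 1).osc

lemma osc_dil {M : ℕ} {h : Q d × Q d → ℂ} (hh : Tame M h) :
    Tendsto (fun n : ℕ => osc d M (fun x => h (((n : ℝ) + 1)⁻¹ • x))) atTop
      (𝓝 (kap d * h 0)) := by
  obtain ⟨C, h0, hC⟩ := hh.2 (k0 d M)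
  have e1 : osc d M (fun _ => h 0) = kap d * h 0 := by
    refine HasOsc.uniq (((tame_const (h 0)).mono (Nat.zero_le M)).osc) ?_
    have := (kap_has (d := d)).const_mul (h 0)
    simpa [mul_comm] using this
  rw [← e1]
  have hΦ : Sm (fun z : ℝ × (Q d × Q d) => h (z.1 • z.2)) :=
    ContDiff.comp hh.1 (contDiff_fst.smul contDiff_snd)
  refine tendsto_stps (th d) th_sm (LM d M) (ω := pw M) (C := C)
    (fun n => ContDiff.comp hh.1 (contDiff_const_smul _)) ?_ (LM_int M) ?_
  · refine Eventually.of_forall fun n => ?_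
    have h3 : ‖((n : ℝ) + 1)⁻¹‖ ≤ 1 := by
      rw [norm_inv, Real.norm_of_nonneg (by positivity)]
      apply inv_le_one_of_one_le₀; linarith [(Nat.cast_nonneg n : (0 : ℝ) ≤ n)]
    have := hC.comp hh.1 (((n : ℝ) + 1)⁻¹ • ContinuousLinearMap.id ℝ (Q d × Q d)) 0 (A := 1) ?_ le_rfl
    · refine Bd.mono' (by simpa [k0] using this) fun x => mul_le_mul_of_nonneg_left ?_ h0
      simp only [pw]
      gcongr
      rw [norm_smul]
      calc _ ≤ 1 * ‖x‖ := by gcongr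
        _ = _ := one_mul _
    · rw [norm_smul]
      calc _ ≤ 1 * 1 := mul_le_mul h3 ContinuousLinearMap.norm_id_le (norm_nonneg _) zero_le_one
        _ = 1 := one_mul 1
  · intro x
    have h5 := (stps_param_cont (LM d M) hΦ x).tendsto 0
    have h6 : Tendsto (fun n : ℕ => ((n : ℝ) + 1)⁻¹) atTop (𝓝 0) := by
      simpa using tendsto_one_div_add_atTop_nhds_zero_nat (𝕜 := ℝ)
    have h7 := h5.comp h6
    simpa [Function.comp_def] using h7

lemma osc_invariant {M : ℕ} {h : Q d × Q d → ℂ} (hh : Tame M h) {c : ℂ}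
    (hc : ∀ n : ℕ, HasOsc (th d) (fun x => h (((n : ℝ) + 1)⁻¹ • x)) c) : c = kap d * h 0 := by
  refine tendsto_nhds_unique (tendsto_const_nhds.congr fun n => ?_) (osc_dil hh)
  refine HasOsc.uniq (hc n) (Tame.osc ?_)
  exact hh.compL (((n : ℝ) + 1)⁻¹ • ContinuousLinearMap.id ℝ (Q d × Q d))

lemma dg_smul (a : ℝ) (y : Q d) : dg a a y = a • y := rfl

lemma osc_fst {M : ℕ} {h : Q d → ℂ} (hh : Tame M h) :
    HasOsc (th d) (fun x => h x.1) (kap d * h 0) := by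
  have h1 : Tame M (fun x : Q d × Q d => h x.1) := hh.compL (ContinuousLinearMap.fst ℝ (Q d) (Q d))
  have := osc_invariant h1 (c := osc d M (fun x => h x.1)) fun n => ?_
  · rw [show h 0 = (fun x : Q d × Q d => h x.1) 0 from rfl, ← this]; exact h1.osc
  · have hn : ((n : ℝ) + 1)⁻¹ ≠ 0 := by positivity
    exact h1.osc.scale _ _ hn hn

lemma osc_snd {M : ℕ} {h : Q d → ℂ} (hh : Tame M h) :
    HasOsc (th d) (fun x => h x.2) (kap d * h 0) := by
  have h1 : Tame M (fun x : Q d × Q d => h x.2) := hh.compL (ContinuousLinearMap.snd ℝ (Q d) (Q d))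
  have := osc_invariant h1 (c := osc d M (fun x => h x.2)) fun n => ?_
  · rw [show h 0 = (fun x : Q d × Q d => h x.2) 0 from rfl, ← this]; exact h1.osc
  · have hn : ((n : ℝ) + 1) ≠ 0 := by positivity
    exact h1.osc.scale _ _ hn hn

/-- one-dimensional gaussian -/
def ga (t : ℝ) : ℂ := ((Real.exp (-(t ^ 2 / 2)) : ℝ) : ℂ)

lemma ga_tame : Tame 0 ga := by
  have hs : Sm (fun t : ℝ => Real.exp (-(t ^ 2 / 2))) := by
    unfold Sm; fun_prop
  have hs' : Sm ga := Complex.ofRealCLM.contDiff.comp hs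
  refine tame_of hs' fun k => ?_
  have h1 : ∃ C, ∀ x, |Polynomial.aeval x (Polynomial.hermite k) * Real.exp (-(x ^ 2 / 2))| ≤ C := by
    have key : ∀ p : Polynomial ℤ, ∃ C, ∀ x : ℝ, |Polynomial.aeval x p * Real.exp (-(x ^ 2 / 2))| ≤ C := by
      intro p
      induction p using Polynomial.induction_on' with
      | add p q hp hq =>
        obtain ⟨C, hC⟩ := hp
        obtain ⟨C', hC'⟩ := hq
        refine ⟨C + C', fun x => ?_⟩
        rw [map_add, add_mul]
        exact (abs_add_le _ _).trans (add_le_add (hC x) (hC' x))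
      | monomial n a =>
        refine ⟨|(a : ℝ)| * ((n.factorial : ℝ) * Real.exp 1), fun x => ?_⟩
        rw [Polynomial.aeval_monomial]
        simp only [eq_intCast, abs_mul, abs_pow, Real.abs_exp, mul_assoc]
        refine mul_le_mul_of_nonneg_left ?_ (abs_nonneg _)
        have h2 := Real.pow_div_factorial_le_exp |x| (abs_nonneg x) n
        rw [div_le_iff₀ (by positivity)] at h2
        calc _ ≤ (Real.exp |x| * (n.factorial : ℝ)) * Real.exp (-(x ^ 2 / 2)) :=
              mul_le_mul_of_nonneg_right h2 (Real.exp_pos _).le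
          _ = (n.factorial : ℝ) * Real.exp (|x| + (-(x ^ 2 / 2))) := by rw [Real.exp_add]; ring
          _ ≤ _ := by
            refine mul_le_mul_of_nonneg_left (Real.exp_le_exp.2 ?_) (by positivity)
            rw [← sq_abs]; nlinarith [sq_nonneg (|x| - 1)]
    exact key _
  obtain ⟨C, hC⟩ := h1
  refine ⟨C, fun x => ?_⟩
  simp only [pw, pow_zero, mul_one]
  have h2 : iteratedFDeriv ℝ k ga x = Complex.ofRealCLM.compContinuousMultilinearMap
      (iteratedFDeriv ℝ k (fun t : ℝ => Real.exp (-(t ^ 2 / 2))) x) :=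
    Complex.ofRealCLM.iteratedFDeriv_comp_left (hs.contDiffAt (x := x)) (by exact_mod_cast le_top)
  rw [h2]
  refine (ContinuousLinearMap.norm_compContinuousMultilinearMap_le _ _).trans ?_
  rw [Complex.ofRealCLM_norm, one_mul, norm_iteratedFDeriv_eq_norm_iteratedDeriv,
    iteratedDeriv_eq_iterate, Polynomial.deriv_gaussian_eq_hermite_mul_gaussian]
  refine le_trans (le_of_eq ?_) (hC x)
  rw [Real.norm_eq_abs, mul_assoc, abs_mul]; simp

def gaV (y : Q d) : ℂ := ∏ i, ga (co d i y)

lemma tame_prod {E : Type*} [NormedAddCommGroup E] [NormedSpace ℝ E] {ι : Type*} (s : Finset ι)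
    {Ψ : ι → E → ℂ} (h : ∀ i, Tame 0 (Ψ i)) : Tame 0 (fun x => ∏ i ∈ s, Ψ i x) := by
  classical
  induction s using Finset.induction_on with
  | empty => simpa using (tame_const (E := E) 1)
  | insert a s ha ih => simp only [Finset.prod_insert ha]; exact (h a).mul ih

lemma gaV_tame : Tame 0 (gaV (d := d)) := tame_prod _ fun i => ga_tame.compL (co d i)

lemma int_prod_co (g : Option (Fin d) → ℝ → ℂ) :
    ∫ y : Q d, ∏ i, g i (co d i y) = ∏ i, ∫ t, g i t := by
  have h1 : ∀ y : Q d, ∏ i, g i (co d i y) = g none y.1 * ∏ i, g (some i) (y.2 i) := by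
    intro y; rw [Fintype.prod_option]; rfl
  simp only [h1]
  have h2 := integral_prod_mul (μ := (volume : Measure ℝ)) (ν := (volume : Measure (Fin d → ℝ)))
    (g none) (fun z => ∏ i, g (some i) (z i))
  have h3 := integral_fintype_prod_volume_eq_prod (ι := Fin d) (E := fun _ => ℝ)
    (fun i => g (some i))
  refine h2.trans ?_
  rw [h3, Fintype.prod_option]

lemma ga_scale_eq (l t : ℝ) : ga (l * t) = Complex.exp (-((l ^ 2 / 2 : ℝ) : ℂ) * (t : ℂ) ^ 2) := by
  rw [ga, Complex.ofReal_exp]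
  congr 1; push_cast; ring

lemma ga_int (l : ℝ) (hl : 0 < l) : Integrable (fun t => ga (l * t)) := by
  have h : Integrable (fun t : ℝ => Real.exp (-(l ^ 2 / 2) * t ^ 2)) :=
    integrable_exp_neg_mul_sq (by positivity)
  refine h.ofReal.congr (Filter.Eventually.of_forall fun t => ?_)
  show _ = ((Real.exp (-((l * t) ^ 2 / 2)) : ℝ) : ℂ)
  have : -(l ^ 2 / 2) * t ^ 2 = -((l * t) ^ 2 / 2) := by ring
  rw [← this]; rfl

lemma gaV_int (l : ℝ) (hl : 0 < l) : Integrable (fun y : Q d => gaV (l • y)) := by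
  have h1 : ∀ y : Q d, gaV (l • y) = ga (l * y.1) * ∏ i, ga (l * y.2 i) := by
    intro y; rw [gaV, Fintype.prod_option]; rfl
  simp only [h1]
  exact (ga_int l hl).mul_prod (Integrable.fintype_prod (fun _ => ga_int l hl))

lemma ga_osc (l : ℝ) (hl : 0 < l) (hl1 : l ≤ 1) :
    ∃ r : ℝ, 1 ≤ r ∧ ∫ z : ℝ, (∫ y : ℝ, Complex.exp (Complex.I * y * z) * ga (l * y)) * ga (l * z)
      = r := by
  have h1 : ∀ z : ℝ, (∫ y : ℝ, Complex.exp (Complex.I * y * z) * ga (l * y)) * ga (l * z)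
      = (Real.sqrt (Real.pi / (l ^ 2 / 2)) * Real.exp (-((l ^ 2 / 2) + 1 / (4 * (l ^ 2 / 2))) * z ^ 2) : ℝ) := by
    intro z
    have hre : 0 < (((l ^ 2 / 2 : ℝ) : ℂ)).re := by rw [Complex.ofReal_re]; positivity
    have := fourierIntegral_gaussian hre (z : ℂ)
    have e : (∫ y : ℝ, Complex.exp (Complex.I * y * z) * ga (l * y))
        = ∫ x : ℝ, Complex.exp (Complex.I * z * x) * Complex.exp (-((l ^ 2 / 2 : ℝ) : ℂ) * x ^ 2) := by
      refine integral_congr_ae (Filter.Eventually.of_forall fun y => ?_)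
      simp only []
      rw [ga_scale_eq]; congr 2; ring
    rw [e, this, Complex.ofReal_mul, Complex.ofReal_exp, Real.sqrt_eq_rpow,
      Complex.ofReal_cpow (by positivity), ga_scale_eq, mul_assoc, ← Complex.exp_add]
    congr 1
    · push_cast; norm_num
    · congr 1; push_cast
      have : (l : ℂ) ≠ 0 := by exact_mod_cast hl.ne'
      field_simp; ring
  simp only [h1]
  rw [integral_complex_ofReal, integral_const_mul, integral_gaussian]
  refine ⟨_, ?_, rfl⟩
  rw [← Real.sqrt_mul (by positivity)]
  apply Real.one_le_sqrt.2
  have hp := Real.pi_gt_three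
  have e : Real.pi / (l ^ 2 / 2) * (Real.pi / (l ^ 2 / 2 + 1 / (4 * (l ^ 2 / 2))))
    = 4 * Real.pi ^ 2 / (l ^ 4 + 1) := by
    field_simp; ring
  rw [e, one_le_div (by positivity)]
  have : l ^ 4 ≤ 1 := pow_le_one₀ hl.le hl1
  nlinarith

lemma kap_ne : kap d ≠ 0 := by
  intro h0
  have hT : Tame 0 (fun x : Q d × Q d => gaV x.1 * gaV x.2) :=
    (gaV_tame.compL (ContinuousLinearMap.fst ℝ (Q d) (Q d))).mul
      (gaV_tame.compL (ContinuousLinearMap.snd ℝ (Q d) (Q d)))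
  have hlim := osc_dil hT
  rw [h0, zero_mul] at hlim
  have key : ∀ n : ℕ, 1 ≤ ‖osc d 0 (fun x => (fun x : Q d × Q d => gaV x.1 * gaV x.2)
      (((n : ℝ) + 1)⁻¹ • x))‖ := by
    intro n
    set l : ℝ := ((n : ℝ) + 1)⁻¹ with hl
    have l0 : 0 < l := by positivity
    have l1 : l ≤ 1 := inv_le_one_of_one_le₀ (by linarith [(Nat.cast_nonneg n : (0 : ℝ) ≤ n)])
    have hT' : Tame 0 (fun x => (fun x : Q d × Q d => gaV x.1 * gaV x.2) (l • x)) :=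
      hT.compL (l • ContinuousLinearMap.id ℝ (Q d × Q d))
    have hi : Integrable (fun x => (fun x : Q d × Q d => gaV x.1 * gaV x.2) (l • x)) :=
      (gaV_int l l0).mul_prod (gaV_int l l0)
    rw [HasOsc.uniq hT'.osc (hasOsc_int th_sm hT'.1 hi)]
    have hi2 : Integrable (fun x => ex (th d) x *
        (fun x : Q d × Q d => gaV x.1 * gaV x.2) (l • x)) := by
      refine hi.bdd_mul (c := 1) (ex_sm th_sm).continuous.aestronglyMeasurable ?_
      exact Filter.Eventually.of_forall fun x => (ex_norm _ _).le
    rw [show (volume : Measure (Q d × Q d)) = (volume : Measure (Q d)).prod volume from rfl] at hi2 ⊢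
    rw [integral_prod_symm _ hi2]
    obtain ⟨r, hr, hr'⟩ := ga_osc l l0 l1
    have e : ∀ z : Q d, (∫ y : Q d, ex (th d) (y, z) *
        (fun x : Q d × Q d => gaV x.1 * gaV x.2) (l • (y, z)))
        = ∏ i, ((fun s : ℝ => (∫ t : ℝ, Complex.exp (Complex.I * t * s) * ga (l * t)) * ga (l * s))
            (co d i z)) := by
      intro z
      rw [Finset.prod_mul_distrib, ← int_prod_co (fun i t => Complex.exp (Complex.I * t * (co d i z : ℝ))
        * ga (l * t)), ← integral_mul_const]
      refine integral_congr_ae (Filter.Eventually.of_forall fun y => ?_)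
      simp only [Prod.smul_fst, Prod.smul_snd, gaV, map_smul, smul_eq_mul, Finset.prod_mul_distrib]
      rw [← mul_assoc]
      congr 2
      rw [← Complex.exp_sum, ex, th, qdot_co]
      congr 1
      push_cast
      rw [Finset.mul_sum]
      exact Finset.sum_congr rfl fun i _ => by ring
    simp only [e]
    rw [int_prod_co (fun _ s => (∫ t : ℝ, Complex.exp (Complex.I * t * s) * ga (l * t)) * ga (l * s)),
      hr', Finset.prod_const, norm_pow, Complex.norm_real, Real.norm_of_nonneg (by linarith)]
    exact one_le_pow₀ hr
  have := ge_of_tendsto' hlim.norm key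
  simp at this
  linarith

end HScale


section Param

set_option linter.unusedSectionVars false

open Topology Filter

section gen
variable {X : Type} [NormedAddCommGroup X] [NormedSpace ℝ X]
variable {E : Type} [NormedAddCommGroup E] [NormedSpace ℝ E] [FiniteDimensional ℝ E]
  [MeasureSpace E] [BorelSpace E]

def inlc (X E F : Type) [NormedAddCommGroup X] [NormedSpace ℝ X]
    [NormedAddCommGroup E] [NormedSpace ℝ E] [NormedAddCommGroup F] [NormedSpace ℝ F] :
    ((X × E) →L[ℝ] F) →L[ℝ] (X →L[ℝ] F) :=
  (ContinuousLinearMap.compL ℝ X (X × E) F).flip (ContinuousLinearMap.inl ℝ X E)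

lemma inlc_apply {F : Type} [NormedAddCommGroup F] [NormedSpace ℝ F] (T : (X × E) →L[ℝ] F) (v : X) :
    inlc X E F T v = T (v, 0) := rfl

lemma hfd {F : Type} [NormedAddCommGroup F] [NormedSpace ℝ F] [NormedSpace ℂ F] {J : X × E → F}
    (hJ : Sm J) {e : E → ℂ} (he : Continuous e) (he1 : ∀ x, ‖e x‖ ≤ 1)
    {η : X → ℝ} {ν : E → ℝ} (hη : Continuous η) (hν : Integrable ν) (hν0 : ∀ x, 0 ≤ ν x)
    {C : ℝ} (hC0 : 0 ≤ C)
    (h0 : ∀ ξ x, ‖J (ξ, x)‖ ≤ C * (η ξ * ν x))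
    (h1 : ∀ ξ x, ‖inlc X E F (fderiv ℝ J (ξ, x))‖ ≤ C * (η ξ * ν x)) (ξ : X) :
    HasFDerivAt (fun ξ => ∫ x, e x • J (ξ, x)) (∫ x, e x • inlc X E F (fderiv ℝ J (ξ, x))) ξ := by
  have cJ : ∀ ξ, Continuous fun x => e x • J (ξ, x) := fun ξ =>
    he.smul (hJ.continuous.comp (by fun_prop))
  have cJ' : Continuous fun x => e x • inlc X E F (fderiv ℝ J (ξ, x)) :=
    he.smul ((inlc X E F).continuous.comp (hJ.fderiv'.continuous.comp (by fun_prop)))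
  have hs : {ξ' | η ξ' < η ξ + 1} ∈ 𝓝 ξ :=
    (isOpen_lt hη continuous_const).mem_nhds (by simp)
  have nb : ∀ (x : E) (w : F), ‖e x • w‖ ≤ ‖w‖ := fun x w => by
    rw [norm_smul]; exact mul_le_of_le_one_left (norm_nonneg _) (he1 x)
  refine hasFDerivAt_integral_of_dominated_of_fderiv_le (𝕜 := ℝ) (bound := fun x => C * ((η ξ + 1) * ν x))
    (F' := fun ξ x => e x • inlc X E F (fderiv ℝ J (ξ, x))) hs
    (Eventually.of_forall fun ξ => (cJ ξ).aestronglyMeasurable) ?_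
    cJ'.aestronglyMeasurable ?_ ((hν.const_mul _).const_mul C) ?_
  · refine ((hν.const_mul (η ξ)).const_mul C).mono' (cJ ξ).aestronglyMeasurable
      (Eventually.of_forall fun x => (nb x _).trans (h0 ξ x))
  · refine Eventually.of_forall fun x ξ' hξ' => ?_
    rw [norm_smul]
    refine (mul_le_of_le_one_left (norm_nonneg _) (he1 x)).trans ((h1 ξ' x).trans ?_)
    refine mul_le_mul_of_nonneg_left (mul_le_mul_of_nonneg_right (le_of_lt hξ') (hν0 x)) hC0
  · refine Eventually.of_forall fun x ξ' _ => ?_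
    have h3 : HasFDerivAt (fun ξ : X => J (ξ, x)) ((fderiv ℝ J (ξ', x)).comp
        (ContinuousLinearMap.inl ℝ X E)) ξ' := by
      have h4 : HasFDerivAt (fun ξ : X => (ξ, x)) (ContinuousLinearMap.inl ℝ X E) ξ' :=
        hasFDerivAt_prodMk_left ξ' x
      exact HasFDerivAt.comp ξ' (hJ.diff _).hasFDerivAt h4
    exact h3.const_smul (e x)

/-- parameter-dependent bound -/
def PB {F : Type} [NormedAddCommGroup F] [NormedSpace ℝ F] (η : X → ℝ) (ν : E → ℝ) (J : X × E → F) :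
    Prop := Sm J ∧ ∀ k, ∃ C, 0 ≤ C ∧ ∀ z, ‖iteratedFDeriv ℝ k J z‖ ≤ C * (η z.1 * ν z.2)

lemma PB.fd {F : Type} [NormedAddCommGroup F] [NormedSpace ℝ F] {η : X → ℝ} {ν : E → ℝ} {J : X × E → F}
    (h : PB η ν J) : PB η ν (fun z => inlc X E F (fderiv ℝ J z)) := by
  refine ⟨(inlc X E F).contDiff.comp h.1.fderiv', fun k => ?_⟩
  obtain ⟨C, hC0, hC⟩ := h.2 (k + 1)
  refine ⟨‖inlc X E F‖ * C, by positivity, fun z => ?_⟩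
  have := (inlc X E F).norm_iteratedFDeriv_comp_left (h.1.fderiv'.contDiffAt (x := z)) (n := k)
    (by exact_mod_cast le_top)
  rw [norm_iteratedFDeriv_fderiv] at this
  refine this.trans ?_
  rw [mul_assoc]
  exact mul_le_mul_of_nonneg_left (hC z) (norm_nonneg _)

variable {e : E → ℂ} {η : X → ℝ} {ν : E → ℝ}

lemma PB.hfd {F : Type} [NormedAddCommGroup F] [NormedSpace ℝ F] [NormedSpace ℂ F] {J : X × E → F}
    (h : PB η ν J) (he : Continuous e) (he1 : ∀ x, ‖e x‖ ≤ 1)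
    (hη : Continuous η) (hη0 : ∀ ξ, 0 ≤ η ξ) (hν : Integrable ν) (hν0 : ∀ x, 0 ≤ ν x) (ξ : X) :
    HasFDerivAt (fun ξ => ∫ x, e x • J (ξ, x)) (∫ x, e x • inlc X E F (fderiv ℝ J (ξ, x))) ξ := by
  obtain ⟨C, hC0, hC⟩ := h.2 0
  obtain ⟨C', hC0', hC'⟩ := h.fd.2 0
  refine _root_.hfd h.1 he he1 hη hν hν0 (C := C + C') (by positivity) (fun ξ x => ?_) (fun ξ x => ?_) ξ
  · have := hC (ξ, x)
    rw [norm_iteratedFDeriv_zero] at this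
    refine this.trans (mul_le_mul_of_nonneg_right (by linarith) (mul_nonneg (hη0 _) (hν0 _)))
  · have := hC' (ξ, x)
    rw [norm_iteratedFDeriv_zero] at this
    refine this.trans (mul_le_mul_of_nonneg_right (by linarith) (mul_nonneg (hη0 _) (hν0 _)))

lemma PB.smooth_aux (he : Continuous e) (he1 : ∀ x, ‖e x‖ ≤ 1)
    (hη : Continuous η) (hη0 : ∀ ξ, 0 ≤ η ξ) (hν : Integrable ν) (hν0 : ∀ x, 0 ≤ ν x) (k : ℕ) :
    ∀ (F : Type) [NormedAddCommGroup F] [NormedSpace ℝ F] [NormedSpace ℂ F]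
      (J : X × E → F), PB η ν J →
    ContDiff ℝ k (fun ξ => ∫ x, e x • J (ξ, x)) ∧
    ∃ C, ∀ ξ, ‖iteratedFDeriv ℝ k (fun ξ => ∫ x, e x • J (ξ, x)) ξ‖ ≤ C * η ξ := by
  induction k with
  | zero =>
    intro F _ _ _ J h
    refine ⟨contDiff_zero.2 (continuous_iff_continuousAt.2 fun ξ =>
      (h.hfd he he1 hη hη0 hν hν0 ξ).continuousAt), ?_⟩
    obtain ⟨C, hC0, hC⟩ := h.2 0
    refine ⟨C * ∫ x, ν x, fun ξ => ?_⟩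
    rw [norm_iteratedFDeriv_zero]
    have : ‖∫ x, e x • J (ξ, x)‖ ≤ ∫ x, C * (η ξ * ν x) := by
      refine norm_integral_le_of_norm_le ((hν.const_mul _).const_mul C) (Eventually.of_forall fun x => ?_)
      have := hC (ξ, x)
      rw [norm_iteratedFDeriv_zero] at this
      rw [norm_smul]; exact (mul_le_of_le_one_left (norm_nonneg _) (he1 x)).trans this
    refine this.trans (le_of_eq ?_)
    rw [integral_const_mul, integral_const_mul]; ring
  | succ k ih =>
    intro F _ _ _ J h
    have hd := h.hfd he he1 hη hη0 hν hν0
    have e1 : fderiv ℝ (fun ξ => ∫ x, e x • J (ξ, x))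
        = fun ξ => ∫ x, e x • inlc X E F (fderiv ℝ J (ξ, x)) := funext fun ξ => (hd ξ).fderiv
    obtain ⟨i1, C, i2⟩ := ih _ _ h.fd
    refine ⟨?_, C, fun ξ => ?_⟩
    · have := (contDiff_succ_iff_fderiv (𝕜 := ℝ) (n := (k : WithTop ℕ∞))
        (f := fun ξ => ∫ x, e x • J (ξ, x))).2 ⟨fun ξ => (hd ξ).differentiableAt, by simp, by rw [e1]; exact i1⟩
      exact_mod_cast this
    · rw [← norm_iteratedFDeriv_fderiv, e1]; exact i2 ξ

end gen

section comm
variable {X : Type} [NormedAddCommGroup X] [NormedSpace ℝ X]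
variable {E : Type} [NormedAddCommGroup E] [NormedSpace ℝ E]

lemma stps_dirD_lift (L : List (E × (E →L[ℝ] ℝ))) {Φ : X × E → ℂ} (h : Sm Φ) (v : X) :
    dirD (v, (0 : E)) (stps (L.map (lft X)) Φ) = stps (L.map (lft X)) (dirD (v, (0 : E)) Φ) := by
  induction L with
  | nil => rfl
  | cons a L ih =>
    have e1 : ∀ Φ : X × E → ℂ, stps ((a :: L).map (lft X)) Φ = stp (lft X a) (stps (L.map (lft X)) Φ) :=
      fun _ => rfl
    rw [e1, e1, ← ih]
    have hs := h.stps (L.map (lft X))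
    generalize stps (L.map (lft X)) Φ = Ψ at hs
    unfold stp
    have h2 := dirD_mul (sm_inv (lft X a).2) (ContDiff.sub hs (hs.dirD (lft X a).1)) (v, (0 : E))
    rw [dirD_inv _ _ (by simp [lft])] at h2
    rw [h2]
    have h3 := dirD_sub hs (hs.dirD (lft X a).1) (v, (0 : E))
    funext z
    simp only [zero_mul, zero_add]
    rw [h3, dirD_comm hs]
end comm

variable {d : ℕ}
variable {X : Type} [NormedAddCommGroup X] [NormedSpace ℝ X]

lemma wt_lift {E : Type} [NormedAddCommGroup E] [NormedSpace ℝ E] (L : List (E × (E →L[ℝ] ℝ)))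
    (z : X × E) : wt (L.map (lft X)) z = wt L z.2 := by
  simp [wt, lft, Function.comp_def]

lemma osc_eq {M : ℕ} {Φ : X × (Q d × Q d) → ℂ} (h : Sm Φ) (ξ : X) :
    osc d M (fun x => Φ (ξ, x)) = ∫ x, ex (th d) x • stps ((LM d M).map (lft X)) Φ (ξ, x) := by
  unfold osc
  refine integral_congr_ae (Eventually.of_forall fun x => ?_)
  simp only [smul_eq_mul]
  rw [stps_lift _ h]

lemma Tame.pb {M : ℕ} {Φ : X × (Q d × Q d) → ℂ} (h : Tame M Φ) :
    PB (pw M) (fun x => wt (LM d M) x * pw M x) (stps ((LM d M).map (lft X)) Φ) := by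
  refine ⟨h.1.stps _, fun k => ?_⟩
  obtain ⟨K, hK0, hK⟩ := bd_stps ((LM d M).map (lft X)) k
  obtain ⟨C, hC0, hC⟩ := h.2 (k + ((LM d M).map (lft X)).length)
  refine ⟨K * C, by positivity, fun z => ?_⟩
  refine (hK _ C Φ h.1 hC k le_rfl z).trans ?_
  refine mul_le_mul_of_nonneg_left ?_ (by positivity)
  simp only [wt_lift]
  calc _ ≤ wt (LM d M) z.2 * (pw M z.1 * pw M z.2) :=
      mul_le_mul_of_nonneg_left (pw_prod M z) (wt_nonneg _ _)
    _ = _ := by ring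

lemma tame_osc_param {M : ℕ} {Φ : X × (Q d × Q d) → ℂ} (h : Tame M Φ) :
    Tame M (fun ξ => osc d M (fun x => Φ (ξ, x))) := by
  have hc : Continuous (ex (th d)) := (ex_sm th_sm).continuous
  have key := fun k => PB.smooth_aux (X := X) hc (fun x => (ex_norm _ _).le) (η := pw M) (pw_cont M)
    (fun ξ => (pw_pos M ξ).le) (LM_int M) (fun x => mul_nonneg (wt_nonneg _ _) (pw_pos M x).le) k ℂ
    _ h.pb
  have e : (fun ξ => osc d M (fun x => Φ (ξ, x)))
    = fun ξ => ∫ x, ex (th d) x • stps ((LM d M).map (lft X)) Φ (ξ, x) := funext fun ξ => osc_eq h.1 ξ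
  rw [e]
  exact tame_of (contDiff_infty.2 fun k => (key k).1) fun k => (key k).2

lemma clm_int_apply {E F : Type} [NormedAddCommGroup E] [NormedSpace ℝ E] [MeasureSpace E]
    [NormedAddCommGroup F] [NormedSpace ℝ F]
    {φ : E → (F →L[ℝ] ℂ)} (h : Integrable φ) (v : F) : (∫ x, φ x) v = ∫ x, φ x v :=
  ContinuousLinearMap.integral_apply h v

lemma hfd_dirD {M : ℕ} {Φ : X × (Q d × Q d) → ℂ} (hs : Sm Φ) {ξ : X}
    {C : ℝ} {η : X → ℝ}
    (h1 : ∀ ξ x, ‖inlc X (Q d × Q d) ℂ (fderiv ℝ (stps ((LM d M).map (lft X)) Φ) (ξ, x))‖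
      ≤ C * (η ξ * (wt (LM d M) x * pw M x)))
    (h : HasFDerivAt (fun ξ => ∫ x, ex (th d) x • stps ((LM d M).map (lft X)) Φ (ξ, x))
      (∫ x, ex (th d) x • inlc X (Q d × Q d) ℂ (fderiv ℝ (stps ((LM d M).map (lft X)) Φ) (ξ, x))) ξ)
    (v : X) :
    fderiv ℝ (fun ξ => osc d M (fun x => Φ (ξ, x))) ξ v
      = osc d M (fun x => dirD (v, (0 : Q d × Q d)) Φ (ξ, x)) := by
  have e : (fun ξ => osc d M (fun x => Φ (ξ, x)))
    = fun ξ => ∫ x, ex (th d) x • stps ((LM d M).map (lft X)) Φ (ξ, x) := funext fun ξ => osc_eq hs ξ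
  rw [e, h.fderiv, osc_eq (hs.dirD _), ← stps_dirD_lift _ hs, clm_int_apply]
  · rfl
  · have cJ' : Continuous fun x => ex (th d) x • inlc X (Q d × Q d) ℂ
        (fderiv ℝ (stps ((LM d M).map (lft X)) Φ) (ξ, x)) :=
      (ex_sm th_sm).continuous.smul ((inlc X (Q d × Q d) ℂ).continuous.comp
        ((hs.stps _).fderiv'.continuous.comp (by fun_prop)))
    refine (((LM_int M).const_mul (η ξ)).const_mul C).mono' cJ'.aestronglyMeasurable
      (Eventually.of_forall fun x => ?_)
    rw [norm_smul, ex_norm, one_mul]; exact h1 ξ x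

lemma tame_dirD_osc {M : ℕ} {Φ : X × (Q d × Q d) → ℂ} (h : Tame M Φ) (v ξ : X) :
    dirD v (fun ξ => osc d M (fun x => Φ (ξ, x))) ξ
      = osc d M (fun x => dirD (v, (0 : Q d × Q d)) Φ (ξ, x)) := by
  have hc : Continuous (ex (th d)) := (ex_sm th_sm).continuous
  have h2 := h.pb.hfd (X := X) hc (fun x => (ex_norm _ _).le) (η := pw M) (pw_cont M)
    (fun ξ => (pw_pos M ξ).le) (LM_int M) (fun x => mul_nonneg (wt_nonneg _ _) (pw_pos M x).le) ξ
  obtain ⟨C, _, hC⟩ := h.pb.fd.2 0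
  refine hfd_dirD h.1 (C := C) (η := pw M) (fun ξ x => ?_) h2 v
  simpa using hC (ξ, x)

lemma Tame.slice {M : ℕ} {Φ : X × (Q d × Q d) → ℂ} (h : Tame M Φ) (ξ : X) :
    Tame M (fun x => Φ (ξ, x)) := by
  have := h.comp (ContinuousLinearMap.inr ℝ X (Q d × Q d)) (ξ, 0)
  simpa using this

end Param


section Taylor

open Topology Filter

variable {d : ℕ}

lemma taylor_aux (n : ℕ) : ∀ (F : ℕ → ℝ → ℂ) (K : ℝ),
    (∀ j s, HasDerivAt (F j) (Complex.I * F (j + 1) s) s) →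
    (∀ s ∈ Set.Icc (0 : ℝ) 1, ‖F n s‖ ≤ K) → ∀ h ∈ Set.Icc (0 : ℝ) 1,
    ‖F 0 h - ∑ j ∈ Finset.range n, (h : ℂ) ^ j * (Complex.I ^ j / (j.factorial : ℂ)) * F j 0‖
      ≤ h ^ n * K := by
  induction n with
  | zero => intro F K _ hK h hh; simpa using hK h hh
  | succ n ih =>
    intro F K hF hK h hh
    have ih' := ih (fun j => F (j + 1)) K (fun j s => hF (j + 1) s) hK
    set R : ℝ → ℂ := fun h => F 0 h - ∑ j ∈ Finset.range (n + 1),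
      (h : ℂ) ^ j * (Complex.I ^ j / (j.factorial : ℂ)) * F j 0 with hR
    have hd : ∀ s, HasDerivAt R (Complex.I * (F 1 s - ∑ j ∈ Finset.range n,
      (s : ℂ) ^ j * (Complex.I ^ j / (j.factorial : ℂ)) * F (j + 1) 0)) s := by
      intro s
      have h1 : ∀ j : ℕ, HasDerivAt (fun h : ℝ => (h : ℂ) ^ j * (Complex.I ^ j / (j.factorial : ℂ)) * F j 0)
          ((j * (s : ℂ) ^ (j - 1)) * (Complex.I ^ j / (j.factorial : ℂ)) * F j 0) s := by
        intro j
        have := ((hasDerivAt_pow j (s : ℂ)).comp_ofReal.mul_const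
          (Complex.I ^ j / (j.factorial : ℂ))).mul_const (F j 0)
        simpa using this
      have h2 := HasDerivAt.fun_sum (u := Finset.range (n + 1)) fun j _ => h1 j
      have h3 := (hF 0 s).sub h2
      refine h3.congr_deriv ?_
      rw [Finset.sum_range_succ', mul_sub, Finset.mul_sum]
      simp only [Nat.cast_zero, zero_mul, add_zero, zero_add]
      congr 1
      refine Finset.sum_congr rfl fun j _ => ?_
      rw [Nat.factorial_succ, Nat.add_sub_cancel]
      push_cast
      have e1 : (j : ℂ) + 1 ≠ 0 := by exact_mod_cast Nat.succ_ne_zero j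
      have e2 : (j.factorial : ℂ) ≠ 0 := by exact_mod_cast Nat.factorial_ne_zero j
      field_simp
      ring
    have hR0 : R 0 = 0 := by
      simp [hR, Finset.sum_range_succ', zero_pow]
    have := norm_image_sub_le_of_norm_deriv_le_segment' (f := R) (a := 0) (b := h) (C := h ^ n * K)
      (fun s _ => (hd s).hasDerivWithinAt) (fun s hs => ?_) h ⟨hh.1, le_rfl⟩
    · rw [hR0, sub_zero, sub_zero] at this
      refine this.trans (le_of_eq (by ring))
    · rw [norm_mul, Complex.norm_I, one_mul]
      have hs1 : s ∈ Set.Icc (0 : ℝ) 1 := ⟨hs.1, hs.2.le.trans hh.2⟩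
      have hK0 : 0 ≤ K := (norm_nonneg _).trans (hK s hs1)
      refine (ih' s hs1).trans ?_
      have hs0 := hs.1
      have := pow_le_pow_left₀ hs.1 hs.2.le n
      exact mul_le_mul_of_nonneg_right this hK0

/-- `(y,z) ↦ (y, s z)` -/
def zs (d : ℕ) (s : ℝ) : (Q d × Q d) →L[ℝ] (Q d × Q d) :=
  (ContinuousLinearMap.fst ℝ (Q d) (Q d)).prod (s • ContinuousLinearMap.snd ℝ (Q d) (Q d))

lemma zs_apply (s : ℝ) (x : Q d × Q d) : zs d s x = (x.1, s • x.2) := rfl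

lemma zs_norm (s : ℝ) : ‖zs d s‖ ≤ 1 + |s| := by
  refine ContinuousLinearMap.opNorm_le_bound _ (by positivity) fun x => ?_
  rw [zs_apply, Prod.norm_def, add_mul, one_mul]
  refine max_le ((norm_fst_le x).trans (by simp; positivity)) ?_
  rw [norm_smul, Real.norm_eq_abs]
  exact (mul_le_mul_of_nonneg_left (norm_snd_le x) (abs_nonneg s)).trans
    (by linarith [norm_nonneg x])

/-- `∑ ∂_{y_i} ∂_{z_i}` -/
def Xop (h : Q d × Q d → ℂ) : Q d × Q d → ℂ :=
  fun x => ∑ i, dirD (ee d i, (0 : Q d)) (dirD ((0 : Q d), ee d i) h) x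

lemma Tame.Xop {M : ℕ} {h : Q d × Q d → ℂ} (hh : Tame M h) : Tame M (Xop h) :=
  Tame.sum _ fun _ => (hh.dirD _).dirD _

lemma bd_unif {G : Type} [NormedAddCommGroup G] [NormedSpace ℝ G] {M : ℕ} {W : G → ℂ} (hW : Tame M W)
    (k : ℕ) : ∃ C, 0 ≤ C ∧ ∀ (L : (Q d × Q d) →L[ℝ] G) (A : ℝ), 1 ≤ A → ‖L‖ ≤ A →
      Bd k (pw M) (C * (A ^ k * A ^ M)) (fun x => W (L x)) := by
  obtain ⟨C, h0, hC⟩ := hW.2 k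
  refine ⟨C, h0, fun L A hA hL => ?_⟩
  have := hC.comp hW.1 L 0 hL hA
  simp only [add_zero] at this
  refine this.mono' fun x => ?_
  have h1 : pw M (L x) ≤ A ^ M * pw M x := by
    unfold pw
    rw [← mul_pow]
    apply pow_le_pow_left₀ (by positivity)
    have h2 := L.le_opNorm x
    have h3 := mul_le_mul_of_nonneg_right hL (norm_nonneg x)
    nlinarith
  have hA0 : 0 ≤ A := by linarith
  calc A ^ k * C * pw M (L x) ≤ A ^ k * C * (A ^ M * pw M x) :=
      mul_le_mul_of_nonneg_left h1 (by positivity)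
    _ = _ := by ring

/-- the function `(v, x) ↦ ∂_{(0,v)} h (x)` -/
def Wf (h : Q d × Q d → ℂ) : Q d × (Q d × Q d) → ℂ :=
  fun x => ∑ i, ((co d i x.1 : ℝ) : ℂ) * dirD ((0 : Q d), ee d i) h x.2

lemma Wf_tame {M : ℕ} {h : Q d × Q d → ℂ} (hh : Tame M h) : Tame (M + 1) (Wf h) := by
  refine Tame.sum _ fun i => ?_
  rw [add_comm]
  exact (tame_lin ((co d i).comp (ContinuousLinearMap.fst ℝ (Q d) (Q d × Q d)))).mul
    ((hh.dirD _).compL (ContinuousLinearMap.snd ℝ (Q d) (Q d × Q d)))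

lemma osc_zs_deriv {M : ℕ} {h : Q d × Q d → ℂ} (hh : Tame M h) (s : ℝ) :
    HasDerivAt (fun s => osc d (M + 1) (fun x => h (zs d s x)))
      (osc d (M + 1) (fun x => Wf h (x.2, zs d s x))) s := by
  set Φ : ℝ × (Q d × Q d) → ℂ := fun z => h (z.2.1, z.1 • z.2.2) with hΦ
  have sΦ : Sm Φ := ContDiff.comp hh.1 (by unfold Sm; fun_prop :
    Sm (fun z : ℝ × (Q d × Q d) => (z.2.1, z.1 • z.2.2)))
  have dΦ : ∀ s x, dirD ((1 : ℝ), (0 : Q d × Q d)) Φ (s, x) = Wf h (x.2, zs d s x) := by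
    intro s x
    have h1 : HasFDerivAt (fun z : ℝ × (Q d × Q d) => (z.2.1, z.1 • z.2.2))
        (((ContinuousLinearMap.fst ℝ (Q d) (Q d)).comp (ContinuousLinearMap.snd ℝ ℝ (Q d × Q d))).prod
        (s • ((ContinuousLinearMap.snd ℝ (Q d) (Q d)).comp (ContinuousLinearMap.snd ℝ ℝ (Q d × Q d)))
          + (ContinuousLinearMap.fst ℝ ℝ (Q d × Q d)).smulRight x.2)) (s, x) := by
      refine HasFDerivAt.prodMk ?_ ?_
      · exact ((ContinuousLinearMap.fst ℝ (Q d) (Q d)).comp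
          (ContinuousLinearMap.snd ℝ ℝ (Q d × Q d))).hasFDerivAt
      · exact HasFDerivAt.smul (x := (s, x)) (ContinuousLinearMap.hasFDerivAt (ContinuousLinearMap.fst ℝ ℝ (Q d × Q d)))
          (ContinuousLinearMap.hasFDerivAt ((ContinuousLinearMap.snd ℝ (Q d) (Q d)).comp (ContinuousLinearMap.snd ℝ ℝ (Q d × Q d))))
    have h2 := HasFDerivAt.comp (s, x) (hh.1.diff (x.1, s • x.2)).hasFDerivAt h1
    have h3 : fderiv ℝ Φ (s, x) = _ := h2.fderiv
    simp only [dirD, h3]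
    simp only [ContinuousLinearMap.comp_apply, ContinuousLinearMap.prod_apply,
      _root_.add_apply, _root_.smul_apply,
      ContinuousLinearMap.smulRight_apply, ContinuousLinearMap.coe_snd', ContinuousLinearMap.coe_fst',
      Prod.fst_zero, Prod.snd_zero, smul_zero, zero_add, one_smul]
    simp only [Wf, dirD, zs_apply]
    have h4 : ((0 : Q d), x.2) = ∑ i, co d i x.2 • ((0 : Q d), ee d i) := by
      have : ((0 : Q d), x.2) = (0, ∑ i, co d i x.2 • ee d i) := by rw [← decomp]
      rw [this]
      refine Prod.ext ?_ ?_
      · rw [Prod.fst_sum]; simp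
      · rw [Prod.snd_sum]; rfl
    rw [h4, map_sum]
    refine Finset.sum_congr rfl fun i _ => ?_
    rw [map_smul]; simp
  set L := LM d (M + 1)
  obtain ⟨K, hK0, hK⟩ := bd_stps L 0
  obtain ⟨C, hC0, hC⟩ := bd_unif (d := d) (hh.mono (Nat.le_add_right M 1 : M ≤ M + 1)) L.length
  obtain ⟨C', hC0', hC'⟩ := bd_unif (d := d) (Wf_tame hh) L.length
  set η : ℝ → ℝ := fun s => (2 + |s|) ^ L.length * (2 + |s|) ^ (M + 1) with hη
  have b0 : ∀ s x, ‖stps (L.map (lft ℝ)) Φ (s, x)‖ ≤ (K * (C + C')) * (η s * (wt L x * pw (M + 1) x)) := by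
    intro s x
    rw [stps_lift _ sΦ]
    have := hC (zs d s) (2 + |s|) (by linarith [abs_nonneg s]) ((zs_norm s).trans (by linarith))
    have := (hK _ _ _ (ContDiff.comp hh.1 (zs d s).contDiff) (by rw [zero_add]; exact this)).val x
    refine this.trans ?_
    have hw := mul_nonneg (wt_nonneg L x) (pw_pos (M + 1) x).le
    have : 0 ≤ K * (C' * η s) := by positivity
    simp only [hη] at *
    nlinarith [mul_nonneg this hw]
  have b1 : ∀ s x, ‖inlc ℝ (Q d × Q d) ℂ (fderiv ℝ (stps (L.map (lft ℝ)) Φ) (s, x))‖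
      ≤ (K * (C + C')) * (η s * (wt L x * pw (M + 1) x)) := by
    intro s x
    have e0 : ∀ T : ℝ →L[ℝ] ℂ, ‖T‖ = ‖T 1‖ := fun T => by
      have : T = ContinuousLinearMap.toSpanSingleton ℝ (T 1) := by ext; simp
      conv_lhs => rw [this]
      rw [ContinuousLinearMap.norm_toSpanSingleton]
    rw [e0, inlc_apply]
    have e1 := congrFun (stps_dirD_lift L sΦ (1 : ℝ)) (s, x)
    rw [stps_lift _ (sΦ.dirD _)] at e1
    simp only [dΦ] at e1
    have e2 : fderiv ℝ (stps (L.map (lft ℝ)) Φ) (s, x) (1, 0) = _ := e1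
    rw [e2]
    set Ls := (ContinuousLinearMap.snd ℝ (Q d) (Q d)).prod (zs d s) with hLs
    have := hC' Ls (2 + |s|)
      (by linarith [abs_nonneg s]) (by
        refine ContinuousLinearMap.opNorm_le_bound _ (by positivity) fun x => ?_
        rw [hLs, ContinuousLinearMap.prod_apply, Prod.norm_def]
        refine max_le ((norm_snd_le x).trans ?_) (((zs d s).le_opNorm x).trans
          (mul_le_mul_of_nonneg_right ((zs_norm s).trans (by linarith)) (norm_nonneg x)))
        nlinarith [norm_nonneg x, abs_nonneg s])
    have := (hK _ _ _ (ContDiff.comp (Wf_tame hh).1 Ls.contDiff)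
      (by rw [zero_add]; exact this)).val x
    refine le_trans (le_of_eq (by rfl)) (this.trans ?_)
    have hw := mul_nonneg (wt_nonneg L x) (pw_pos (M + 1) x).le
    have : 0 ≤ K * (C * η s) := by positivity
    simp only [hη] at *
    nlinarith [mul_nonneg this hw]
  have hc : Continuous (ex (th d)) := (ex_sm th_sm).continuous
  have h2 := hfd (X := ℝ) (sΦ.stps (L.map (lft ℝ))) hc (fun x => (ex_norm _ _).le) (η := η)
    (by fun_prop) (LM_int (M + 1)) (fun x => mul_nonneg (wt_nonneg _ _) (pw_pos _ x).le)
    (by positivity) b0 b1 s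
  have h3 := hfd_dirD sΦ (ξ := s) b1 h2 1
  simp only [dΦ] at h3
  have e : (fun ξ => osc d (M + 1) (fun x => Φ (ξ, x)))
    = fun ξ => ∫ x, ex (th d) x • stps ((LM d (M + 1)).map (lft ℝ)) Φ (ξ, x) :=
      funext fun ξ => osc_eq sΦ ξ
  rw [← e] at h2
  have h4 := h2.hasDerivAt
  rw [← h3, h2.fderiv]
  exact h4

lemma osc_mono {M M' : ℕ} (hM : M ≤ M') {h : Q d × Q d → ℂ} (hh : Tame M h) :
    osc d M h = osc d M' h := hh.osc.uniq (hh.mono hM).osc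

lemma osc_zs_deriv' {M : ℕ} {h : Q d × Q d → ℂ} (hh : Tame M h) (s : ℝ) :
    HasDerivAt (fun s => osc d M (fun x => h (zs d s x)))
      (Complex.I * osc d M (fun x => Xop h (zs d s x))) s := by
  have h1 := osc_zs_deriv hh s
  have e1 : (fun s => osc d M (fun x => h (zs d s x))) = fun s => osc d (M + 1) (fun x => h (zs d s x)) :=
    funext fun s => osc_mono (Nat.le_succ M) (hh.compL (zs d s))
  rw [e1]
  refine h1.congr_deriv ?_
  have hT : Tame (M + 1) (fun x => Wf h (x.2, zs d s x)) :=
    (Wf_tame hh).compL ((ContinuousLinearMap.snd ℝ (Q d) (Q d)).prod (zs d s))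
  refine hT.osc.uniq ?_
  have key : ∀ i, HasOsc (th d) (fun x : Q d × Q d => ((co d i x.2 : ℝ) : ℂ) * dirD ((0 : Q d), ee d i) h (zs d s x))
      (Complex.I * osc d M (fun x => dirD (ee d i, (0 : Q d)) (dirD ((0 : Q d), ee d i) h) (zs d s x))) := by
    intro i
    have hi := hh.dirD ((0 : Q d), ee d i)
    have h3 := HasOsc.mul_lin (v := (ee d i, (0 : Q d))) th_sm (hi.compL (zs d s)).1
      (((hi.compL (zs d s)).dirD _).osc) (hi.compL (zs d s)).osc
    have e2 : dirD (ee d i, (0 : Q d)) (fun x => dirD ((0 : Q d), ee d i) h (zs d s x))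
        = fun x => dirD (ee d i, (0 : Q d)) (dirD ((0 : Q d), ee d i) h) (zs d s x) := by
      have := dirD_comp hi.1 (zs d s) 0 (ee d i, (0 : Q d))
      simpa [zs_apply] using this
    rw [e2] at h3
    have e3 : ∀ x : Q d × Q d, fderiv ℝ (th d) x (ee d i, (0 : Q d)) = co d i x.2 := by
      intro x; rw [th_fderiv, ee_qdot]; simp [qdot]
    simpa only [e3] using h3
  have h5 := HasOsc.sum th_sm Finset.univ (fun i =>
    ((tame_lin ((co d i).comp (ContinuousLinearMap.snd ℝ (Q d) (Q d)))).mul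
      ((hh.dirD ((0 : Q d), ee d i)).compL (zs d s))).1) (fun i _ => key i)
  have h6 : HasOsc (th d) (fun x => Xop h (zs d s x)) (∑ i, osc d M (fun x =>
      dirD (ee d i, (0 : Q d)) (dirD ((0 : Q d), ee d i) h) (zs d s x))) :=
    HasOsc.sum th_sm Finset.univ (fun i => (((hh.dirD _).dirD _).compL (zs d s)).1)
      (fun i _ => (((hh.dirD _).dirD _).compL (zs d s)).osc)
  rw [(hh.Xop.compL (zs d s)).osc.uniq h6, Finset.mul_sum]
  exact h5

lemma Tame.Xopn {M : ℕ} {h : Q d × Q d → ℂ} (hh : Tame M h) (j : ℕ) : Tame M (_root_.Xop^[j] h) := by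
  induction j with
  | zero => exact hh
  | succ j ih => rw [Function.iterate_succ_apply']; exact ih.Xop

/-- Taylor expansion of the oscillatory integral -/
lemma osc_taylor {M : ℕ} {h : Q d × Q d → ℂ} (hh : Tame M h) (n : ℕ) (K : ℝ)
    (hK : ∀ s ∈ Set.Icc (0 : ℝ) 1, ‖osc d M (fun x => Xop^[n] h (zs d s x))‖ ≤ K) (s : ℝ)
    (hs : s ∈ Set.Icc (0 : ℝ) 1) :
    ‖osc d M (fun x => h (zs d s x)) - kap d * ∑ j ∈ Finset.range n,
      (s : ℂ) ^ j * ((Complex.I ^ j / (j.factorial : ℂ)) * Xop^[j] h 0)‖ ≤ s ^ n * K := by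
  have := taylor_aux n (fun j s => osc d M (fun x => Xop^[j] h (zs d s x))) K
    (fun j s => by
      have := osc_zs_deriv' (hh.Xopn j) s
      rw [Function.iterate_succ_apply']; exact this) hK s hs
  have e : ∀ j, osc d M (fun x => Xop^[j] h (zs d 0 x)) = kap d * Xop^[j] h 0 := by
    intro j
    have h1 : Tame M (fun y : Q d => Xop^[j] h (y, 0)) :=
      (hh.Xopn j).compL (ContinuousLinearMap.inl ℝ (Q d) (Q d))
    have h2 := osc_fst h1
    refine HasOsc.uniq ((hh.Xopn j).compL (zs d 0)).osc ?_
    simpa [zs_apply, ← Prod.zero_eq_mk] using h2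
  simp only [e] at this
  rw [Finset.mul_sum]
  refine le_trans (le_of_eq ?_) this
  congr 2
  exact Finset.sum_congr rfl fun j _ => by ring

end Taylor


section Fub

open Topology Filter

variable {d : ℕ}

lemma Tame.stp {E : Type*} [NormedAddCommGroup E] [NormedSpace ℝ E] {M : ℕ} {Ψ : E → ℂ}
    (h : Tame M Ψ) (a : E × (E →L[ℝ] ℝ)) : Tame M (stp a Ψ) := by
  refine ⟨h.1.stp a, fun k => ?_⟩
  obtain ⟨K, hK0, hK⟩ := bd_stp k a
  obtain ⟨C, hC0, hC⟩ := h.2 (k + 1)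
  refine ⟨K * C, by positivity, (hK _ _ _ h.1 hC).mono' fun x => ?_⟩
  refine mul_le_mul_of_nonneg_left ?_ (by positivity)
  exact mul_le_of_le_one_left (pw_pos M x).le
    (inv_le_one_of_one_le₀ (by linarith [abs_nonneg (a.2 x)]))

/-- left lift of a step -/
def lfl {X : Type*} [NormedAddCommGroup X] [NormedSpace ℝ X] (E : Type*) [NormedAddCommGroup E]
    [NormedSpace ℝ E] (a : X × (X →L[ℝ] ℝ)) : (X × E) × ((X × E) →L[ℝ] ℝ) :=
  ((a.1, 0), a.2.comp (ContinuousLinearMap.fst ℝ X E))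

lemma osc_lfl {X : Type} [NormedAddCommGroup X] [NormedSpace ℝ X] {M : ℕ} {Φ : X × (Q d × Q d) → ℂ}
    (h : Tame M Φ) (L : List (X × (X →L[ℝ] ℝ))) :
    Tame M (stps (L.map (lfl (Q d × Q d))) Φ) ∧
    (fun ξ => osc d M (fun x => stps (L.map (lfl (Q d × Q d))) Φ (ξ, x)))
      = stps L (fun ξ => osc d M (fun x => Φ (ξ, x))) := by
  induction L with
  | nil => exact ⟨h, rfl⟩
  | cons a L ih =>
    obtain ⟨h1, h2⟩ := ih
    refine ⟨h1.stp _, ?_⟩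
    have e2 : ∀ Ψ, stps (a :: L) Ψ = stp a (stps L Ψ) := fun _ => rfl
    rw [e2, ← h2]
    funext ξ
    simp only [stp]
    rw [tame_dirD_osc h1]
    have s1 := h1.slice ξ
    have s2 := (h1.dirD (a.1, (0 : Q d × Q d))).slice ξ
    have s3 := ((h1.stp (lfl (Q d × Q d) a)).slice ξ).osc
    have s4 := (HasOsc.sub th_sm s1.1 s2.1 s1.osc s2.osc).const_mul
      ((1 + Complex.I * ((a.2 ξ : ℝ) : ℂ))⁻¹)
    exact s3.uniq s4

lemma th2_sm : Sm (fun z : (Q d × Q d) × (Q d × Q d) => th d z.1 + th d z.2) :=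
  ContDiff.add (ContDiff.comp th_sm contDiff_fst) (ContDiff.comp th_sm contDiff_snd)

lemma th2_fderiv (z v : (Q d × Q d) × (Q d × Q d)) :
    fderiv ℝ (fun z : (Q d × Q d) × (Q d × Q d) => th d z.1 + th d z.2) z v
      = fderiv ℝ (th d) z.1 v.1 + fderiv ℝ (th d) z.2 v.2 := by
  have h1 := (th_sm (d := d)).diff z.1 |>.hasFDerivAt.comp z
    (ContinuousLinearMap.hasFDerivAt (ContinuousLinearMap.fst ℝ (Q d × Q d) (Q d × Q d)))
  have h2 := (th_sm (d := d)).diff z.2 |>.hasFDerivAt.comp z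
    (ContinuousLinearMap.hasFDerivAt (ContinuousLinearMap.snd ℝ (Q d × Q d) (Q d × Q d)))
  have h3 := (h1.add h2).fderiv
  have h4 : (fun z : (Q d × Q d) × (Q d × Q d) => th d z.1 + th d z.2) =
    th d ∘ Prod.fst + th d ∘ Prod.snd := rfl
  rw [h4, h3]; rfl

lemma fub {M : ℕ} {Φ : (Q d × Q d) × (Q d × Q d) → ℂ} (h : Tame M Φ) :
    HasOsc (fun z : (Q d × Q d) × (Q d × Q d) => th d z.1 + th d z.2) Φ
      (osc d M (fun ξ => osc d M (fun x => Φ (ξ, x)))) := by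
  set L1 := (LM d M).map (lft (Q d × Q d)) with hL1
  set L2 := (LM d M).map (lfl (X := Q d × Q d) (Q d × Q d)) with hL2
  have hv : ∀ a ∈ L1 ++ L2, Vld (fun z : (Q d × Q d) × (Q d × Q d) => th d z.1 + th d z.2) a := by
    intro a ha
    rw [List.mem_append] at ha
    rcases ha with ha | ha <;> obtain ⟨b, hb, rfl⟩ := List.mem_map.1 ha <;>
      obtain ⟨v1, v2⟩ := vld_LM M b hb <;> refine ⟨fun x => ?_, by simpa [lft, lfl] using v2⟩ <;>
      rw [th2_fderiv] <;> simp [lft, lfl, v1]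
  obtain ⟨C, hC0, hC⟩ := h.2 (L1 ++ L2).length
  have hw : ∀ z, wt (L1 ++ L2) z = wt (LM d M) z.1 * wt (LM d M) z.2 := by
    intro z
    rw [wt_append, wt_lift, mul_comm]
    congr 1
    simp [wt, hL2, lfl, Function.comp_def]
  have hi0 := (LM_int (d := d) M).mul_prod (LM_int (d := d) M)
  have hi : Integrable (fun z : (Q d × Q d) × (Q d × Q d) =>
      wt (L1 ++ L2) z * (pw M z.1 * pw M z.2)) := by
    refine hi0.congr (Eventually.of_forall fun z => ?_)
    simp only [hw]; ring
  have hb : Bd (L1 ++ L2).length (fun z : (Q d × Q d) × (Q d × Q d) => pw M z.1 * pw M z.2) C Φ :=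
    hC.mono' fun x => mul_le_mul_of_nonneg_left (pw_prod M x) hC0
  have key := hasOsc_stps th2_sm (L1 ++ L2) hv h.1 hb hi
  obtain ⟨t1, t2⟩ := osc_lfl h (LM d M)
  have e0 : stps (L1 ++ L2) Φ = stps L1 (stps L2 Φ) := by simp [stps]
  convert key using 1
  obtain ⟨K, hK0, hK⟩ := bd_stps (L1 ++ L2) 0
  have hint : Integrable (fun z : (Q d × Q d) × (Q d × Q d) =>
      ex (fun z : (Q d × Q d) × (Q d × Q d) => th d z.1 + th d z.2) z * stps (L1 ++ L2) Φ z) := by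
    refine (hi.const_mul (K * C)).mono' ((ex_sm th2_sm).continuous.mul
      (h.1.stps _).continuous).aestronglyMeasurable (Eventually.of_forall fun z => ?_)
    rw [norm_mul, ex_norm, one_mul]
    exact (hK _ _ _ h.1 (by rw [zero_add]; exact hb)).val z
  rw [show (volume : Measure ((Q d × Q d) × (Q d × Q d))) = volume.prod volume from rfl,
    integral_prod _ hint]
  rw [osc, ← t2]
  refine integral_congr_ae (Eventually.of_forall fun ξ => ?_)
  simp only
  rw [osc, ← integral_const_mul]
  refine integral_congr_ae (Eventually.of_forall fun x => ?_)
  simp only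
  rw [← stps_lift _ t1.1, e0, ← mul_assoc]
  congr 1
  simp only [ex]
  rw [← Complex.exp_add]; push_cast; ring_nf

end Fub


section Iter

open Topology Filter

variable {d : ℕ}

/-- bounded support in the second variable -/
def BS {X E : Type*} [NormedAddCommGroup E] (R : ℝ) (Ψ : X × E → ℂ) : Prop :=
  ∀ x, R < ‖x.2‖ → Ψ x = 0

lemma BS.ev {X E : Type*} [NormedAddCommGroup E] [NormedAddCommGroup X] {R : ℝ} {Ψ : X × E → ℂ}
    (h : BS R Ψ) {x : X × E} (hx : R < ‖x.2‖) : Ψ =ᶠ[𝓝 x] fun _ => 0 := by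
  have : {x : X × E | R < ‖x.2‖} ∈ 𝓝 x :=
    (isOpen_lt continuous_const (continuous_norm.comp continuous_snd)).mem_nhds hx
  filter_upwards [this] with z hz using h z hz

lemma BS.stp {X E : Type*} [NormedAddCommGroup E] [NormedAddCommGroup X] [NormedSpace ℝ E]
    [NormedSpace ℝ X] {R : ℝ} {Ψ : X × E → ℂ}
    (h : BS R Ψ) (a) : BS R (stp a Ψ) := by
  intro x hx
  simp [_root_.stp, dirD, h x hx, (h.ev hx).fderiv_eq]

lemma BS.cs {X : Type*} {R : ℝ} {Ψ : X × Q d → ℂ} (h : BS R Ψ) (y : X) :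
    HasCompactSupport (fun z => Ψ (y, z)) := by
  refine HasCompactSupport.intro (isCompact_closedBall (0 : Q d) R) fun z hz => h _ ?_
  simpa using hz

lemma slice_ibp {R : ℝ} {Ψ : Q d × Q d → ℂ} (hs : Sm Ψ) (h : BS R Ψ) (i : Option (Fin d)) (y : Q d) :
    ∫ z, ex (th d) (y, z) * stp (sz d i) Ψ (y, z) = ∫ z, ex (th d) (y, z) * Ψ (y, z) := by
  have hΘ : Sm (fun z => th d (y, z)) := th_sm.slice y
  have hφ := hs.slice y
  have hc := h.cs y
  have h1 := ibp hΘ (ee d i) hφ hc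
  have h2 : ∀ z, fderiv ℝ (fun z => th d (y, z)) z (ee d i) = co d i y := by
    intro z
    have : fderiv ℝ (fun z => th d (y, z)) z = (fderiv ℝ (th d) (y, z)).comp
        (ContinuousLinearMap.inr ℝ (Q d) (Q d)) :=
      (HasFDerivAt.comp z (th_sm.diff (y, z)).hasFDerivAt (hasFDerivAt_prodMk_right y z)).fderiv
    rw [this, ContinuousLinearMap.comp_apply, th_fderiv]
    have e0 : qdot (0 : Q d) z = 0 := by simp [qdot]
    simp [qdot_ee, e0]
  simp only [h2] at h1
  set c : ℂ := 1 + Complex.I * ((co d i y : ℝ) : ℂ) with hcdef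
  have hc0 : c ≠ 0 := onepi_ne _
  have e1 : ∀ z, ex (th d) (y, z) * stp (sz d i) Ψ (y, z)
      = c⁻¹ * (ex (fun z => th d (y, z)) z * Ψ (y, z) - ex (fun z => th d (y, z)) z * dirD (ee d i) (fun z => Ψ (y, z)) z) := by
    intro z
    simp only [stp, sz]
    rw [dirD_slice hs]
    simp only [ContinuousLinearMap.comp_apply, ContinuousLinearMap.coe_fst', hcdef, ex]
    ring
  simp only [e1]
  have i1 : Integrable (fun z => ex (fun z => th d (y, z)) z * Ψ (y, z)) :=
    int_cs ((ex_sm hΘ).continuous.mul hφ.continuous) hc.mul_left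
  have i2 : Integrable (fun z => ex (fun z => th d (y, z)) z * dirD (ee d i) (fun z => Ψ (y, z)) z) :=
    int_cs ((ex_sm hΘ).continuous.mul (hφ.dirD _).continuous) (cs_dirD hc _).mul_left
  rw [integral_const_mul, integral_sub i1 i2, h1, sub_neg_eq_add]
  have e2 : ∀ z, Complex.I * ((co d i y : ℝ) : ℂ) * ex (fun z => th d (y, z)) z * Ψ (y, z)
    = (Complex.I * ((co d i y : ℝ) : ℂ)) * (ex (fun z => th d (y, z)) z * Ψ (y, z)) := fun z => by ring
  simp only [e2]
  rw [integral_const_mul, ← one_add_mul, ← hcdef, ← mul_assoc, inv_mul_cancel₀ hc0, one_mul]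
  rfl

lemma slice_ibps (L : List (Option (Fin d))) {R : ℝ} {Ψ : Q d × Q d → ℂ} (hs : Sm Ψ) (h : BS R Ψ)
    (y : Q d) : BS R (stps (L.map (sz d)) Ψ) ∧
    ∫ z, ex (th d) (y, z) * stps (L.map (sz d)) Ψ (y, z) = ∫ z, ex (th d) (y, z) * Ψ (y, z) := by
  induction L with
  | nil => exact ⟨h, rfl⟩
  | cons a L ih =>
    refine ⟨ih.1.stp (sz d a), ?_⟩
    rw [← ih.2, ← slice_ibp (hs.stps _) ih.1 a y]; rfl

lemma osc_iter {M : ℕ} {R : ℝ} {Ψ : Q d × Q d → ℂ} (h : Tame M Ψ) (hR : BS R Ψ) :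
    HasOsc (th d) Ψ (∫ y, ∫ z, ex (th d) (y, z) * Ψ (y, z)) := by
  set n := M + (d + 1 + 1) with hn
  set L := rep n (bz d) with hL
  obtain ⟨C, hC0, hC⟩ := h.2 L.length
  set ω : Q d × Q d → ℝ := fun x => pw M x.1 * (Metric.closedBall (0 : Q d) R).indicator (fun _ => 1) x.2
    with hω
  have hω0 : ∀ x, 0 ≤ ω x := fun x =>
    mul_nonneg (pw_pos _ _).le (Set.indicator_nonneg (fun _ _ => zero_le_one) _)
  have hb : Bd L.length ω (C * (1 + |R|) ^ M) Ψ := by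
    intro j hj x
    by_cases hx : R < ‖x.2‖
    · have : iteratedFDeriv ℝ j Ψ x = 0 := by
        rw [((hR.ev hx).iteratedFDeriv ℝ j).eq_of_nhds]
        have : iteratedFDeriv ℝ j (fun _ : Q d × Q d => (0 : ℂ)) = 0 := iteratedFDeriv_fun_zero
        rw [this]; rfl
      rw [this, norm_zero]; have := hω0 x; positivity
    · refine (hC j hj x).trans ?_
      have h1 : (Metric.closedBall (0 : Q d) R).indicator (fun _ => (1 : ℝ)) x.2 = 1 :=
        Set.indicator_of_mem (by simpa using hx) _
      have h2 : pw M x.2 ≤ (1 + |R|) ^ M :=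
        pow_le_pow_left₀ (by positivity) (by linarith [le_abs_self R, not_lt.1 hx]) M
      simp only [hω, h1, mul_one]
      have h3 := pw_prod M x
      have h4 := mul_le_mul_of_nonneg_left h2 (pw_pos M x.1).le
      calc C * pw M x ≤ C * (pw M x.1 * (1 + |R|) ^ M) := mul_le_mul_of_nonneg_left (h3.trans h4) hC0
        _ = _ := by ring
  have hball : Integrable ((Metric.closedBall (0 : Q d) R).indicator (fun _ => (1 : ℝ))) :=
    (integrable_indicator_iff Metric.isClosed_closedBall.measurableSet).2
      ((continuous_const.locallyIntegrable).integrableOn_isCompact (isCompact_closedBall _ _))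
  have hiw : Integrable (iw (d + 1 + 1) : Q d → ℝ) := iw_int _ (by simp; omega)
  have hi : Integrable (fun x => wt L x * ω x) := by
    refine (hiw.mul_prod hball).mono' ?_ (Eventually.of_forall fun x => ?_)
    · refine (wt_cont L).aestronglyMeasurable.mul (((pw_cont M).comp continuous_fst).aestronglyMeasurable.mul ?_)
      exact ((measurable_const.indicator Metric.isClosed_closedBall.measurableSet).comp measurable_snd).aestronglyMeasurable
    · rw [Real.norm_of_nonneg (mul_nonneg (wt_nonneg _ _) (hω0 x))]
      simp only [hω]
      rw [← mul_assoc]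
      refine mul_le_mul_of_nonneg_right ?_ (Set.indicator_nonneg (fun _ _ => zero_le_one) _)
      rw [hL, wt_rep]
      have h1 := pow_le_pow_left₀ (wt_nonneg (bz d) x) (wt_bz x) n
      refine (mul_le_mul_of_nonneg_right h1 (pw_pos M x.1).le).trans (le_of_eq ?_)
      have : (1 + ‖x.1‖) ≠ 0 := by positivity
      rw [hn, pow_add, pw, iw, mul_right_comm, ← mul_pow, inv_mul_cancel₀ this, one_pow, one_mul]
  have key := hasOsc_stps th_sm L (fun a ha => vld_bz a (mem_rep ha)) h.1 hb hi
  convert key using 1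
  obtain ⟨K, hK0, hK⟩ := bd_stps L 0
  have hint : Integrable (fun x => ex (th d) x * stps L Ψ x) := by
    refine (hi.const_mul (K * (C * (1 + |R|) ^ M))).mono' ((ex_sm th_sm).continuous.mul
      (h.1.stps _).continuous).aestronglyMeasurable (Eventually.of_forall fun z => ?_)
    rw [norm_mul, ex_norm, one_mul]
    exact (hK _ _ _ h.1 (by rw [zero_add]; exact hb)).val z
  rw [show (volume : Measure (Q d × Q d)) = volume.prod volume from rfl, integral_prod _ hint]
  refine integral_congr_ae (Eventually.of_forall fun y => ?_)
  have e : L = (rep n (Finset.univ.toList : List (Option (Fin d)))).map (sz d) := by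
    simp [hL, rep, bz, List.map_flatten]
  simp only
  rw [e]
  exact (slice_ibps _ h.1 hR y).2.symm

end Iter


section Loc

open Topology Filter

variable {d : ℕ}

/-- locally tame amplitudes -/
def LTm (M : ℕ) (g : Q d × Q d × Q d → ℂ) : Prop :=
  Sm g ∧ ∀ ζ : Q d → ℂ, Sm ζ → HasCompactSupport ζ → Tame M (fun x => ζ x.1 * g x)

lemma LTm.dirD {M : ℕ} {g : Q d × Q d × Q d → ℂ} (h : LTm M g) (v : Q d × Q d × Q d) :
    LTm M (dirD v g) := by
  refine ⟨h.1.dirD v, fun ζ hζ hc => ?_⟩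
  have s1 : Sm (fun x : Q d × Q d × Q d => ζ x.1) := ContDiff.comp hζ contDiff_fst
  have e1 := dirD_mul s1 h.1 v
  have e2 := dirD_comp hζ (ContinuousLinearMap.fst ℝ (Q d) (Q d × Q d)) 0 v
  simp only [add_zero, ContinuousLinearMap.coe_fst'] at e2
  have t1 := (h.2 ζ hζ hc).dirD v
  have t2 := ((tame_const (-1)).mul (h.2 _ (hζ.dirD v.1) (cs_dirD hc v.1)))
  rw [zero_add] at t2
  have := t1.add t2
  rw [e1, e2] at this
  convert this using 2 with x
  ring

lemma LTm.sum {M : ℕ} {ι : Type*} (s : Finset ι) {g : ι → Q d × Q d × Q d → ℂ} (h : ∀ i, LTm M (g i)) :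
    LTm M (fun x => ∑ i ∈ s, g i x) := by
  refine ⟨ContDiff.sum fun i _ => (h i).1, fun ζ hζ hc => ?_⟩
  simp only [Finset.mul_sum]
  exact Tame.sum s fun i => (h i).2 ζ hζ hc

lemma zeta_ex (w : Q d) (R : ℝ) : ∃ ζ : Q d → ℂ, Sm ζ ∧ HasCompactSupport ζ ∧
    ∀ x ∈ Metric.ball w R, ζ x = 1 := cut_ex w R

/-- slices are tame -/
lemma LTm.slice {M : ℕ} {g : Q d × Q d × Q d → ℂ} (h : LTm M g) (w p : Q d) :
    Tame M (fun x : Q d × Q d => g (w, p + x.1, x.2)) := by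
  obtain ⟨ζ, z1, z2, z3⟩ := zeta_ex w 1
  have := (h.2 ζ z1 z2).comp (ContinuousLinearMap.inr ℝ (Q d) (Q d × Q d)) (w, p, 0)
  convert this using 2 with x
  have e : ContinuousLinearMap.inr ℝ (Q d) (Q d × Q d) x + (w, p, 0) = (w, p + x.1, x.2) := by
    ext <;> simp [add_comm]
  rw [e]; simp [z3 w (by simp)]

/-- the symbol -/
def Bop (d M : ℕ) (s : ℝ) (g : Q d × Q d × Q d → ℂ) (ξ : Q d × Q d) : ℂ :=
  (kap d)⁻¹ * osc d M (fun x => g (ξ.1, ξ.2 + x.1, s • x.2))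

/-- the affine map used for `Bop` -/
def bL (d : ℕ) (s : ℝ) : ((Q d × Q d) × (Q d × Q d)) →L[ℝ] (Q d × Q d × Q d) :=
  ((ContinuousLinearMap.fst ℝ (Q d) (Q d)).comp (ContinuousLinearMap.fst ℝ _ _)).prod
    (((ContinuousLinearMap.snd ℝ (Q d) (Q d)).comp (ContinuousLinearMap.fst ℝ _ _) +
      (ContinuousLinearMap.fst ℝ (Q d) (Q d)).comp (ContinuousLinearMap.snd ℝ _ _)).prod
      (s • (ContinuousLinearMap.snd ℝ (Q d) (Q d)).comp (ContinuousLinearMap.snd ℝ _ _)))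

lemma bL_apply (s : ℝ) (z : (Q d × Q d) × (Q d × Q d)) :
    bL d s z = (z.1.1, z.1.2 + z.2.1, s • z.2.2) := rfl

lemma Bop_loc {M : ℕ} {s : ℝ} {g : Q d × Q d × Q d → ℂ} (h : LTm M g) (ξ : Q d × Q d) :
    ∃ F : Q d × Q d → ℂ, Sm F ∧ Bop d M s g =ᶠ[𝓝 ξ] F ∧
      ∀ u : Q d × Q d, _root_.dirD u F ξ = Bop d M s (_root_.dirD (u.1, u.2, (0 : Q d)) g) ξ := by
  obtain ⟨ζ, z1, z2, z3⟩ := zeta_ex ξ.1 1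
  have t0 := h.2 ζ z1 z2
  have t1 := t0.compL (bL d s)
  simp only [bL_apply] at t1
  set Φ : (Q d × Q d) × (Q d × Q d) → ℂ := fun z => ζ z.1.1 * g (z.1.1, z.1.2 + z.2.1, s • z.2.2) with hΦ
  have t2 := tame_osc_param t1
  refine ⟨fun η => (kap d)⁻¹ * osc d M (fun x => Φ (η, x)), contDiff_const.mul t2.1, ?_, fun u => ?_⟩
  · have : {η : Q d × Q d | η.1 ∈ Metric.ball ξ.1 1} ∈ 𝓝 ξ :=
      (Metric.isOpen_ball.preimage continuous_fst).mem_nhds (by simp)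
    filter_upwards [this] with η hη
    simp only [Bop, hΦ, z3 η.1 hη, one_mul]
  · have e1 := tame_dirD_osc t1 u ξ
    rw [dirD_const_mul t2.1]
    simp only
    rw [e1, Bop]
    congr 2
    funext x
    have e2 := congrFun (dirD_comp t0.1 (bL d s) 0 (u, (0 : Q d × Q d))) (ξ, x)
    simp only [add_zero, bL_apply, Prod.fst_zero, Prod.snd_zero, smul_zero] at e2
    refine e2.trans ?_
    have : (fun x : Q d × Q d × Q d => ζ x.1 * g x) =ᶠ[𝓝 (ξ.1, ξ.2 + x.1, s • x.2)] g := by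
      have : {η : Q d × Q d × Q d | η.1 ∈ Metric.ball ξ.1 1} ∈ 𝓝 (ξ.1, ξ.2 + x.1, s • x.2) :=
        (Metric.isOpen_ball.preimage continuous_fst).mem_nhds (by simp)
      filter_upwards [this] with η hη
      rw [z3 η.1 hη, one_mul]
    simp only [_root_.dirD, this.fderiv_eq]

lemma Bop_sm {M : ℕ} {s : ℝ} {g : Q d × Q d × Q d → ℂ} (h : LTm M g) : Sm (Bop d M s g) := by
  refine contDiff_iff_contDiffAt.2 fun ξ => ?_
  obtain ⟨F, h1, h2, _⟩ := Bop_loc (s := s) h ξ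
  exact (h1.contDiffAt).congr_of_eventuallyEq h2

lemma Bop_dirD {M : ℕ} {s : ℝ} {g : Q d × Q d × Q d → ℂ} (h : LTm M g) (u : Q d × Q d) :
    dirD u (Bop d M s g) = Bop d M s (dirD (u.1, u.2, (0 : Q d)) g) := by
  funext ξ
  obtain ⟨F, h1, h2, h3⟩ := Bop_loc (s := s) h ξ
  rw [← h3 u]
  simp only [dirD, h2.fderiv_eq]

lemma LTm.slice' {M : ℕ} {g : Q d × Q d × Q d → ℂ} (h : LTm M g) (w p : Q d) (s : ℝ) :
    Tame M (fun x : Q d × Q d => g (w, p + x.1, s • x.2)) :=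
  (h.slice w p).compL (zs d s)

/-- change of variables -/
def gE (d : ℕ) : ((Q d × Q d) × (Q d × Q d)) ≃L[ℝ] ((Q d × Q d) × (Q d × Q d)) :=
  LinearEquiv.toContinuousLinearEquiv
  { toFun := fun x => ((x.1.1, x.1.2 + x.2.2), (x.2.1 - x.1.1, x.2.2))
    invFun := fun x => ((x.1.1, x.1.2 - x.2.2), (x.2.1 + x.1.1, x.2.2))
    map_add' := fun x y => by ext <;> simp <;> ring
    map_smul' := fun c x => by ext <;> simp <;> ring
    left_inv := fun x => by simp
    right_inv := fun x => by simp }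

lemma gE_apply (x : (Q d × Q d) × (Q d × Q d)) :
    gE d x = ((x.1.1, x.1.2 + x.2.2), (x.2.1 - x.1.1, x.2.2)) := rfl

def sE (d : ℕ) : ((Q d × Q d) × (Q d × Q d)) ≃L[ℝ] ((Q d × Q d) × (Q d × Q d)) :=
  LinearEquiv.toContinuousLinearEquiv
  { toFun := fun x => (x.1, -x.2)
    invFun := fun x => (x.1, -x.2)
    map_add' := fun x y => by ext <;> simp <;> ring
    map_smul' := fun c x => by ext <;> simp
    left_inv := fun x => by simp
    right_inv := fun x => by simp }

lemma sE_apply (x : (Q d × Q d) × (Q d × Q d)) : sE d x = (x.1, -x.2) := rfl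

lemma gE_mp : MeasurePreserving (gE d) :=
  mp_of_conj (gE d) (sE d) (fun x => by simp [sE_apply]) (fun x => by
    rw [gE_apply, sE_apply, gE_apply, sE_apply]; ext <;> simp)

lemma qdot_add_right (x y z : Q d) : qdot x (y + z) = qdot x y + qdot x z := by
  simp [qdot_co, mul_add, Finset.sum_add_distrib]

lemma qdot_sub_left (x y z : Q d) : qdot (x - y) z = qdot x z - qdot y z := by
  simp [qdot_co, sub_mul, Finset.sum_sub_distrib]

lemma gE_th (x : (Q d × Q d) × (Q d × Q d)) :
    th d (gE d x).1 + th d (gE d x).2 = th d x.1 + th d x.2 := by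
  rw [gE_apply]; simp only [th, qdot_add_right, qdot_sub_left]; ring

/-- the big function -/
def PhiA (A : Q d × Q d × Q d → ℂ) (s σ : ℝ) (q : Q d) (U : Q d → ℂ)
    (z : (Q d × Q d) × (Q d × Q d)) : ℂ :=
  A (q + σ • z.1.2, z.1.1 + z.2.1, s • z.2.2) * U z.1.2

def pL (d : ℕ) (s σ : ℝ) : ((Q d × Q d) × (Q d × Q d)) →L[ℝ] (Q d × Q d × Q d) :=
  (σ • (ContinuousLinearMap.snd ℝ (Q d) (Q d)).comp (ContinuousLinearMap.fst ℝ _ _)).prod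
    (((ContinuousLinearMap.fst ℝ (Q d) (Q d)).comp (ContinuousLinearMap.fst ℝ _ _) +
      (ContinuousLinearMap.fst ℝ (Q d) (Q d)).comp (ContinuousLinearMap.snd ℝ _ _)).prod
      (s • (ContinuousLinearMap.snd ℝ (Q d) (Q d)).comp (ContinuousLinearMap.snd ℝ _ _)))

lemma pL_apply (s σ : ℝ) (q : Q d) (z : (Q d × Q d) × (Q d × Q d)) :
    pL d s σ z + (q, 0, 0) = (q + σ • z.1.2, z.1.1 + z.2.1, s • z.2.2) := by
  have : pL d s σ z = (σ • z.1.2, z.1.1 + z.2.1, s • z.2.2) := rfl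
  rw [this]; ext <;> simp [add_comm]

lemma PhiA_tame {M : ℕ} {A : Q d × Q d × Q d → ℂ} (h : LTm M A) (s σ : ℝ) (q : Q d) {U : Q d → ℂ}
    (hU : Sm U) (hc : HasCompactSupport U) : Tame M (PhiA A s σ q U) := by
  obtain ⟨R, hR⟩ := hc.isBounded.subset_ball (0 : Q d)
  obtain ⟨ζ, z1, z2, z3⟩ := zeta_ex q (|σ| * |R| + 1)
  have hζ : ∀ z, ζ (q + σ • z) * U z = U z := by
    intro z
    by_cases hz : z ∈ tsupport U
    · have h1 := hR hz
      rw [z3, one_mul]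
      rw [mem_ball_zero_iff] at h1
      rw [Metric.mem_ball, dist_eq_norm, add_sub_cancel_left, norm_smul, Real.norm_eq_abs]
      have := mul_le_mul_of_nonneg_left (h1.le.trans (le_abs_self R)) (abs_nonneg σ)
      linarith
    · rw [image_eq_zero_of_notMem_tsupport hz, mul_zero]
  have tΦ0 := ((h.2 ζ z1 z2).comp (pL d s σ) (q, 0, 0)).mul
    ((tame_cs hU hc).compL ((ContinuousLinearMap.snd ℝ (Q d) (Q d)).comp
      (ContinuousLinearMap.fst ℝ (Q d × Q d) (Q d × Q d))))
  rw [add_zero] at tΦ0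
  have e : PhiA A s σ q U = fun x => ζ (pL d s σ x + (q, 0, 0)).1 * A (pL d s σ x + (q, 0, 0)) *
      U (((ContinuousLinearMap.snd ℝ (Q d) (Q d)).comp
        (ContinuousLinearMap.fst ℝ (Q d × Q d) (Q d × Q d))) x) := by
    funext z
    rw [pL_apply, PhiA]
    show A _ * U z.1.2 = ζ (q + σ • z.1.2) * A _ * U z.1.2
    rw [mul_right_comm, hζ, mul_comm]
  rw [e]; exact tΦ0

lemma PhiA_inner {M : ℕ} {A : Q d × Q d × Q d → ℂ} (h : LTm M A) (s σ : ℝ) (q : Q d) {U : Q d → ℂ}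
    (hU : Sm U) (hc : HasCompactSupport U) (ξ : Q d × Q d) :
    osc d M (fun x => PhiA A s σ q U (ξ, x)) = kap d * (Bop d M s A (q + σ • ξ.2, ξ.1) * U ξ.2) := by
  have h1 := (h.slice' (q + σ • ξ.2) ξ.1 s).osc.const_mul (U ξ.2)
  have e : (fun x : Q d × Q d => PhiA A s σ q U (ξ, x))
      = fun x => U ξ.2 * A (q + σ • ξ.2, ξ.1 + x.1, s • x.2) := by
    funext x; rw [PhiA, mul_comm]
  rw [← e] at h1
  rw [((PhiA_tame h s σ q hU hc).slice ξ).osc.uniq h1, Bop]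
  have hk := kap_ne (d := d)
  rw [← mul_assoc, ← mul_assoc, mul_inv_cancel₀ hk, one_mul, mul_comm]

end Loc

section Cmp
variable {d : ℕ}

lemma fub_gE {M : ℕ} {Φ : (Q d × Q d) × (Q d × Q d) → ℂ} (h : Tame M Φ) :
    osc d M (fun ξ => osc d M (fun x => Φ (ξ,x)))
      = osc d M (fun ξ => osc d M (fun x => Φ (gE d (ξ,x)))) := by
  have h' : Tame M (fun x => Φ (gE d x)) := h.compL ((gE d).toContinuousLinearMap)
  have h1 := fub h
  have h2 := fub h'
  have h3 := HasOsc.comp h1 (gE d) gE_mp (fun x => by exact gE_th x)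
  exact HasOsc.uniq h3 h2

lemma tame_gE {M : ℕ} {Φ : (Q d × Q d) × (Q d × Q d) → ℂ} (h : Tame M Φ) :
    Tame M (fun x => Φ (gE d x)) := h.compL ((gE d).toContinuousLinearMap)

/-- shifted function -/
def Psh (A : Q d × Q d × Q d → ℂ) (s σ : ℝ) (q : Q d) (U : Q d → ℂ) (ζ : Q d) (x : Q d × Q d) : ℂ :=
  A (q + σ • (ζ + x.2), x.1, s • x.2) * U (ζ + x.2)

lemma PhiA_gE (A : Q d × Q d × Q d → ℂ) (s σ : ℝ) (q : Q d) (U : Q d → ℂ) (ξ x : Q d × Q d) :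
    PhiA A s σ q U (gE d (ξ, x)) = Psh A s σ q U ξ.2 x := by
  rw [gE_apply, PhiA, Psh]
  simp only [add_sub_cancel]

/-- the comparison of the two oscillatory integrals -/
lemma osc_compare {M : ℕ} {A : Q d × Q d × Q d → ℂ} (h : LTm M A) (s σ : ℝ) (q : Q d) {U : Q d → ℂ}
    (hU : Sm U) (hc : HasCompactSupport U) :
    Tame M (Psh A s σ q U 0) ∧
    Tame M (fun x : Q d × Q d => Bop d M s A (q + σ • x.2, x.1) * U x.2) ∧
    osc d M (Psh A s σ q U 0) =
      osc d M (fun x : Q d × Q d => Bop d M s A (q + σ • x.2, x.1) * U x.2) := by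
  have tΦ := PhiA_tame h s σ q hU hc
  have inner := PhiA_inner h s σ q hU hc
  have inner' : (fun ξ : Q d × Q d => osc d M (fun x => PhiA A s σ q U (ξ, x)))
    = fun ξ => kap d * (Bop d M s A (q + σ • ξ.2, ξ.1) * U ξ.2) := funext inner
  have hk := kap_ne (d := d)
  have tO := tame_osc_param tΦ
  rw [inner'] at tO
  have t2 : Tame M (fun x : Q d × Q d => Bop d M s A (q + σ • x.2, x.1) * U x.2) := by
    have := (tame_const (E := Q d × Q d) (kap d)⁻¹).mul tO
    rw [zero_add] at this
    simp only [← mul_assoc, inv_mul_cancel₀ hk, one_mul] at this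
    exact this
  have tΦ' := tame_gE tΦ
  have f3 := fub_gE tΦ
  rw [inner'] at f3
  obtain ⟨H, hH⟩ : ∃ H : Q d → ℂ, H = fun ζ' => osc d M (Psh A s σ q U ζ') := ⟨_, rfl⟩
  have e3 : (fun ξ : Q d × Q d => osc d M (fun x : Q d × Q d => PhiA A s σ q U (gE d (ξ, x))))
      = fun ξ => H ξ.2 := by
    funext ξ; rw [hH]; congr 1; funext x; exact PhiA_gE A s σ q U ξ x
  have tG := tame_osc_param tΦ'
  rw [e3] at f3 tG
  have tH : Tame M H := tG.compL (ContinuousLinearMap.inr ℝ (Q d) (Q d))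
  have t1 : Tame M (Psh A s σ q U 0) := by
    have := tΦ'.slice ((0 : Q d), (0 : Q d))
    have e : (fun x : Q d × Q d => PhiA A s σ q U (gE d (((0 : Q d), (0 : Q d)), x)))
      = Psh A s σ q U 0 := funext fun x => PhiA_gE A s σ q U _ x
    rw [e] at this; exact this
  refine ⟨t1, t2, ?_⟩
  have f4 := tG.osc.uniq (osc_snd tH)
  have f5 := tO.osc.uniq (t2.osc.const_mul (kap d))
  rw [f5, f4] at f3
  have f6 := mul_left_cancel₀ hk f3
  rw [f6, hH]
end Cmp


section OpEq
variable {d : ℕ}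

/-- the amplitude in the symmetric variables -/
def tA (t : ℝ) (a : Q d × Q d × Q d → ℂ) : Q d × Q d × Q d → ℂ :=
  fun y => a (y.1 + (1 - t) • y.2.2, y.2.1, y.1 - t • y.2.2)

lemma int_subst (q : Q d) (ℏ : ℝ) (hℏ : 0 < ℏ) (F : Q d → Q d → ℂ) :
    ∫ p, ∫ q', F p q' = (ℏ ^ (Module.finrank ℝ (Q d)) : ℝ) • ∫ p, ∫ z, F p (q - ℏ • z) := by
  rw [← integral_smul]
  congr 1; funext p
  have h1 := Measure.integral_comp_smul (volume : Measure (Q d)) (fun x => F p (q - x)) ℏ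
  rw [h1, integral_sub_left_eq_self (F p) volume q, smul_smul, abs_of_pos (by positivity),
    mul_inv_cancel₀ (by positivity), one_smul]

lemma ephase_ex (ℏ : ℝ) (hℏ : 0 < ℏ) (p q z : Q d) :
    ephase ℏ p (q - (q - ℏ • z)) = ex (th d) (p, z) := by
  have h : qdot p (q - (q - ℏ • z)) = ℏ * qdot p z := by
    rw [sub_sub_cancel]
    simp only [qdot_co, Finset.mul_sum]
    refine Finset.sum_congr rfl fun i _ => ?_
    rw [map_smul, smul_eq_mul]; ring
  have h' : (ℏ : ℂ) ≠ 0 := by exact_mod_cast hℏ.ne'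
  rw [ephase, ex, h, th]
  congr 1
  push_cast
  field_simp

lemma op_eq {M : ℕ} {t : ℝ} {a : Q d × Q d × Q d → ℂ} (h : LTm M (tA t a)) {ℏ : ℝ} (hℏ : 0 < ℏ)
    {u : Q d → ℂ} (hu : IsCc u) (q : Q d) :
    OpAmp ℏ a u q = Op ℏ t (Bop d M ℏ (tA t a)) u q := by
  obtain ⟨hu1, hu2⟩ := hu
  obtain ⟨U, hU⟩ : ∃ U : Q d → ℂ, U = fun z => u (q - ℏ • z) := ⟨_, rfl⟩
  have sU : Sm U := by
    rw [hU]; exact ContDiff.comp hu1 (contDiff_const.sub (contDiff_id.const_smul ℏ))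
  have cU : ∃ R : ℝ, ∀ z, R < ‖z‖ → U z = 0 := by
    obtain ⟨R, hR⟩ := hu2.isBounded.subset_closedBall (0 : Q d)
    refine ⟨(R + ‖q‖) / ℏ, fun z hz => ?_⟩
    rw [hU]
    refine image_eq_zero_of_notMem_tsupport fun hm => ?_
    have h1 := hR hm
    rw [mem_closedBall_zero_iff] at h1
    rw [div_lt_iff₀ hℏ] at hz
    have h2 : ‖ℏ • z‖ ≤ ‖q - ℏ • z‖ + ‖q‖ := by
      have := norm_sub_le q (q - ℏ • z)
      rw [sub_sub_cancel] at this; linarith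
    rw [norm_smul, Real.norm_eq_abs, abs_of_pos hℏ] at h2
    linarith [mul_comm ‖z‖ ℏ]
  obtain ⟨R, hR⟩ := cU
  have cU' : HasCompactSupport U := HasCompactSupport.intro (isCompact_closedBall (0 : Q d) R)
    (fun x hx => hR x (by simpa using hx))
  obtain ⟨t1, t2, e⟩ := osc_compare h ℏ (-((1 - t) * ℏ)) q sU cU'
  have b1 : BS R (Psh (tA t a) ℏ (-((1 - t) * ℏ)) q U 0) := by
    intro x hx; rw [Psh, zero_add, hR _ hx, mul_zero]
  have b2 : BS R (fun x : Q d × Q d => Bop d M ℏ (tA t a) (q + (-((1 - t) * ℏ)) • x.2, x.1) * U x.2) := by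
    intro x hx; simp only [hR _ hx, mul_zero]
  rw [t1.osc.uniq (osc_iter t1 b1), t2.osc.uniq (osc_iter t2 b2)] at e
  rw [OpAmp, Op, int_subst q ℏ hℏ (fun p q' => a (q, p, q') * ephase ℏ p (q - q') * u q'),
    int_subst q ℏ hℏ (fun p q' => Bop d M ℏ (tA t a) (t • q + (1 - t) • q', p) * ephase ℏ p (q - q') * u q')]
  congr 2
  have e1 : ∀ p z, a (q, p, q - ℏ • z) * ephase ℏ p (q - (q - ℏ • z)) * u (q - ℏ • z) =
      ex (th d) (p, z) * Psh (tA t a) ℏ (-((1 - t) * ℏ)) q U 0 (p, z) := by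
    intro p z
    rw [ephase_ex ℏ hℏ, Psh, zero_add, hU, tA]
    have x1 : q + (-((1 - t) * ℏ)) • z + (1 - t) • ℏ • z = q := by
      rw [smul_smul, add_assoc, ← add_smul]; simp
    have x2 : q + (-((1 - t) * ℏ)) • z - t • ℏ • z = q - ℏ • z := by module
    simp only [x1, x2]; ring
  have e2 : ∀ p z, Bop d M ℏ (tA t a) (t • q + (1 - t) • (q - ℏ • z), p) *
      ephase ℏ p (q - (q - ℏ • z)) * u (q - ℏ • z) =
      ex (th d) (p, z) * (Bop d M ℏ (tA t a) (q + (-((1 - t) * ℏ)) • z, p) * U z) := by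
    intro p z
    rw [ephase_ex ℏ hℏ, hU]
    have x1 : t • q + (1 - t) • (q - ℏ • z) = q + (-((1 - t) * ℏ)) • z := by module
    rw [x1]; ring
  simp only [e1, e2]
  exact e

end OpEq


section Words
variable {d : ℕ}

/-- letters -/
abbrev Lt (d : ℕ) := Fin 3 × Option (Fin d)

def wd {ι E : Type*} [NormedAddCommGroup E] [NormedSpace ℝ E] (e : ι → E) (W : List ι)
    (g : E → ℂ) : E → ℂ := W.foldr (fun l h => dirD (e l) h) g

section gen
variable {ι E : Type*} [NormedAddCommGroup E] [NormedSpace ℝ E] {e : ι → E}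

lemma wd_nil (g : E → ℂ) : wd e [] g = g := rfl

lemma wd_cons (l : ι) (W : List ι) (g : E → ℂ) : wd e (l :: W) g = dirD (e l) (wd e W g) := rfl

lemma wd_append (W W' : List ι) (g : E → ℂ) : wd e (W ++ W') g = wd e W (wd e W' g) := by
  simp [wd, List.foldr_append]

lemma Sm.wd {g : E → ℂ} (hg : Sm g) (W : List ι) : Sm (wd e W g) := by
  induction W with
  | nil => exact hg
  | cons l W ih => exact ih.dirD _

lemma wd_perm {W W' : List ι} (h : W.Perm W') {g : E → ℂ} (hg : Sm g) : wd e W g = wd e W' g := by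
  induction h with
  | nil => rfl
  | cons l _ ih => rw [wd_cons, wd_cons, ih]
  | swap l l' W => simp only [wd_cons]; exact dirD_comm (hg.wd W) _ _
  | trans _ _ h1 h2 => rw [h1, h2]

lemma wd_cons' {g : E → ℂ} (hg : Sm g) (l : ι) (W : List ι) :
    wd e (l :: W) g = wd e W (dirD (e l) g) := by
  rw [wd_perm (W' := W ++ [l]) (List.perm_append_singleton l W).symm hg, wd_append]; rfl

lemma wd_add (W : List ι) {g h : E → ℂ} (hg : Sm g) (hh : Sm h) :
    wd e W (fun x => g x + h x) = fun x => wd e W g x + wd e W h x := by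
  induction W with
  | nil => rfl
  | cons l W ih => simp only [wd_cons]; rw [ih]; exact dirD_add (hg.wd W) (hh.wd W) _

lemma wd_sub (W : List ι) {g h : E → ℂ} (hg : Sm g) (hh : Sm h) :
    wd e W (fun x => g x - h x) = fun x => wd e W g x - wd e W h x := by
  induction W with
  | nil => rfl
  | cons l W ih => simp only [wd_cons]; rw [ih]; exact dirD_sub (hg.wd W) (hh.wd W) _

lemma wd_const_mul (W : List ι) {g : E → ℂ} (hg : Sm g) (c : ℂ) :
    wd e W (fun x => c * g x) = fun x => c * wd e W g x := by
  induction W with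
  | nil => rfl
  | cons l W ih => simp only [wd_cons]; rw [ih]; exact dirD_const_mul (hg.wd W) _ _

lemma wd_sum {κ : Type*} (s : Finset κ) (W : List ι) {g : κ → E → ℂ} (hg : ∀ i, Sm (g i)) :
    wd e W (fun x => ∑ i ∈ s, g i x) = fun x => ∑ i ∈ s, wd e W (g i) x := by
  induction W with
  | nil => rfl
  | cons l W ih => simp only [wd_cons]; rw [ih]; exact dirD_sum s (fun i => (hg i).wd W) _

end gen

/-- the canonical word of a block -/
def blk (k : Fin 3) (α : MIdx d) : List (Lt d) :=
  List.replicate α.1 (k, none) ++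
    (List.finRange d).flatMap (fun i => List.replicate (α.2 i) (k, some i))

lemma wd_replicate {ι E : Type*} [NormedAddCommGroup E] [NormedSpace ℝ E] (e : ι → E) (n : ℕ)
    (l : ι) (g : E → ℂ) : wd e (List.replicate n l) g = (dirD (e l))^[n] g := by
  induction n with
  | zero => rfl
  | succ n ih => rw [List.replicate_succ, wd_cons, ih, Function.iterate_succ_apply']

lemma wd_flat {ι κ E : Type*} [NormedAddCommGroup E] [NormedSpace ℝ E] (e : ι → E) (L : List κ)
    (n : κ → ℕ) (l : κ → ι) (g : E → ℂ) :
    wd e (L.flatMap (fun i => List.replicate (n i) (l i))) g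
      = L.foldr (fun i h => (dirD (e (l i)))^[n i] h) g := by
  induction L with
  | nil => rfl
  | cons a L ih => rw [List.flatMap_cons, wd_append, ih, wd_replicate, List.foldr_cons]

lemma wd_blk {E : Type*} [NormedAddCommGroup E] [NormedSpace ℝ E] (e : Lt d → E) (k : Fin 3)
    (α : MIdx d) (g : E → ℂ) : wd e (blk k α) g = (dirD (e (k, none)))^[α.1]
      ((List.finRange d).foldr (fun i h => (dirD (e (k, some i)))^[α.2 i] h) g) := by
  rw [blk, wd_append, wd_flat, wd_replicate]

def ld (d : ℕ) (l : Lt d) : Q d × Q d × Q d :=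
  if l.1 = 0 then (ee d l.2, 0, 0) else if l.1 = 1 then (0, ee d l.2, 0) else (0, 0, ee d l.2)

def ld2 (d : ℕ) (l : Lt d) : Q d × Q d := ((ld d l).1, (ld d l).2.1)

lemma mderiv3_wd (α β γ : MIdx d) (g : Q d × Q d × Q d → ℂ) :
    mderiv3 α β γ g = wd (ld d) (blk 0 α ++ blk 1 β ++ blk 2 γ) g := by
  rw [wd_append, wd_append, wd_blk, wd_blk, wd_blk]; rfl

lemma mderiv2_wd (α β : MIdx d) (g : Q d × Q d → ℂ) :
    mderiv2 α β g = wd (ld2 d) (blk 0 α ++ blk 1 β) g := by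
  rw [wd_append, wd_blk, wd_blk]; rfl

/-- angular weight of a letter -/
def angl (l : Lt d) : ℤ := if l.2 = none then 0 else if l.1 = 1 then -1 else 1

def npl (l : Lt d) : ℕ := if l.1 = 1 then 1 else 0

def ang (W : List (Lt d)) : ℤ := (W.map angl).sum
def np (W : List (Lt d)) : ℕ := (W.map npl).sum

lemma sum_blk {X : Type*} [AddCommMonoid X] (φ : Lt d → X) (k : Fin 3) (α : MIdx d) :
    ((blk k α).map φ).sum = α.1 • φ (k, none) + ∑ i, α.2 i • φ (k, some i) := by
  rw [blk, List.map_append, List.sum_append, List.map_replicate, List.sum_replicate]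
  congr 1
  rw [Fin.sum_univ_def]
  generalize List.finRange d = L
  induction L with
  | nil => rfl
  | cons a L ih => simp [List.flatMap_cons, ih]

lemma ang_append (W W' : List (Lt d)) : ang (W ++ W') = ang W + ang W' := by simp [ang]
lemma np_append (W W' : List (Lt d)) : np (W ++ W') = np W + np W' := by simp [np]
lemma ang_cons (l : Lt d) (W : List (Lt d)) : ang (l :: W) = angl l + ang W := by simp [ang]
lemma np_cons (l : Lt d) (W : List (Lt d)) : np (l :: W) = npl l + np W := by simp [np]

lemma len_blk (k : Fin 3) (α : MIdx d) : (blk k α).length = deg α := by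
  have := sum_blk (fun _ => (1 : ℕ)) k α
  simpa [deg] using this

lemma ang_blk0 (α : MIdx d) : ang (blk 0 α) = degA α := by
  rw [ang, sum_blk]; simp [angl, degA]
lemma ang_blk1 (α : MIdx d) : ang (blk 1 α) = - degA α := by
  rw [ang, sum_blk]; simp [angl, degA]
lemma ang_blk2 (α : MIdx d) : ang (blk 2 α) = degA α := by
  rw [ang, sum_blk]; simp [angl, degA]
lemma np_blk0 (α : MIdx d) : np (blk 0 α) = 0 := by
  rw [np, sum_blk]; simp [npl]
lemma np_blk1 (α : MIdx d) : np (blk 1 α) = deg α := by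
  rw [np, sum_blk]; simp [npl, deg]
lemma np_blk2 (α : MIdx d) : np (blk 2 α) = 0 := by
  rw [np, sum_blk]; simp [npl]

lemma count_blk (k : Fin 3) (α : MIdx d) (l : Lt d) :
    (blk k α).count l = if l.1 = k then l.2.elim α.1 α.2 else 0 := by
  have h : (blk k α).count l = ((blk k α).map (fun x => if x = l then 1 else 0)).sum := by
    generalize blk k α = L
    induction L with
    | nil => rfl
    | cons a L ih => rw [List.count_cons, ih]; simp [add_comm]
  rw [h, sum_blk]
  obtain ⟨k', j⟩ := l
  by_cases hk : k' = k
  · subst hk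
    cases j <;> simp
  · have : ¬ k = k' := fun h => hk h.symm
    simp [hk, this]

lemma word_norm (W : List (Lt d)) : ∃ α β γ : MIdx d, W.Perm (blk 0 α ++ blk 1 β ++ blk 2 γ) := by
  refine ⟨(W.count (0, none), fun i => W.count (0, some i)),
    (W.count (1, none), fun i => W.count (1, some i)),
    (W.count (2, none), fun i => W.count (2, some i)), ?_⟩
  rw [List.perm_iff_count]
  rintro ⟨k, j⟩
  simp only [List.count_append, count_blk]
  fin_cases k <;> cases j <;> simp

lemma ang_perm {W W' : List (Lt d)} (h : W.Perm W') : ang W = ang W' := (h.map _).sum_eq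
lemma np_perm {W W' : List (Lt d)} (h : W.Perm W') : np W = np W' := (h.map _).sum_eq

end Words


section AWs
variable {d : ℕ} {f : ℝ → ℝ}

lemma one_le_brF (f : ℝ → ℝ) (x : Q d × Q d) : 1 ≤ brF f x := by
  rw [brF, Real.one_le_sqrt]
  have : 0 ≤ ∑ i, (x.2.2 i / f x.1.1) ^ 2 := Finset.sum_nonneg fun i _ => sq_nonneg _
  nlinarith [sq_nonneg x.2.1]

/-- weighted amplitude bounds up to order `N` -/
def AW (f : ℝ → ℝ) (c : ℤ) (m : ℝ) (N : ℕ) (K : ℝ) (g : Q d × Q d × Q d → ℂ) : Prop :=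
  Sm g ∧ ∀ W : List (Lt d), W.length ≤ N → ∀ x, ‖wd (ld d) W g x‖ ≤
    K * (f x.1.1 ^ (c + ang W) * brF f (x.1, x.2.1) ^ (m - np W))

/-- the same with weights at the intermediate point -/
def AV (f : ℝ → ℝ) (t : ℝ) (c : ℤ) (m : ℝ) (N : ℕ) (K : ℝ) (g : Q d × Q d × Q d → ℂ) : Prop :=
  Sm g ∧ ∀ W : List (Lt d), W.length ≤ N → ∀ x, ‖wd (ld d) W g x‖ ≤
    K * (f (t * x.1.1 + (1 - t) * x.2.2.1) ^ (c + ang W) * brFA f t x ^ (m - np W))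

lemma one_le_brFA (f : ℝ → ℝ) (t : ℝ) (x : Q d × Q d × Q d) : 1 ≤ brFA f t x := by
  rw [brFA, Real.one_le_sqrt]
  have : 0 ≤ ∑ i, (x.2.1.2 i / f (t * x.1.1 + (1 - t) * x.2.2.1)) ^ 2 :=
    Finset.sum_nonneg fun i _ => sq_nonneg _
  nlinarith [sq_nonneg x.2.1.1]

lemma mem_idxSet {N : ℕ} {α : MIdx d} (h : deg α ≤ N) : α ∈ idxSet d N := by
  simp only [idxSet, Finset.mem_filter, Finset.mem_product, Finset.mem_range, Fintype.mem_piFinset]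
  have h1 : α.1 + ∑ i, α.2 i ≤ N := h
  refine ⟨⟨by omega, fun i => ?_⟩, h⟩
  have := Finset.single_le_sum (f := α.2) (fun _ _ => Nat.zero_le _) (Finset.mem_univ i)
  omega

lemma w_bal {F b c e Z K : ℝ} (hF : 0 < F) (hb : 0 < b) {c' e' : ℝ} (hc : c' = -c) (he : e' = -e) :
    F ^ c' * b ^ e' * Z ≤ K ↔ Z ≤ K * (F ^ c * b ^ e) := by
  rw [hc, he, Real.rpow_neg hF.le, Real.rpow_neg hb.le, ← mul_inv, inv_mul_le_iff₀ (by positivity),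
    mul_comm]

lemma sum3_le {X : Type*} (s : Finset X) (T : X → X → X → ℝ) (pos : ∀ a b c, 0 ≤ T a b c)
    {a b c : X} (ha : a ∈ s) (hb : b ∈ s) (hc : c ∈ s) :
    T a b c ≤ ∑ a ∈ s, ∑ b ∈ s, ∑ c ∈ s, T a b c := by
  have i1 := Finset.single_le_sum (f := fun a => ∑ b ∈ s, ∑ c ∈ s, T a b c)
    (fun a _ => Finset.sum_nonneg fun b _ => Finset.sum_nonneg fun c _ => pos a b c) ha
  have i2 := Finset.single_le_sum (f := fun b => ∑ c ∈ s, T a b c)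
    (fun b _ => Finset.sum_nonneg fun c _ => pos a b c) hb
  have i3 := Finset.single_le_sum (f := fun c => T a b c) (fun c _ => pos a b c) hc
  exact (i3.trans i2).trans i1

lemma amp_AV (hf : ∀ r, 1 ≤ f r) {m t : ℝ} {a : Q d × Q d × Q d → ℂ} (ha : IsAmp f m t a) (N : ℕ) :
    AV f t 0 m N (ampNorm f m t N a) a := by
  refine ⟨ha.1, fun W hW x => ?_⟩
  obtain ⟨α, β, γ, hp⟩ := word_norm W
  have hl := hp.length_eq
  simp only [List.length_append, len_blk] at hl
  rw [wd_perm hp ha.1, ang_perm hp, np_perm hp, ← mderiv3_wd]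
  simp only [ang_append, np_append, ang_blk0, ang_blk1, ang_blk2, np_blk0, np_blk1, np_blk2,
    zero_add, add_zero]
  have hb : ∀ x : Q d × Q d × Q d, (0 : ℝ) < brFA f t x := fun x => lt_of_lt_of_le one_pos (one_le_brFA f t x)
  have hf0 : ∀ r, 0 < f r := fun r => lt_of_lt_of_le one_pos (hf r)
  rw [← Real.rpow_intCast]
  push_cast
  rw [← w_bal (hf0 _) (hb x) (c' := -(degA α : ℝ) + (degA β : ℝ) - (degA γ : ℝ))
    (e' := -m + (deg β : ℝ)) (by ring) (by ring)]
  have bdd : ∀ α β γ : MIdx d, BddAbove (Set.range fun x : Q d × Q d × Q d =>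
      f (t * x.1.1 + (1 - t) * x.2.2.1) ^ (-(degA α : ℝ) + (degA β : ℝ) - (degA γ : ℝ)) *
          brFA f t x ^ (-m + (deg β : ℝ)) * ‖mderiv3 α β γ a x‖) := by
    intro α β γ
    obtain ⟨C, hC⟩ := ha.2 α β γ
    refine ⟨C, ?_⟩
    rintro _ ⟨y, rfl⟩
    simp only
    rw [w_bal (hf0 _) (hb y) (c := (degA α : ℝ) - (degA β : ℝ) + (degA γ : ℝ))
      (e := m - (deg β : ℝ)) (by ring) (by ring), ← mul_assoc]
    exact hC y
  refine (le_ciSup (bdd α β γ) x).trans ?_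
  have pos : ∀ α β γ : MIdx d, 0 ≤ (if deg α + deg β + deg γ ≤ N then
      ⨆ x : Q d × Q d × Q d,
        f (t * x.1.1 + (1 - t) * x.2.2.1) ^ (-(degA α : ℝ) + (degA β : ℝ) - (degA γ : ℝ)) *
          brFA f t x ^ (-m + (deg β : ℝ)) * ‖mderiv3 α β γ a x‖
    else 0) := by
    intro α β γ
    split_ifs
    · refine Real.iSup_nonneg fun x => ?_
      have := hf0 (t * x.1.1 + (1 - t) * x.2.2.1)
      have := hb x
      positivity
    · exact le_rfl
  have i4 := sum3_le (idxSet d N) _ pos (mem_idxSet (α := α) (by omega))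
    (mem_idxSet (α := β) (by omega)) (mem_idxSet (α := γ) (by omega))
  rw [if_pos (by omega)] at i4
  exact i4

lemma ampNorm_nonneg (hf : ∀ r, 1 ≤ f r) {m t : ℝ} {a : Q d × Q d × Q d → ℂ} (N : ℕ) :
    0 ≤ ampNorm f m t N a := by
  refine Finset.sum_nonneg fun α _ => Finset.sum_nonneg fun β _ => Finset.sum_nonneg fun γ _ => ?_
  split_ifs
  · refine Real.iSup_nonneg fun x => ?_
    have := lt_of_lt_of_le one_pos (hf (t * x.1.1 + (1 - t) * x.2.2.1))
    have := lt_of_lt_of_le one_pos (one_le_brFA f t x)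
    positivity
  · exact le_rfl

lemma AV.dirD {t : ℝ} {c : ℤ} {m : ℝ} {N : ℕ} {K : ℝ} {g : Q d × Q d × Q d → ℂ}
    (h : AV f t c m (N + 1) K g) (l : Lt d) : AV f t (c + angl l) (m - npl l) N K (dirD (ld d l) g) := by
  refine ⟨h.1.dirD _, fun W hW x => ?_⟩
  have := h.2 (l :: W) (by simpa using hW) x
  rw [wd_cons' h.1, ang_cons, np_cons] at this
  rw [add_assoc, sub_sub]
  exact_mod_cast this

/-- the linear map -/
def tL (d : ℕ) (t : ℝ) : Q d × Q d × Q d →L[ℝ] Q d × Q d × Q d :=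
  (ContinuousLinearMap.fst ℝ (Q d) (Q d × Q d) + (1 - t) •
    (ContinuousLinearMap.snd ℝ (Q d) (Q d)).comp (ContinuousLinearMap.snd ℝ (Q d) (Q d × Q d))).prod
  (((ContinuousLinearMap.fst ℝ (Q d) (Q d)).comp (ContinuousLinearMap.snd ℝ (Q d) (Q d × Q d))).prod
  (ContinuousLinearMap.fst ℝ (Q d) (Q d × Q d) - t •
    (ContinuousLinearMap.snd ℝ (Q d) (Q d)).comp (ContinuousLinearMap.snd ℝ (Q d) (Q d × Q d))))

lemma tL_apply (t : ℝ) (y : Q d × Q d × Q d) :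
    tL d t y = (y.1 + (1 - t) • y.2.2, y.2.1, y.1 - t • y.2.2) := rfl

lemma tA_eq (t : ℝ) (a : Q d × Q d × Q d → ℂ) : tA t a = fun y => a (tL d t y + 0) := by
  funext y; rw [add_zero, tL_apply, tA]

lemma tA_sm (t : ℝ) {a : Q d × Q d × Q d → ℂ} (ha : Sm a) : Sm (tA t a) := by
  rw [tA_eq]; exact ContDiff.comp ha ((tL d t).contDiff.add contDiff_const)

lemma tL_ld {t : ℝ} (ht : t ∈ Set.Icc (0 : ℝ) 1) (l : Lt d) : ∃ (c1 c2 : ℝ) (l1 l2 : Lt d),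
    |c1| ≤ 1 ∧ |c2| ≤ 1 ∧ angl l1 = angl l ∧ angl l2 = angl l ∧ npl l1 = npl l ∧ npl l2 = npl l ∧
    tL d t (ld d l) = c1 • ld d l1 + c2 • ld d l2 := by
  obtain ⟨h0, h1⟩ := ht
  obtain ⟨k, i⟩ := l
  fin_cases k
  · exact ⟨1, 1, (0, i), (2, i), by simp, by simp, by simp [angl], by simp [angl], by simp [npl],
      by simp [npl], by simp [ld, tL_apply]⟩
  · exact ⟨1, 0, (1, i), (1, i), by simp, by simp, by simp [angl], by simp [angl], by simp [npl],
      by simp [npl], by simp [ld, tL_apply]⟩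
  · exact ⟨1 - t, -t, (0, i), (2, i), by rw [abs_le]; constructor <;> linarith,
      by rw [abs_le]; constructor <;> linarith, by simp [angl], by simp [angl], by simp [npl],
      by simp [npl], by simp [ld, tL_apply]⟩

lemma tA_AW {t : ℝ} (ht : t ∈ Set.Icc (0 : ℝ) 1) (W : List (Lt d)) :
    ∀ (c : ℤ) (m K : ℝ) (g : Q d × Q d × Q d → ℂ), AV f t c m W.length K g →
    ∀ x, ‖wd (ld d) W (tA t g) x‖ ≤
      2 ^ W.length * K * (f x.1.1 ^ (c + ang W) * brF f (x.1, x.2.1) ^ (m - np W)) := by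
  induction W with
  | nil =>
    intro c m K g h x
    have h1 := h.2 [] le_rfl (tL d t x)
    have e1 : t * (tL d t x).1.1 + (1 - t) * (tL d t x).2.2.1 = x.1.1 := by
      rw [tL_apply]; simp; ring
    have e2 : brFA f t (tL d t x) = brF f (x.1, x.2.1) := by
      rw [brFA, e1]; rfl
    rw [e1, e2] at h1
    have e3 : tA t g x = g (tL d t x) := rfl
    simpa [wd_nil, e3] using h1
  | cons l W ih =>
    intro c m K g h x
    obtain ⟨c1, c2, l1, l2, hc1, hc2, a1, a2, n1, n2, e⟩ := tL_ld ht l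
    have s1 := h.1.dirD (ld d l1)
    have s2 := h.1.dirD (ld d l2)
    have key : dirD (ld d l) (tA t g) = fun x => (c1 : ℂ) * tA t (dirD (ld d l1) g) x
        + (c2 : ℂ) * tA t (dirD (ld d l2) g) x := by
      rw [tA_eq, dirD_comp h.1, e]
      funext y
      rw [dirD_vadd, dirD_vsmul, dirD_vsmul, tA_eq, tA_eq]
    have hW := h.dirD (N := W.length) l1
    have hW2 := h.dirD (N := W.length) l2
    have b1 := ih _ _ _ _ hW x
    have b2 := ih _ _ _ _ hW2 x
    rw [wd_cons' (tA_sm t h.1), key, wd_add _ (by exact contDiff_const.mul (tA_sm t s1)) (by exact contDiff_const.mul (tA_sm t s2)),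
      wd_const_mul _ (tA_sm t s1), wd_const_mul _ (tA_sm t s2)]
    rw [a1, n1] at b1
    rw [a2, n2] at b2
    rw [ang_cons, np_cons, ← add_assoc, Nat.cast_add, ← sub_sub, List.length_cons, pow_succ]
    generalize (f x.1.1 ^ (c + angl l + ang W) * brF f (x.1, x.2.1) ^ (m - npl l - np W)) = T at *
    refine (norm_add_le _ _).trans ?_
    rw [norm_mul, norm_mul, Complex.norm_real, Complex.norm_real, Real.norm_eq_abs, Real.norm_eq_abs]
    have q1 := mul_le_mul hc1 b1 (norm_nonneg _) zero_le_one
    have q2 := mul_le_mul hc2 b2 (norm_nonneg _) zero_le_one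
    linarith

lemma amp_AW (hf : ∀ r, 1 ≤ f r) {m t : ℝ} (ht : t ∈ Set.Icc (0 : ℝ) 1)
    {a : Q d × Q d × Q d → ℂ} (ha : IsAmp f m t a) (N : ℕ) :
    AW f 0 m N (2 ^ N * ampNorm f m t N a) (tA t a) := by
  refine ⟨tA_sm t ha.1, fun W hW x => ?_⟩
  have h1 := amp_AV hf ha N
  have h2 : AV f t 0 m W.length (ampNorm f m t N a) a := ⟨h1.1, fun W' hW' => h1.2 W' (hW'.trans hW)⟩
  refine (tA_AW ht W _ _ _ _ h2 x).trans ?_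
  have := ampNorm_nonneg (d := d) hf (m := m) (t := t) (a := a) N
  have := lt_of_lt_of_le one_pos (hf x.1.1)
  have := lt_of_lt_of_le one_pos (one_le_brF f (x.1, x.2.1))
  gcongr
  norm_num

lemma AW.wd {c : ℤ} {m : ℝ} {N : ℕ} {K : ℝ} {g : Q d × Q d × Q d → ℂ} (W0 : List (Lt d))
    (h : AW f c m (N + W0.length) K g) : AW f (c + ang W0) (m - np W0) N K (wd (ld d) W0 g) := by
  refine ⟨h.1.wd _, fun W hW x => ?_⟩
  have := h.2 (W ++ W0) (by simpa using hW) x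
  rw [wd_append, ang_append, np_append] at this
  rw [add_assoc, sub_sub, add_comm (ang W0), ← Nat.cast_add, add_comm (np W0)]
  exact this

lemma AW.mono {c : ℤ} {m : ℝ} {N N' : ℕ} {K : ℝ} {g : Q d × Q d × Q d → ℂ}
    (h : AW f c m N K g) (hN : N' ≤ N) : AW f c m N' K g :=
  ⟨h.1, fun W hW => h.2 W (hW.trans hN)⟩

/-- `∂_p ⬝ ∂_{q'}` -/
def Yop (g : Q d × Q d × Q d → ℂ) : Q d × Q d × Q d → ℂ :=
  fun x => ∑ i, wd (ld d) [(1, i), (2, i)] g x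

lemma dpdq_eq : (dpdq' (d := d)) = Yop := by
  funext g x
  rw [Yop, Fintype.sum_option]; rfl

lemma Sm.Yop {g : Q d × Q d × Q d → ℂ} (h : Sm g) : Sm (Yop g) :=
  ContDiff.sum fun i _ => h.wd _

lemma AW.Yop {c : ℤ} {m : ℝ} {N : ℕ} {K : ℝ} {g : Q d × Q d × Q d → ℂ}
    (h : AW f c m (N + 2) K g) : AW f c (m - 1) N ((d + 1) * K) (Yop g) := by
  refine ⟨h.1.Yop, fun W hW x => ?_⟩
  have e : _root_.Yop g = fun x => ∑ i, _root_.wd (ld d) [(1, i), (2, i)] g x := rfl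
  rw [e, wd_sum _ _ (fun i => h.1.wd _)]
  refine (norm_sum_le _ _).trans ?_
  have : ∀ i ∈ Finset.univ, ‖_root_.wd (ld d) W (_root_.wd (ld d) [(1, i), (2, i)] g) x‖ ≤
      K * (f x.1.1 ^ (c + ang W) * brF f (x.1, x.2.1) ^ (m - 1 - np W)) := by
    intro i _
    have h1 := (AW.wd [(1, i), (2, i)] h).2 W hW x
    have e1 : ang [((1, i) : Lt d), (2, i)] = 0 := by
      cases i <;> simp [ang, angl]
    have e2 : np [((1, i) : Lt d), (2, i)] = 1 := by simp [np, npl]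
    rw [e1, e2, add_zero, Nat.cast_one] at h1
    exact h1
  refine (Finset.sum_le_sum this).trans ?_
  rw [Finset.sum_const, Finset.card_univ, Fintype.card_option, Fintype.card_fin, nsmul_eq_mul]
  push_cast
  rw [mul_assoc]

lemma AW.Yopn {c : ℤ} {m : ℝ} {N : ℕ} {K : ℝ} (j : ℕ) {g : Q d × Q d × Q d → ℂ}
    (h : AW f c m (N + 2 * j) K g) : AW f c (m - j) N ((d + 1) ^ j * K) (_root_.Yop^[j] g) := by
  induction j generalizing N with
  | zero => simpa using h
  | succ j ih =>
    rw [Function.iterate_succ_apply']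
    have h1 := (ih (N := N + 2) (by convert h using 1; ring)).Yop
    convert h1 using 1
    · push_cast; ring
    · ring

lemma wd_Yop (W : List (Lt d)) {g : Q d × Q d × Q d → ℂ} (hg : Sm g) :
    wd (ld d) W (Yop g) = Yop (wd (ld d) W g) := by
  have e : Yop g = fun x => ∑ i, wd (ld d) [(1, i), (2, i)] g x := rfl
  rw [e, wd_sum _ _ (fun i => hg.wd _)]
  funext x
  rw [Yop]
  refine Finset.sum_congr rfl fun i _ => ?_
  rw [← wd_append, ← wd_append, wd_perm List.perm_append_comm hg]

lemma Sm.Yopn {g : Q d × Q d × Q d → ℂ} (h : Sm g) (j : ℕ) : Sm (_root_.Yop^[j] g) := by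
  induction j with
  | zero => exact h
  | succ j ih => rw [Function.iterate_succ_apply']; exact ih.Yop

lemma wd_Yopn (W : List (Lt d)) (j : ℕ) {g : Q d × Q d × Q d → ℂ} (hg : Sm g) :
    wd (ld d) W (Yop^[j] g) = Yop^[j] (wd (ld d) W g) := by
  induction j with
  | zero => rfl
  | succ j ih => rw [Function.iterate_succ_apply', Function.iterate_succ_apply', wd_Yop _ (hg.Yopn j), ih]

end AWs


section WB

lemma iFD_words {ι E : Type*} [Fintype ι] [NormedAddCommGroup E] [NormedSpace ℝ E] (e : ι → E)
    (lam : ι → E →L[ℝ] ℝ) (hx : ∀ x, x = ∑ i, lam i x • e i) (hl : ∀ i x, |lam i x| ≤ ‖x‖) (j : ℕ) :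
    ∀ (Ψ : E → ℂ), Sm Ψ → ∀ (x : E) (B : ℝ), (∀ W : List ι, W.length = j → ‖wd e W Ψ x‖ ≤ B) →
    ‖iteratedFDeriv ℝ j Ψ x‖ ≤ (Fintype.card ι : ℝ) ^ j * B := by
  induction j with
  | zero => intro Ψ _ x B h; simpa [wd_nil] using h [] rfl
  | succ j ih =>
    intro Ψ hs x B h
    have h1 : fderiv ℝ Ψ = fun y => ∑ i, ContinuousLinearMap.smulRightL ℝ E ℂ (lam i) (dirD (e i) Ψ y) := by
      funext y
      ext v
      rw [_root_.sum_apply]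
      conv_lhs => rw [hx v, map_sum]
      refine Finset.sum_congr rfl fun i _ => ?_
      rw [map_smul]; rfl
    have sm : ∀ i, Sm (fun y => ContinuousLinearMap.smulRightL ℝ E ℂ (lam i) (dirD (e i) Ψ y)) :=
      fun i => (ContinuousLinearMap.contDiff _).comp (hs.dirD (e i))
    rw [← norm_iteratedFDeriv_fderiv, h1, iteratedFDeriv_fun_sum_apply (fun i _ => ((sm i).nat j).contDiffAt)]
    refine (norm_sum_le _ _).trans ?_
    have b : ∀ i ∈ Finset.univ, ‖iteratedFDeriv ℝ j (fun y =>
        ContinuousLinearMap.smulRightL ℝ E ℂ (lam i) (dirD (e i) Ψ y)) x‖ ≤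
        (Fintype.card ι : ℝ) ^ j * B := by
      intro i _
      have q := (ContinuousLinearMap.smulRightL ℝ E ℂ (lam i)).norm_iteratedFDeriv_comp_left
        (f := dirD (e i) Ψ) (x := x) (n := j) (N := j) (((hs.dirD (e i)).nat j).contDiffAt) le_rfl
      have n1 : ‖ContinuousLinearMap.smulRightL ℝ E ℂ (lam i)‖ ≤ 1 := by
        refine ContinuousLinearMap.opNorm_le_bound _ zero_le_one fun c => ?_
        refine ContinuousLinearMap.opNorm_le_bound _ (by positivity) fun v => ?_
        have := hl i v
        simp only [ContinuousLinearMap.smulRightL_apply_apply, ContinuousLinearMap.smulRight_apply, norm_smul, Real.norm_eq_abs, one_mul]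
        rw [mul_comm]; gcongr
      have r := ih (dirD (e i) Ψ) (hs.dirD _) x B (fun W hW => by
        have := h (W ++ [i]) (by simp [hW])
        rw [wd_append] at this; exact this)
      refine q.trans ((mul_le_mul n1 r (norm_nonneg _) zero_le_one).trans ?_)
      rw [one_mul]
    refine (Finset.sum_le_sum b).trans ?_
    rw [Finset.sum_const, Finset.card_univ, nsmul_eq_mul, pow_succ]
    apply le_of_eq; ring

lemma bd_words {ι E : Type*} [Fintype ι] [Nonempty ι] [NormedAddCommGroup E] [NormedSpace ℝ E] (e : ι → E)
    (lam : ι → E →L[ℝ] ℝ) (hx : ∀ x, x = ∑ i, lam i x • e i) (hl : ∀ i x, |lam i x| ≤ ‖x‖) (k : ℕ)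
    {Ψ : E → ℂ} (hs : Sm Ψ) {C : ℝ} {ω : E → ℝ}
    (h : ∀ W : List ι, W.length ≤ k → ∀ x, ‖wd e W Ψ x‖ ≤ C * ω x) :
    Bd k ω ((Fintype.card ι : ℝ) ^ k * C) Ψ := by
  intro j hj x
  have h0 := (norm_nonneg _).trans (h [] (Nat.zero_le _) x)
  refine (iFD_words e lam hx hl j Ψ hs x (C * ω x) (fun W hW => h W (hW.le.trans hj) x)).trans ?_
  rw [mul_assoc]
  gcongr
  exact_mod_cast Fintype.card_pos

variable {d : ℕ}

def lam3 (d : ℕ) (l : Lt d) : Q d × Q d × Q d →L[ℝ] ℝ :=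
  if l.1 = 0 then (co d l.2).comp (ContinuousLinearMap.fst ℝ (Q d) (Q d × Q d)) else
  if l.1 = 1 then (co d l.2).comp ((ContinuousLinearMap.fst ℝ (Q d) (Q d)).comp
    (ContinuousLinearMap.snd ℝ (Q d) (Q d × Q d))) else
  (co d l.2).comp ((ContinuousLinearMap.snd ℝ (Q d) (Q d)).comp
    (ContinuousLinearMap.snd ℝ (Q d) (Q d × Q d)))

lemma lam3_x (x : Q d × Q d × Q d) : x = ∑ l, lam3 d l x • ld d l := by
  rw [Fintype.sum_prod_type, Fin.sum_univ_three]
  have h1 := (decomp x.1).trans (Fintype.sum_option _)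
  have h2 := (decomp x.2.1).trans (Fintype.sum_option _)
  have h3 := (decomp x.2.2).trans (Fintype.sum_option _)
  refine Prod.ext ?_ (Prod.ext ?_ ?_)
  · simp [lam3, ld, Prod.fst_sum, Prod.snd_sum]; exact h1
  · simp [lam3, ld, Prod.fst_sum, Prod.snd_sum]; exact h2
  · simp [lam3, ld, Prod.fst_sum, Prod.snd_sum]; exact h3

lemma lam3_le (l : Lt d) (x : Q d × Q d × Q d) : |lam3 d l x| ≤ ‖x‖ := by
  obtain ⟨k, i⟩ := l
  fin_cases k
  · exact (co_le x.1 i).trans (norm_fst_le x)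
  · exact (co_le x.2.1 i).trans ((norm_fst_le x.2).trans (norm_snd_le x))
  · exact (co_le x.2.2 i).trans ((norm_snd_le x.2).trans (norm_snd_le x))

abbrev Lu (d : ℕ) := Bool × Option (Fin d)

def lu (d : ℕ) (l : Lu d) : Q d × Q d := if l.1 then (ee d l.2, 0) else (0, ee d l.2)

def lamu (d : ℕ) (l : Lu d) : Q d × Q d →L[ℝ] ℝ :=
  if l.1 then (co d l.2).comp (ContinuousLinearMap.fst ℝ (Q d) (Q d)) else
  (co d l.2).comp (ContinuousLinearMap.snd ℝ (Q d) (Q d))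

lemma lamu_x (x : Q d × Q d) : x = ∑ l, lamu d l x • lu d l := by
  rw [Fintype.sum_prod_type, Fintype.sum_bool]
  have h1 := (decomp x.1).trans (Fintype.sum_option _)
  have h2 := (decomp x.2).trans (Fintype.sum_option _)
  refine Prod.ext ?_ ?_
  · simp [lamu, lu, Prod.fst_sum, Prod.snd_sum]; exact h1
  · simp [lamu, lu, Prod.fst_sum, Prod.snd_sum]; exact h2

lemma lamu_le (l : Lu d) (x : Q d × Q d) : |lamu d l x| ≤ ‖x‖ := by
  obtain ⟨k, i⟩ := l
  cases k
  · exact (co_le x.2 i).trans (norm_snd_le x)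
  · exact (co_le x.1 i).trans (norm_fst_le x)

end WB


section Key
variable {d : ℕ} {f : ℝ → ℝ}

/-- Japanese bracket via coordinates -/
def jb (y : Q d) : ℝ := Real.sqrt (1 + ∑ i, (co d i y) ^ 2)

lemma one_le_jb (y : Q d) : 1 ≤ jb y := by
  rw [jb, Real.one_le_sqrt]
  have : 0 ≤ ∑ i, (co d i y) ^ 2 := Finset.sum_nonneg fun i _ => sq_nonneg _
  linarith

lemma jb_peetre (P y : Q d) : jb (P + y) ≤ ((d + 1) * (1 + ‖y‖)) * jb P := by
  have hb := one_le_jb P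
  have hy := norm_nonneg y
  have hsq : jb P ^ 2 = 1 + ∑ i, (co d i P) ^ 2 := by
    rw [jb, Real.sq_sqrt]
    have : 0 ≤ ∑ i, (co d i P) ^ 2 := Finset.sum_nonneg fun i _ => sq_nonneg _
    linarith
  have hP : ∀ i, |co d i P| ≤ jb P := by
    intro i
    rw [jb]
    apply Real.le_sqrt_of_sq_le
    have := Finset.single_le_sum (f := fun i => (co d i P) ^ 2) (fun _ _ => sq_nonneg _)
      (Finset.mem_univ i)
    rw [sq_abs]
    linarith
  rw [jb, Real.sqrt_le_left (by positivity)]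
  have h1 : ∑ i, (co d i (P + y)) ^ 2 ≤ ∑ i : Option (Fin d), ((co d i P) ^ 2 + (2 * jb P * ‖y‖ + ‖y‖ ^ 2)) := by
    refine Finset.sum_le_sum fun i _ => ?_
    rw [map_add]
    have a1 := hP i
    have a2 := co_le y i
    have a3 : co d i P * co d i y ≤ jb P * ‖y‖ := by
      refine (le_abs_self _).trans ?_
      rw [abs_mul]; exact mul_le_mul a1 a2 (abs_nonneg _) (by positivity)
    have a4 : (co d i y) ^ 2 ≤ ‖y‖ ^ 2 := by
      rw [← sq_abs]; gcongr
    nlinarith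
  rw [Finset.sum_add_distrib, Finset.sum_const, Finset.card_univ, Fintype.card_option,
    Fintype.card_fin, nsmul_eq_mul] at h1
  push_cast at h1
  have hd : (0 : ℝ) ≤ d := Nat.cast_nonneg d
  have h2 : 1 + ∑ i, (co d i (P + y)) ^ 2 ≤ jb P ^ 2 + (d + 1) * (2 * jb P * ‖y‖ + ‖y‖ ^ 2) := by
    rw [hsq]; linarith
  refine h2.trans ?_
  generalize jb P = b at *
  generalize ‖y‖ = Y at *
  have e1 : (d + 1 : ℝ) * (1 + Y) * b = (d + 1) * b + (d + 1) * Y * b := by ring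
  have e2 : b + (d + 1) * Y ≤ (d + 1) * (1 + Y) * b := by
    rw [e1]
    have : (d + 1) * Y * 1 ≤ (d + 1) * Y * b := by gcongr
    nlinarith
  have e3 : b ^ 2 + (d + 1) * (2 * b * Y + Y ^ 2) ≤ (b + (d + 1) * Y) ^ 2 := by
    have : 0 ≤ (d : ℝ) * (d + 1) * Y ^ 2 := by positivity
    nlinarith
  refine e3.trans ?_
  gcongr

/-- linear diagonal scaling -/
def dgL (d : ℕ) (a b : ℝ) : Q d →L[ℝ] Q d :=
  (a • ContinuousLinearMap.fst ℝ ℝ (Fin d → ℝ)).prod (b • ContinuousLinearMap.snd ℝ ℝ (Fin d → ℝ))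

lemma dgL_apply (a b : ℝ) (y : Q d) : dgL d a b y = dg a b y := rfl

lemma brF_jb (w p : Q d) : brF f (w, p) = jb (dg 1 (f w.1)⁻¹ p) := by
  rw [brF, jb, Fintype.sum_option, ← add_assoc]
  simp [dg, co, div_eq_inv_mul]

lemma dg_inv {F : ℝ} (hF : F ≠ 0) (p y : Q d) : dg 1 F⁻¹ (p + dg 1 F y) = dg 1 F⁻¹ p + y := by
  ext <;> simp [dg, mul_add, hF]

lemma brF_peetre (hf : ∀ r, 1 ≤ f r) (w p y : Q d) :
    brF f (w, p + dg 1 (f w.1) y) ≤ ((d + 1) * (1 + ‖y‖)) * brF f (w, p) := by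
  have hF : f w.1 ≠ 0 := (lt_of_lt_of_le one_pos (hf _)).ne'
  rw [brF_jb, brF_jb, dg_inv hF]
  exact jb_peetre _ _

lemma brF_peetre' (hf : ∀ r, 1 ≤ f r) (w p y : Q d) :
    brF f (w, p) ≤ ((d + 1) * (1 + ‖y‖)) * brF f (w, p + dg 1 (f w.1) y) := by
  have hF : f w.1 ≠ 0 := (lt_of_lt_of_le one_pos (hf _)).ne'
  have := brF_peetre hf w (p + dg 1 (f w.1) y) (-y)
  have e : p + dg 1 (f w.1) y + dg 1 (f w.1) (-y) = p := by
    rw [add_assoc, ← dgL_apply, ← dgL_apply, ← map_add, add_neg_cancel, map_zero, add_zero]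
  rwa [e, norm_neg] at this

lemma rp_le {b b' D m : ℝ} {M : ℕ} (hb : 0 < b) (hb' : 0 < b') (hD : 1 ≤ D) (h1 : b' ≤ D * b)
    (h2 : b ≤ D * b') (hm : |m| ≤ M) : b' ^ m ≤ D ^ M * b ^ m := by
  have hD0 : 0 < D := by linarith
  rw [abs_le] at hm
  rw [← Real.rpow_natCast]
  rcases le_total 0 m with h | h
  · refine (Real.rpow_le_rpow hb'.le h1 h).trans ?_
    rw [Real.mul_rpow hD0.le hb.le]
    gcongr
    exact hm.2
  · have h3 : b / D ≤ b' := by rw [div_le_iff₀ hD0]; linarith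
    refine (Real.rpow_le_rpow_of_nonpos (by positivity) h3 h).trans ?_
    rw [Real.div_rpow hb.le hD0.le, div_eq_mul_inv, ← Real.rpow_neg hD0.le, mul_comm]
    gcongr
    linarith

/-- the inner affine map -/
def kL (d : ℕ) (F s : ℝ) : Q d × Q d →L[ℝ] Q d × Q d × Q d :=
  (0 : Q d × Q d →L[ℝ] Q d).prod (((dgL d 1 F).comp (ContinuousLinearMap.fst ℝ (Q d) (Q d))).prod
    (s • (dgL d 1⁻¹ F⁻¹).comp (ContinuousLinearMap.snd ℝ (Q d) (Q d))))

lemma kL_apply (F s : ℝ) (w p : Q d) (x : Q d × Q d) :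
    kL d F s x + (w, p, 0) = (w, p + dg 1 F x.1, s • dg 1⁻¹ F⁻¹ x.2) := by
  have : kL d F s x = (0, dg 1 F x.1, s • dg 1⁻¹ F⁻¹ x.2) := rfl
  rw [this]; ext <;> simp [add_comm]

def lut (l : Lu d) : Lt d := (if l.1 then 1 else 2, l.2)

lemma dg_ee_none (a b : ℝ) : dg a b (ee d none) = a • ee d none := by
  ext <;> simp [dg, ee, eR]

lemma dg_ee_some (a b : ℝ) (i : Fin d) : dg a b (ee d (some i)) = b • ee d (some i) := by
  ext <;> simp [dg, ee, eTh]

lemma kL_lu {F s : ℝ} (hF : 1 ≤ F) (hs : s ∈ Set.Icc (0 : ℝ) 1) (l : Lu d) : ∃ c : ℝ,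
    |c| ≤ F ^ (- angl (lut l)) ∧ kL d F s (lu d l) = c • ld d (lut l) := by
  have e0 : ∀ y : Q d × Q d, kL d F s y = (0, dg 1 F y.1, s • dg 1⁻¹ F⁻¹ y.2) := fun y => rfl
  have z : ∀ a b : ℝ, dg a b (0 : Q d) = 0 := fun a b => by ext <;> simp [dg]
  have hs' : |s| ≤ 1 := by rw [abs_of_nonneg hs.1]; exact hs.2
  have hF0 : 0 < F := by linarith
  obtain ⟨b, i⟩ := l
  rw [e0]
  cases b <;> cases i
  · exact ⟨s, by simpa [lut, angl] using hs', by simp [lu, lut, ld, z, dg_ee_none]⟩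
  · refine ⟨s * F⁻¹, ?_, by simp [lu, lut, ld, z, dg_ee_some, smul_smul]⟩
    simp only [lut, angl, abs_mul, abs_inv, abs_of_pos hF0]
    simp
    exact mul_le_of_le_one_left (by positivity) hs'
  · exact ⟨1, by simp [lut, angl], by simp [lu, lut, ld, z, dg_ee_none]⟩
  · exact ⟨F, by simp [lut, angl, abs_of_pos hF0], by simp [lu, lut, ld, z, dg_ee_some]⟩

lemma wd_kL {F s : ℝ} (hF : 1 ≤ F) (hs : s ∈ Set.Icc (0 : ℝ) 1) (w p : Q d) {g : Q d × Q d × Q d → ℂ}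
    (hg : Sm g) (W : List (Lu d)) : ∃ c : ℝ, |c| ≤ F ^ (- ang (W.map lut)) ∧
    wd (lu d) W (fun x => g (kL d F s x + (w, p, 0)))
      = fun x => (c : ℂ) * wd (ld d) (W.map lut) g (kL d F s x + (w, p, 0)) := by
  have hF0 : 0 < F := by linarith
  induction W with
  | nil => exact ⟨1, by simp [ang], by simp [wd_nil]⟩
  | cons l W ih =>
    obtain ⟨c, hc, e⟩ := ih
    obtain ⟨c', hc', e'⟩ := kL_lu hF hs l
    have sg := hg.wd (e := ld d) (W.map lut)
    have sg' : Sm (fun x => wd (ld d) (W.map lut) g (kL d F s x + (w, p, 0))) :=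
      ContDiff.comp sg ((kL d F s).contDiff.add contDiff_const)
    refine ⟨c * c', ?_, ?_⟩
    · rw [List.map_cons, ang_cons, neg_add, zpow_add₀ hF0.ne', abs_mul, mul_comm]
      exact mul_le_mul hc' hc (abs_nonneg _) (by positivity)
    · rw [wd_cons, e, dirD_const_mul sg', dirD_comp sg, e', List.map_cons, wd_cons]
      funext x
      rw [dirD_vsmul]
      push_cast; ring

lemma np_nonneg_le {b m : ℝ} (hb : 1 ≤ b) (n : ℕ) : b ^ (m - n) ≤ b ^ m :=
  Real.rpow_le_rpow_of_exponent_le hb (by simp)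

lemma bd_key (hf : ∀ r, 1 ≤ f r) {c : ℤ} {m K s : ℝ} {k M : ℕ} (hm : |m| ≤ M) (hK : 0 ≤ K)
    (hs : s ∈ Set.Icc (0 : ℝ) 1) {g : Q d × Q d × Q d → ℂ} (hg : AW f c m k K g) (w p : Q d) :
    Bd k (pw M) ((Fintype.card (Lu d) : ℝ) ^ k * ((d + 1) ^ M * (K * (f w.1 ^ c * brF f (w, p) ^ m))))
      (fun x => g (kL d (f w.1) s x + (w, p, 0))) := by
  have sg' : Sm (fun x => g (kL d (f w.1) s x + (w, p, 0))) :=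
      ContDiff.comp hg.1 ((kL d (f w.1) s).contDiff.add contDiff_const)
  refine bd_words (lu d) (lamu d) lamu_x lamu_le k sg' fun W hW x => ?_
  obtain ⟨c', hc', e⟩ := wd_kL (hf w.1) hs w p hg.1 W
  have h1 := hg.2 (W.map lut) (by simpa using hW) (kL d (f w.1) s x + (w, p, 0))
  rw [e]
  simp only
  rw [kL_apply] at h1 ⊢
  simp only at h1
  rw [norm_mul, Complex.norm_real, Real.norm_eq_abs]
  have hF0 : 0 < f w.1 := lt_of_lt_of_le one_pos (hf _)
  have b0 : 0 < brF f (w, p) := lt_of_lt_of_le one_pos (one_le_brF f _)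
  have b1 := one_le_brF f (w, p + dg 1 (f w.1) x.1)
  have b1' : 0 < brF f (w, p + dg 1 (f w.1) x.1) := lt_of_lt_of_le one_pos b1
  have hd : (0 : ℝ) ≤ d := Nat.cast_nonneg d
  have r1 := rp_le b0 b1' (D := (d + 1) * (1 + ‖x.1‖)) (by nlinarith [norm_nonneg x.1])
    (brF_peetre hf w p x.1) (brF_peetre' hf w p x.1) hm
  have r2 := (np_nonneg_le b1 (np (W.map lut))).trans r1
  refine (mul_le_mul hc' h1 (norm_nonneg _) (by positivity)).trans ?_
  have r3 : ((d + 1 : ℝ) * (1 + ‖x.1‖)) ^ M ≤ (d + 1) ^ M * pw M x := by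
    rw [mul_pow]; gcongr; exact pw_fst M x
  calc f w.1 ^ (- ang (W.map lut)) * (K * (f w.1 ^ (c + ang (W.map lut)) *
        brF f (w, p + dg 1 (f w.1) x.1) ^ (m - np (W.map lut))))
      = K * (f w.1 ^ c * brF f (w, p + dg 1 (f w.1) x.1) ^ (m - np (W.map lut))) := by
        rw [zpow_add₀ hF0.ne', zpow_neg]; field_simp
    _ ≤ K * (f w.1 ^ c * (((d + 1) ^ M * pw M x) * brF f (w, p) ^ m)) := by
        gcongr
        exact r2.trans (by gcongr)
    _ = _ := by ring

/-- the key estimate -/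
lemma key_est (d M' : ℕ) : ∃ C, 0 ≤ C ∧ ∀ (f : ℝ → ℝ), (∀ r, 1 ≤ f r) → ∀ (c : ℤ) (m K s : ℝ) (M : ℕ),
    |m| ≤ M' → M ≤ M' → 0 ≤ K → s ∈ Set.Icc (0 : ℝ) 1 → ∀ g : Q d × Q d × Q d → ℂ, LTm M g →
    AW f c m (k0 d M') K g → ∀ w p : Q d,
    ‖osc d M (fun x => g (w, p + x.1, s • x.2))‖ ≤ C * (K * (f w.1 ^ c * brF f (w, p) ^ m)) := by
  obtain ⟨C, hC, hb⟩ := osc_bound d M'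
  refine ⟨C * ((Fintype.card (Lu d) : ℝ) ^ (k0 d M') * (d + 1) ^ M'), by positivity, ?_⟩
  intro f hf c m K s M hm hM hK hs g hg hA w p
  have hF0 : f w.1 ≠ 0 := (lt_of_lt_of_le one_pos (hf _)).ne'
  have t1 := hg.slice' w p s
  have o1 := (t1.mono hM).osc.scale 1 (f w.1) one_ne_zero hF0
  have bk := bd_key hf hm hK hs hA w p
  have sg' : Sm (fun x => g (kL d (f w.1) s x + (w, p, 0))) :=
      ContDiff.comp hA.1 ((kL d (f w.1) s).contDiff.add contDiff_const)
  have e : (fun x : Q d × Q d => g (kL d (f w.1) s x + (w, p, 0))) =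
      fun x => g (w, p + dg 1 (f w.1) x.1, s • dg 1⁻¹ (f w.1)⁻¹ x.2) := by
    funext x; rw [kL_apply]
  have t2 : Tame M' (fun x : Q d × Q d => g (w, p + dg 1 (f w.1) x.1, s • dg 1⁻¹ (f w.1)⁻¹ x.2)) :=
    (t1.mono hM).compL (((dgL d 1 (f w.1)).comp (ContinuousLinearMap.fst ℝ (Q d) (Q d))).prod
      ((dgL d 1⁻¹ (f w.1)⁻¹).comp (ContinuousLinearMap.snd ℝ (Q d) (Q d))))
  rw [e] at bk sg'
  rw [osc_mono hM t1, o1.uniq t2.osc]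
  refine (hb _ _ sg' bk).trans (le_of_eq ?_)
  ring

end Key


section LT
variable {d : ℕ} {f : ℝ → ℝ}

lemma bd_cs {E : Type*} [NormedAddCommGroup E] [NormedSpace ℝ E] {ζ : E → ℂ} (hs : Sm ζ)
    (hc : HasCompactSupport ζ) (k : ℕ) :
    ∃ C, 0 ≤ C ∧ Bd k (Set.indicator (tsupport ζ) (fun _ => (1 : ℝ))) C ζ := by
  obtain ⟨C, hC0, hC⟩ := (tame_cs hs hc).2 k
  refine ⟨C, hC0, fun j hj x => ?_⟩
  by_cases hx : x ∈ tsupport ζ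
  · rw [Set.indicator_of_mem hx]
    simpa [pw] using hC j hj x
  · have : iteratedFDeriv ℝ j ζ x = 0 := by
      by_contra h
      exact hx (support_iteratedFDeriv_subset (𝕜 := ℝ) j h)
    rw [this, Set.indicator_of_notMem hx]; simp

lemma abs_ang_le (W : List (Lt d)) : ang W ≤ W.length := by
  induction W with
  | nil => simp [ang]
  | cons l W ih =>
    rw [ang_cons, List.length_cons]
    have : angl l ≤ 1 := by unfold angl; split_ifs <;> simp
    push_cast; linarith

lemma brF_le (hf : ∀ r, 1 ≤ f r) {m : ℝ} {M : ℕ} (hm : |m| ≤ M) (w p : Q d) :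
    brF f (w, p) ^ m ≤ (d + 1) ^ M * pw M p := by
  have hb := one_le_brF f (w, p)
  have hd : (0 : ℝ) ≤ d := Nat.cast_nonneg d
  have h1 : brF f (w, p) ≤ (d + 1) * (1 + ‖p‖) := by
    rw [brF_jb]
    have h0 : jb (0 : Q d) = 1 := by simp [jb]
    have := jb_peetre (0 : Q d) (dg 1 (f w.1)⁻¹ p)
    rw [zero_add, h0, mul_one] at this
    refine this.trans ?_
    gcongr
    refine norm_co _ (norm_nonneg _) fun i => ?_
    have hF := hf w.1
    cases i with
    | none => simpa [dg, co] using co_le p none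
    | some i =>
      have h2 : co d (some i) (dg 1 (f w.1)⁻¹ p) = (f w.1)⁻¹ * co d (some i) p := rfl
      rw [h2, abs_mul, abs_of_pos (inv_pos.2 (by linarith))]
      exact (mul_le_of_le_one_left (abs_nonneg _) (inv_le_one_of_one_le₀ hF)).trans (co_le p _)
  refine (Real.rpow_le_rpow_of_exponent_le hb ((le_abs_self m).trans hm)).trans ?_
  rw [Real.rpow_natCast, pw, ← mul_pow]
  gcongr

lemma AW.lt (hfc : Continuous f) (hf : ∀ r, 1 ≤ f r) {m : ℝ} {c : ℤ} {M : ℕ} (hm : |m| ≤ M)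
    {g : Q d × Q d × Q d → ℂ} (h : ∀ N, ∃ K, 0 ≤ K ∧ AW f c m N K g) : LTm M g := by
  have hs : Sm g := by obtain ⟨K, _, h1⟩ := h 0; exact h1.1
  refine ⟨hs, fun ζ hζ hζc => ?_⟩
  have sζ : Sm (fun x : Q d × Q d × Q d => ζ x.1) := ContDiff.comp hζ contDiff_fst
  refine ⟨ContDiff.mul sζ hs, fun k => ?_⟩
  obtain ⟨K, hK, hA⟩ := h k
  obtain ⟨C1, hC1, h1⟩ := bd_cs hζ hζc k
  have h1' := h1.comp hζ (ContinuousLinearMap.fst ℝ (Q d) (Q d × Q d)) 0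
    (ContinuousLinearMap.norm_fst_le ℝ (Q d) (Q d × Q d)) le_rfl
  simp only [add_zero, one_pow, one_mul, ContinuousLinearMap.coe_fst'] at h1'
  have h2 : Bd k (fun x : Q d × Q d × Q d => f x.1.1 ^ (c + k) * pw M x)
      ((Fintype.card (Lt d) : ℝ) ^ k * (K * (d + 1) ^ M)) g := by
    refine bd_words (ld d) (lam3 d) lam3_x lam3_le k hs fun W hW x => ?_
    refine (hA.2 W hW x).trans ?_
    have b1 := one_le_brF f (x.1, x.2.1)
    have r1 := ((np_nonneg_le (m := m) b1 (np W)).trans (brF_le hf hm x.1 x.2.1)).trans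
      (mul_le_mul_of_nonneg_left ((pw_fst M x.2).trans (pw_snd M x)) (by positivity))
    have r2 : f x.1.1 ^ (c + ang W) ≤ f x.1.1 ^ (c + k) := by
      apply zpow_le_zpow_right₀ (hf _)
      have := abs_ang_le W
      have : (W.length : ℤ) ≤ k := by exact_mod_cast hW
      linarith
    have hF0 : 0 < f x.1.1 := lt_of_lt_of_le one_pos (hf _)
    calc _ ≤ K * (f x.1.1 ^ (c + k) * ((d + 1) ^ M * pw M x)) := by gcongr
      _ = _ := by ring
  have h3 := h1'.mul sζ hs h2
  have hcont : Continuous (fun y : Q d => f y.1 ^ (c + k)) :=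
    (hfc.comp continuous_fst).zpow₀ _ (fun y => Or.inl (lt_of_lt_of_le one_pos (hf _)).ne')
  obtain ⟨C2, hC2⟩ := hζc.isCompact.exists_bound_of_continuousOn (f := fun y : Q d => f y.1 ^ (c + k))
    hcont.continuousOn
  refine ⟨2 ^ k * (C1 * ((Fintype.card (Lt d) : ℝ) ^ k * (K * (d + 1) ^ M))) * |C2|, by positivity,
    h3.mono' fun x => ?_⟩
  rw [mul_assoc _ |C2|]
  refine mul_le_mul_of_nonneg_left ?_ (by positivity)
  have := (pw_pos M x).le
  by_cases hx : x.1 ∈ tsupport ζ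
  · rw [Set.indicator_of_mem hx, one_mul]
    have := (le_abs_self _).trans ((hC2 _ hx).trans (le_abs_self _))
    gcongr
  · rw [Set.indicator_of_notMem hx, zero_mul]; positivity

end LT


section Final
variable {d : ℕ} {f : ℝ → ℝ}

lemma LTm.wd {M : ℕ} {g : Q d × Q d × Q d → ℂ} (h : LTm M g) (W : List (Lt d)) :
    LTm M (_root_.wd (ld d) W g) := by
  induction W with
  | nil => exact h
  | cons l W ih => exact ih.dirD _

lemma LTm.Yopn {M : ℕ} {g : Q d × Q d × Q d → ℂ} (h : LTm M g) (j : ℕ) :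
    LTm M (_root_.Yop^[j] g) := by
  induction j with
  | zero => exact h
  | succ j ih =>
    rw [Function.iterate_succ_apply']
    exact LTm.sum Finset.univ fun i => ih.wd _

/-- words without the third slot -/
def W2 (W : List (Lt d)) : Prop := ∀ l ∈ W, ld d l = ((ld2 d l).1, (ld2 d l).2, (0 : Q d))

lemma mem_blk {k : Fin 3} {α : MIdx d} {l : Lt d} (h : l ∈ blk k α) : l.1 = k := by
  simp only [blk, List.mem_append, List.mem_flatMap, List.mem_replicate] at h
  rcases h with ⟨_, rfl⟩ | ⟨i, _, _, rfl⟩ <;> rfl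

lemma W2_blk (α β : MIdx d) : W2 (blk 0 α ++ blk 1 β) := by
  intro l hl
  rcases List.mem_append.1 hl with h | h
  · have := mem_blk h; simp [ld2, ld, this]
  · have := mem_blk h; simp [ld2, ld, this]

lemma np_le (W : List (Lt d)) : np W ≤ W.length := by
  induction W with
  | nil => simp [np]
  | cons l W ih =>
    rw [np_cons, List.length_cons]
    have : npl l ≤ 1 := by unfold npl; split_ifs <;> simp
    omega

lemma wd_Bop {M : ℕ} {s : ℝ} {g : Q d × Q d × Q d → ℂ} (h : LTm M g) {W : List (Lt d)} (hW : W2 W) :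
    wd (ld2 d) W (Bop d M s g) = Bop d M s (wd (ld d) W g) := by
  induction W with
  | nil => rfl
  | cons l W ih =>
    rw [wd_cons, ih (fun l hl => hW l (List.mem_cons_of_mem _ hl)), Bop_dirD (h.wd W), wd_cons,
      hW l List.mem_cons_self]

/-- inclusion at zero -/
def i0 (d : ℕ) : Q d × Q d →L[ℝ] Q d × Q d × Q d :=
  (ContinuousLinearMap.fst ℝ (Q d) (Q d)).prod ((ContinuousLinearMap.snd ℝ (Q d) (Q d)).prod 0)

lemma i0_apply (x : Q d × Q d) : i0 d x = (x.1, x.2, (0 : Q d)) := rfl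

lemma wd_i0 {g : Q d × Q d × Q d → ℂ} (h : Sm g) {W : List (Lt d)} (hW : W2 W) :
    wd (ld2 d) W (fun x => g (x.1, x.2, (0 : Q d))) = fun x => wd (ld d) W g (x.1, x.2, (0 : Q d)) := by
  induction W with
  | nil => rfl
  | cons l W ih =>
    rw [wd_cons, ih (fun l hl => hW l (List.mem_cons_of_mem _ hl)), wd_cons,
      hW l List.mem_cons_self]
    have := dirD_comp (h.wd (e := ld d) W) (i0 d) 0 (ld2 d l)
    simp only [add_zero, i0_apply] at this
    exact this

lemma Sm_i0 {g : Q d × Q d × Q d → ℂ} (h : Sm g) : Sm (fun x : Q d × Q d => g (x.1, x.2, (0 : Q d))) :=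
  ContDiff.comp h (i0 d).contDiff

lemma Xopn_slice {g : Q d × Q d × Q d → ℂ} (h : Sm g) (w p : Q d) (j : ℕ) :
    Xop^[j] (fun x : Q d × Q d => g (w, p + x.1, x.2))
      = fun x => Yop^[j] g (w, p + x.1, x.2) := by
  induction j with
  | zero => rfl
  | succ j ih =>
    rw [Function.iterate_succ_apply', Function.iterate_succ_apply', ih]
    have hs := h.Yopn j
    generalize Yop^[j] g = G at hs
    have key : ∀ (G : Q d × Q d × Q d → ℂ), Sm G → ∀ v : Q d × Q d,
        dirD v (fun x : Q d × Q d => G (w, p + x.1, x.2))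
          = fun x => dirD ((0 : Q d), v.1, v.2) G (w, p + x.1, x.2) := by
      intro G hG v
      have e : ∀ x : Q d × Q d, ContinuousLinearMap.inr ℝ (Q d) (Q d × Q d) x + (w, p, 0)
          = (w, p + x.1, x.2) := by
        intro x
        simp only [ContinuousLinearMap.inr_apply, Prod.mk_add_mk, zero_add]
        rw [show x + (p, 0) = (p + x.1, x.2) from Prod.ext (add_comm _ _) (add_zero _)]
      have := dirD_comp hG (ContinuousLinearMap.inr ℝ (Q d) (Q d × Q d)) (w, p, 0) v
      simp only [e] at this
      exact this
    funext x
    simp only [Xop, Yop]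
    refine Finset.sum_congr rfl fun i _ => ?_
    rw [key G hs, key _ (hs.dirD _)]
    rfl

lemma cJ_eq (t : ℝ) (a : Q d × Q d × Q d → ℂ) (j : ℕ) :
    cJ d t a j = fun x => (Complex.I ^ j / (j.factorial : ℂ)) *
      Yop^[j] (tA t a) (x.1, x.2, (0 : Q d)) := by
  funext x
  rw [← dpdq_eq]; rfl

lemma cJ_sm {t : ℝ} {a : Q d × Q d × Q d → ℂ} (ha : Sm a) (j : ℕ) : Sm (cJ d t a j) := by
  rw [cJ_eq]
  exact contDiff_const.mul (Sm_i0 ((tA_sm t ha).Yopn j))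

lemma wd_cJ {t : ℝ} {a : Q d × Q d × Q d → ℂ} (ha : Sm a) (j : ℕ) {W : List (Lt d)} (hW : W2 W) :
    wd (ld2 d) W (cJ d t a j) = fun x => (Complex.I ^ j / (j.factorial : ℂ)) *
      Yop^[j] (wd (ld d) W (tA t a)) (x.1, x.2, (0 : Q d)) := by
  rw [cJ_eq, wd_const_mul _ (Sm_i0 ((tA_sm t ha).Yopn j)), wd_i0 ((tA_sm t ha).Yopn j) hW,
    wd_Yopn _ _ (tA_sm t ha)]

lemma tA_lt (hf : GoodF f) {m t : ℝ} (ht : t ∈ Set.Icc (0 : ℝ) 1) {M : ℕ} (hm : |m| ≤ M)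
    {a : Q d × Q d × Q d → ℂ} (ha : IsAmp f m t a) : LTm M (tA t a) :=
  AW.lt hf.1.continuous hf.2.1 hm fun N => ⟨_, by
    have := ampNorm_nonneg (d := d) hf.2.1 (m := m) (t := t) (a := a) N
    positivity, amp_AW hf.2.1 ht ha N⟩

lemma rem_word (hf : GoodF f) {m t : ℝ} (ht : t ∈ Set.Icc (0 : ℝ) 1) {M : ℕ} (hm : |m| ≤ M)
    (N₀ n : ℕ) : ∃ C, 0 ≤ C ∧ ∃ N', ∀ W : List (Lt d), W.length ≤ N₀ → ∀ ℏ ∈ Set.Ioc (0 : ℝ) 1,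
      ∀ a : Q d × Q d × Q d → ℂ, IsAmp f m t a → ∀ x : Q d × Q d,
      ‖Bop d M ℏ (wd (ld d) W (tA t a)) x - ∑ j ∈ Finset.range n, (ℏ : ℂ) ^ j *
        ((Complex.I ^ j / (j.factorial : ℂ)) * Yop^[j] (wd (ld d) W (tA t a)) (x.1, x.2, (0 : Q d)))‖
      ≤ C * ℏ ^ n * ampNorm f m t N' a * (f x.1.1 ^ (ang W) * brF f x ^ (m - n - np W)) := by
  obtain ⟨C, hC0, hC⟩ := key_est d (M + N₀ + n)
  refine ⟨‖(kap d)⁻¹‖ * C * ((d + 1) ^ n * 2 ^ (k0 d (M + N₀ + n) + 2 * n + N₀)), by positivity,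
    k0 d (M + N₀ + n) + 2 * n + N₀, fun W hW ℏ hℏ a ha x => ?_⟩
  generalize hN' : k0 d (M + N₀ + n) + 2 * n + N₀ = N'
  have hA := amp_AW hf.2.1 ht ha N'
  have hL := tA_lt hf ht hm ha
  have hG := hL.wd W
  have hK0 := ampNorm_nonneg (d := d) hf.2.1 (m := m) (t := t) (a := a) N'
  have hA2 := AW.Yopn (N := k0 d (M + N₀ + n)) n
    (AW.wd (N := k0 d (M + N₀ + n) + 2 * n) W (hA.mono (by omega)))
  generalize wd (ld d) W (tA t a) = G at hG hA2 ⊢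
  obtain ⟨w, p⟩ := x
  have hnp : (np W : ℝ) ≤ N₀ := by exact_mod_cast (np_le W).trans hW
  have hord : |m - np W - n| ≤ ((M + N₀ + n : ℕ) : ℝ) := by
    push_cast
    have h1 : (0 : ℝ) ≤ np W := Nat.cast_nonneg _
    have h2 : (0 : ℝ) ≤ n := Nat.cast_nonneg _
    rw [abs_le] at hm ⊢
    constructor <;> linarith [hm.1, hm.2]
  have hT := osc_taylor (hG.slice w p) n
    (C * ((d + 1) ^ n * (2 ^ N' * ampNorm f m t N' a) *
      (f w.1 ^ (0 + ang W) * brF f (w, p) ^ (m - np W - n)))) (fun s hs => by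
      rw [Xopn_slice hG.1]
      simp only [zs_apply]
      exact hC f hf.2.1 _ _ _ s M hord (by omega) (by positivity) hs _ (hG.Yopn n) hA2 w p)
    ℏ ⟨hℏ.1.le, hℏ.2⟩
  simp only [Xopn_slice hG.1, zs_apply, Prod.fst_zero, Prod.snd_zero, add_zero] at hT
  have hkap : kap d ≠ 0 := kap_ne
  have e : Bop d M ℏ G (w, p) - ∑ j ∈ Finset.range n, (ℏ : ℂ) ^ j *
        ((Complex.I ^ j / (j.factorial : ℂ)) * Yop^[j] G (w, p, (0 : Q d)))
      = (kap d)⁻¹ * (osc d M (fun x => G (w, p + x.1, ℏ • x.2)) - kap d * ∑ j ∈ Finset.range n,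
        (ℏ : ℂ) ^ j * ((Complex.I ^ j / (j.factorial : ℂ)) * Yop^[j] G (w, p, (0 : Q d)))) := by
    rw [mul_sub, inv_mul_cancel_left₀ hkap]; rfl
  simp only []
  rw [e, norm_mul]
  refine (mul_le_mul_of_nonneg_left hT (norm_nonneg _)).trans (le_of_eq ?_)
  rw [zero_add, show m - n - (np W : ℝ) = m - np W - n by ring]
  ring

lemma W_conv (hf : ∀ r, 1 ≤ f r) (r : ℝ) (α β : MIdx d) :
    f r ^ (ang (blk 0 α ++ blk 1 β)) = f r ^ ((degA α : ℝ) - (degA β : ℝ)) := by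
  rw [ang_append, ang_blk0, ang_blk1, ← Real.rpow_intCast]
  push_cast
  rw [sub_eq_add_neg]

lemma np_W (α β : MIdx d) : np (blk 0 α ++ blk 1 β) = deg β := by
  rw [np_append, np_blk0, np_blk1, zero_add]

lemma len_W (α β : MIdx d) : (blk 0 α ++ blk 1 β).length = deg α + deg β := by
  rw [List.length_append, len_blk, len_blk]

lemma cJ_symbol (hf : GoodF f) {m t : ℝ} (ht : t ∈ Set.Icc (0 : ℝ) 1)
    {a : Q d × Q d × Q d → ℂ} (ha : IsAmp f m t a) (j : ℕ) :
    IsSymbol f (m - (j : ℝ)) (cJ d t a j) := by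
  refine ⟨cJ_sm ha.1 j, fun α β => ?_⟩
  have hA := amp_AW hf.2.1 ht ha (0 + 2 * j + (blk 0 α ++ blk 1 β).length)
  have h2 := (AW.Yopn j (AW.wd _ hA)).2 [] le_rfl
  refine ⟨‖Complex.I ^ j / (j.factorial : ℂ)‖ * ((d + 1) ^ j *
    (2 ^ (0 + 2 * j + (blk 0 α ++ blk 1 β).length) *
      ampNorm f m t (0 + 2 * j + (blk 0 α ++ blk 1 β).length) a)), fun x => ?_⟩
  rw [mderiv2_wd, wd_cJ ha.1 j (W2_blk α β), norm_mul]
  have h3 := h2 (x.1, x.2, 0)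
  generalize 0 + 2 * j + (blk 0 α ++ blk 1 β).length = N' at h3 ⊢
  rw [wd_nil, show ang ([] : List (Lt d)) = 0 from rfl, show np ([] : List (Lt d)) = 0 from rfl,
    add_zero, Nat.cast_zero, sub_zero] at h3
  rw [zero_add, W_conv hf.2.1, np_W] at h3
  rw [show m - (j : ℝ) - (deg β : ℝ) = m - deg β - j by ring, mul_assoc (_ * _), mul_assoc ‖_‖]
  exact mul_le_mul_of_nonneg_left h3 (norm_nonneg _)

lemma B_symbol (hf : GoodF f) {m t : ℝ} (ht : t ∈ Set.Icc (0 : ℝ) 1) {M : ℕ} (hm : |m| ≤ M)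
    {a : Q d × Q d × Q d → ℂ} (ha : IsAmp f m t a) {ℏ : ℝ} (hℏ : ℏ ∈ Set.Ioc (0 : ℝ) 1) :
    IsSymbol f m (Bop d M ℏ (tA t a)) := by
  have hL := tA_lt hf ht hm ha
  refine ⟨Bop_sm hL, fun α β => ?_⟩
  obtain ⟨C, hC0, N', hC⟩ := rem_word (d := d) hf ht hm (blk 0 α ++ blk 1 β).length 0
  refine ⟨C * ampNorm f m t N' a, fun x => ?_⟩
  have := hC (blk 0 α ++ blk 1 β) le_rfl ℏ hℏ a ha x
  simp only [Finset.range_zero, Finset.sum_empty, sub_zero, pow_zero, mul_one, Nat.cast_zero,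
    W_conv hf.2.1, np_W] at this
  rw [mderiv2_wd, wd_Bop hL (W2_blk α β), mul_assoc (_ * _)]
  exact this

lemma rem_symNorm (hf : GoodF f) {m t : ℝ} (ht : t ∈ Set.Icc (0 : ℝ) 1) {M : ℕ} (hm : |m| ≤ M)
    (N N₀ : ℕ) : ∃ C > (0 : ℝ), ∃ N' : ℕ, ∀ ℏ ∈ Set.Ioc (0 : ℝ) 1,
        ∀ a : Q d × Q d × Q d → ℂ, IsAmp f m t a →
          symNorm f (m - (N : ℝ) - 1) N₀
            (fun x => Bop d M ℏ (tA t a) x - ∑ j ∈ Finset.range (N + 1), (ℏ : ℂ) ^ j * cJ d t a j x)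
            ≤ C * ℏ ^ (N + 1) * ampNorm f m t N' a := by
  obtain ⟨C, hC0, N', hC⟩ := rem_word (d := d) hf ht hm N₀ (N + 1)
  refine ⟨(idxSet d N₀).card * ((idxSet d N₀).card * C) + 1, by positivity, N',
    fun ℏ hℏ a ha => ?_⟩
  have hL := tA_lt hf ht hm ha
  have hK0 := ampNorm_nonneg (d := d) hf.2.1 (m := m) (t := t) (a := a) N'
  have hh : 0 ≤ ℏ := hℏ.1.le
  have hR : 0 ≤ C * ℏ ^ (N + 1) * ampNorm f m t N' a := by positivity
  have main : symNorm f (m - (N : ℝ) - 1) N₀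
      (fun x => Bop d M ℏ (tA t a) x - ∑ j ∈ Finset.range (N + 1), (ℏ : ℂ) ^ j * cJ d t a j x)
      ≤ ∑ α ∈ idxSet d N₀, ∑ β ∈ idxSet d N₀, C * ℏ ^ (N + 1) * ampNorm f m t N' a := by
    refine Finset.sum_le_sum fun α _ => Finset.sum_le_sum fun β _ => ?_
    split_ifs with hd
    · refine Real.iSup_le (fun x => ?_) hR
      have h1 := hC (blk 0 α ++ blk 1 β) (by rw [len_W]; exact hd) ℏ hℏ a ha x
      rw [W_conv hf.2.1, np_W] at h1
      have hF : 0 < f x.1.1 := by linarith [hf.2.1 x.1.1]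
      have hb : 0 < brF f x := by linarith [one_le_brF f x]
      rw [w_bal hF hb (c := (degA α : ℝ) - degA β) (e := m - (N + 1 : ℕ) - deg β) (by ring)
        (by push_cast; ring), mderiv2_wd,
        wd_sub _ (Bop_sm hL) (ContDiff.sum fun j _ => contDiff_const.mul (cJ_sm ha.1 j)),
        wd_Bop hL (W2_blk α β),
        wd_sum _ _ (fun j => contDiff_const.mul (cJ_sm ha.1 j))]
      simp only [wd_const_mul _ (cJ_sm ha.1 _), wd_cJ ha.1 _ (W2_blk α β)]
      exact h1
    · exact hR
  refine main.trans ?_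
  simp only [Finset.sum_const, nsmul_eq_mul]
  have : 0 ≤ ℏ ^ (N + 1) * ampNorm f m t N' a := by positivity
  nlinarith

end Final

/-- asymptotic expansion of the symbol `b^t` associated with an amplitude. -/
theorem statement5 (d : ℕ) (f : ℝ → ℝ) (hf : GoodF f) (m t : ℝ)
    (ht : t ∈ Set.Icc (0 : ℝ) 1) :
    (∀ a : Q d × Q d × Q d → ℂ, IsAmp f m t a → ∀ j : ℕ,
      IsSymbol f (m - (j : ℝ)) (cJ d t a j)) ∧
    ∃ B : ℝ → (Q d × Q d × Q d → ℂ) → (Q d × Q d → ℂ),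
      (∀ ℏ ∈ Set.Ioc (0 : ℝ) 1, ∀ a : Q d × Q d × Q d → ℂ, IsAmp f m t a →
        IsSymbol f m (B ℏ a) ∧ ∀ u : Q d → ℂ, IsCc u → ∀ q : Q d,
          OpAmp ℏ a u q = Op ℏ t (B ℏ a) u q) ∧
      ∀ N N₀ : ℕ, ∃ C > (0 : ℝ), ∃ N' : ℕ, ∀ ℏ ∈ Set.Ioc (0 : ℝ) 1,
        ∀ a : Q d × Q d × Q d → ℂ, IsAmp f m t a →
          symNorm f (m - (N : ℝ) - 1) N₀
            (fun x => B ℏ a x - ∑ j ∈ Finset.range (N + 1), (ℏ : ℂ) ^ j * cJ d t a j x)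
            ≤ C * ℏ ^ (N + 1) * ampNorm f m t N' a := by
  refine ⟨fun a ha j => cJ_symbol hf ht ha j, fun ℏ a => Bop d ⌈|m|⌉₊ ℏ (tA t a), ?_, ?_⟩
  · intro ℏ hℏ a ha
    exact ⟨B_symbol hf ht (Nat.le_ceil _) ha hℏ, fun u hu q =>
      op_eq (tA_lt hf ht (Nat.le_ceil _) ha) hℏ.1 hu q⟩
  · exact fun N N₀ => rem_symNorm hf ht (Nat.le_ceil _) N N₀

end
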